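/- For every integer n ≥ 3, the generalized 3-connectivity of the alternating group graph satisfies κ₃(AG_n) = 2n − 5. -/

import Mathlib

/-- There exist `r` internally disjoint trees connecting `S` in `G`: `r` pairwise
edge-disjoint trees `T₁, …, T_r` of `G`, each containing `S`, with
`V(T_a) ∩ V(T_b) = S` for all `a ≠ b`. -/
def ConnectsSet {V : Type*} (G : SimpleGraph V) (S : Set V) (r : ℕ) : Prop :=
  ∃ T : Fin r → G.Subgraph,
    (∀ a, (T a).coe.IsTree) ∧
    (∀ a, S ⊆ (T a).verts) ∧
    (∀ a b, a ≠ b → (T a).verts ∩ (T b).verts = S) ∧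
    (∀ a b, a ≠ b → Disjoint (T a).edgeSet (T b).edgeSet)

/-- `κ_G(S)`: the maximum number of internally disjoint trees connecting `S` in `G`. -/
noncomputable def treeConn {V : Type*} (G : SimpleGraph V) (S : Set V) : ℕ :=
  sSup {r | ConnectsSet G S r}

/-- The generalized 3-connectivity `κ₃(G) = min {κ_G(S) : S ⊆ V(G), |S| = 3}`. -/
noncomputable def kappa3 {V : Type*} (G : SimpleGraph V) : ℕ :=
  sInf {k | ∃ S : Set V, S.ncard = 3 ∧ treeConn G S = k}

/-- The alternating group graph `AG_n`: the Cayley graph of the alternating group `A_n`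
with connection set `{(1 2 i), (1 i 2) : 3 ≤ i ≤ n}`; here positions are `0`-based, the
3-cycle `(1 2 i)` is `swap 0 i * swap 0 1`, and `(1 i 2)` is its inverse. -/
def altGroupGraph (n : ℕ) (hn : 3 ≤ n) : SimpleGraph ↥(alternatingGroup (Fin n)) :=
  SimpleGraph.fromRel (fun x y => ∃ i : Fin n, 2 ≤ (i : ℕ) ∧
    ((y : Equiv.Perm (Fin n)) =
        (x : Equiv.Perm (Fin n)) *
          (Equiv.swap ⟨0, by omega⟩ i * Equiv.swap ⟨0, by omega⟩ ⟨1, by omega⟩) ∨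
      (y : Equiv.Perm (Fin n)) =
        (x : Equiv.Perm (Fin n)) *
          (Equiv.swap ⟨0, by omega⟩ i * Equiv.swap ⟨0, by omega⟩ ⟨1, by omega⟩)⁻¹))

/-! ### Menger's theorem -/

namespace SimpleGraph

variable {V : Type*} {G : SimpleGraph V}

/-- Every walk that meets a set has an initial segment meeting it exactly at its end. -/
lemma Walk.exists_prefix (Y : Set V) {a b : V} (p : G.Walk a b)
    (h : ∃ v ∈ p.support, v ∈ Y) :
    ∃ v ∈ Y, ∃ q : G.Walk a v, q.support ⊆ p.support ∧ (∀ w ∈ q.support, w ∈ Y → w = v) ∧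
      ∀ e ∈ q.edges, ∃ u ∈ e, u ∉ Y := by
  induction p with
  | nil =>
    obtain ⟨v, hv, hY⟩ := h
    simp only [support_nil, List.mem_singleton] at hv
    subst hv
    exact ⟨v, hY, Walk.nil, by simp, by simp, by simp⟩
  | @cons a c b hac p ih =>
    by_cases ha : a ∈ Y
    · exact ⟨a, ha, Walk.nil, by simp, by simp, by simp⟩
    · obtain ⟨v, hv, q, hq, hqv, hqe⟩ := ih (by
        obtain ⟨v, hv, hY⟩ := h
        rw [support_cons, List.mem_cons] at hv
        rcases hv with rfl | hv
        · exact absurd hY ha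
        · exact ⟨v, hv, hY⟩)
      refine ⟨v, hv, Walk.cons hac q, ?_, ?_, ?_⟩
      · simp only [support_cons]
        exact List.cons_subset_cons _ hq
      · intro w hw hwY
        rw [support_cons, List.mem_cons] at hw
        rcases hw with rfl | hw
        · exact absurd hwY ha
        · exact hqv w hw hwY
      · intro e he
        rw [edges_cons, List.mem_cons] at he
        rcases he with rfl | he
        · exact ⟨a, by simp, ha⟩
        · exact hqe e he

/-- `Y` meets every walk from `A` to `B`. -/
def Separates (G : SimpleGraph V) (A B Y : Set V) : Prop :=
  ∀ a ∈ A, ∀ b ∈ B, ∀ p : G.Walk a b, ∃ v ∈ p.support, v ∈ Y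

lemma Separates.symm {A B Y : Set V} (h : G.Separates A B Y) : G.Separates B A Y := by
  intro b hb a ha p
  obtain ⟨v, hv, hY⟩ := h a ha b hb p.reverse
  exact ⟨v, by simpa using hv, hY⟩

/-- There are `k` disjoint walks from `A` to `B`. -/
def Linked (G : SimpleGraph V) (A B : Set V) (k : ℕ) : Prop :=
  ∃ (a b : Fin k → V) (p : ∀ i, G.Walk (a i) (b i)), (∀ i, a i ∈ A) ∧ (∀ i, b i ∈ B) ∧
    (∀ i, (p i).IsPath) ∧ ∀ i j, i ≠ j → ∀ v ∈ (p i).support, v ∉ (p j).support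

lemma Linked.mono {G' : SimpleGraph V} (hle : G' ≤ G) {A B : Set V} {k : ℕ}
    (h : G'.Linked A B k) : G.Linked A B k := by
  obtain ⟨a, b, p, ha, hb, hp, hd⟩ := h
  refine ⟨a, b, fun i => (p i).mapLe hle, ha, hb, fun i => ?_, ?_⟩
  · simpa using hp i
  · simpa using hd

/-- In the one-edge deletion step of Menger's theorem, a set separating `A` from
`insert x Y` after deleting the edge `xy` separates `A` from `B` beforehand. -/
lemma Separates.of_deleteEdges {A B Y Z : Set V} {x y : V}
    (hY : (G.deleteEdges {s(x, y)}).Separates A B Y) (hyY : y ∉ Y)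
    (hy : ∀ a ∈ A, ∀ p : (G.deleteEdges {s(x, y)}).Walk a y, ∃ v ∈ p.support, v ∈ Y)
    (hZ : (G.deleteEdges {s(x, y)}).Separates A (insert x Y) Z) : G.Separates A B Z := by
  intro a ha b hb p
  have hmeet : ∃ v ∈ p.support, v ∈ insert x (insert y Y) := by
    by_cases hx : x ∈ p.support
    · exact ⟨x, hx, by simp⟩
    · have he : s(x, y) ∉ p.edges := fun he => hx (p.fst_mem_support_of_mem_edges he)
      obtain ⟨v, hv, hvY⟩ := hY a ha b hb (p.toDeleteEdges {s(x, y)} (by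
        intro e he' hes; rw [Set.mem_singleton_iff] at hes; exact he (hes ▸ he')))
      exact ⟨v, by simpa [Walk.toDeleteEdges] using hv, by simp [hvY]⟩
  obtain ⟨v, hv, q, hqp, hqv, hqe⟩ := p.exists_prefix _ hmeet
  have hq' : ∀ e ∈ q.edges, e ∉ ({s(x, y)} : Set (Sym2 V)) := by
    intro e he hes
    rw [Set.mem_singleton_iff] at hes
    obtain ⟨u, hu, hnu⟩ := hqe e he
    rw [hes, Sym2.mem_iff] at hu
    rcases hu with rfl | rfl <;> simp at hnu
  set r := q.toDeleteEdges {s(x, y)} hq' with hr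
  have hrs : r.support = q.support := by simp [hr, Walk.toDeleteEdges]
  by_cases hvx : v ∈ insert x Y
  · obtain ⟨w, hw, hwZ⟩ := hZ a ha v hvx r
    exact ⟨w, hqp (hrs ▸ hw), hwZ⟩
  · have hvy : v = y := by
      simp only [Set.mem_insert_iff, not_or] at hv hvx
      tauto
    subst hvy
    obtain ⟨w, hw, hwY⟩ := hy a ha r
    have := hqv w (hrs ▸ hw) (by simp [hwY])
    exact absurd (this ▸ hwY) hyY

/-- A linkage of full size onto a set `Y` meets `Y` only in the ends of its walks. -/
lemma linkage_ends {k : ℕ} {Y : Finset V} (hk : Y.card = k) {a b : Fin k → V}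
    {p : ∀ i, G.Walk (a i) (b i)} (hb : ∀ i, b i ∈ Y)
    (hd : ∀ i j, i ≠ j → ∀ v ∈ (p i).support, v ∉ (p j).support) :
    (∀ y ∈ Y, ∃ i, b i = y) ∧ Function.Injective b ∧
      ∀ i, ∀ v ∈ (p i).support, v ∈ Y → v = b i := by
  classical
  have hinj : Function.Injective b := by
    intro i j hij
    by_contra hne
    exact hd i j hne (b i) (by simp) (by rw [hij]; simp)
  have hsurj : ∀ y ∈ Y, ∃ i, b i = y := by
    have himg : Finset.univ.image b = Y := by
      apply Finset.eq_of_subset_of_card_le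
      · intro v hv
        obtain ⟨i, -, rfl⟩ := Finset.mem_image.1 hv
        exact hb i
      · rw [Finset.card_image_of_injective _ hinj, hk]; simp
    intro y hy
    rw [← himg] at hy
    simpa using hy
  refine ⟨hsurj, hinj, ?_⟩
  intro i v hv hvY
  obtain ⟨j, rfl⟩ := hsurj v hvY
  by_contra hne
  have hij : i ≠ j := fun h => hne (by rw [h])
  exact hd i j hij _ hv (by simp)

/-- **Menger's theorem**, the set version: if every set separating `A` from `B` has at least
`k` vertices, there are `k` disjoint paths from `A` to `B`. -/
theorem menger [Finite V] (k : ℕ) (G : SimpleGraph V) (A B : Set V)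
    (h : ∀ Y : Finset V, G.Separates A B Y → k ≤ Y.card) : G.Linked A B k := by
  classical
  have := Fintype.ofFinite V
  induction hn : G.edgeSet.ncard using Nat.strong_induction_on generalizing G A B with
  | _ n ih =>
  by_cases hE : G = ⊥
  · subst hE
    have hcard := h (A ∩ B).toFinset (by
      intro a ha b hb p
      have hab : a = b := by
        cases p with
        | nil => rfl
        | cons h' _ => exact absurd h' (by simp)
      subst hab
      exact ⟨a, by simp, by simp [ha, hb]⟩)
    obtain ⟨f⟩ : Nonempty (Fin k ↪ (A ∩ B).toFinset) :=
      Function.Embedding.nonempty_of_card_le (by rwa [Fintype.card_fin, Fintype.card_coe])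
    refine ⟨fun i => f i, fun i => f i, fun i => Walk.nil, ?_, ?_, by simp, ?_⟩
    · intro i; have := (f i).2; simp only [Set.mem_toFinset] at this; exact this.1
    · intro i; have := (f i).2; simp only [Set.mem_toFinset] at this; exact this.2
    · intro i j hij v hv hv'
      simp only [Walk.support_nil, List.mem_singleton] at hv hv'
      exact hij (f.injective (Subtype.ext (hv.symm.trans hv')))
  obtain ⟨x₀, y₀, hxy₀⟩ : ∃ x y, G.Adj x y := by
    by_contra hne
    push Not at hne
    exact hE (by ext u v; simpa using hne u v)
  have hlt : ∀ x y, G.Adj x y → (G.deleteEdges {s(x, y)}).edgeSet.ncard < n := by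
    intro x y hxy
    rw [← hn]
    refine Set.ncard_lt_ncard ?_
    rw [edgeSet_ssubset_edgeSet]
    refine lt_of_le_of_ne (deleteEdges_le _) fun heq => ?_
    have : (G.deleteEdges {s(x, y)}).Adj x y := by rw [heq]; exact hxy
    simp [deleteEdges_adj] at this
  by_cases hG' : ∀ Y : Finset V, (G.deleteEdges {s(x₀, y₀)}).Separates A B Y → k ≤ Y.card
  · exact (ih _ (hlt _ _ hxy₀) _ A B hG' rfl).mono (deleteEdges_le _)
  push Not at hG'
  obtain ⟨Y, hY₀, hYk⟩ := hG'
  -- orient the edge so that its first end is on the side of `A`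
  obtain ⟨x, y, hxy, hY, a₀, ha₀, p₀, hp₀, b₀, hb₀, q₀, hq₀⟩ : ∃ x y, ∃ _ : G.Adj x y,
      ∃ _ : (G.deleteEdges {s(x, y)}).Separates A B Y, ∃ a ∈ A,
      ∃ p : (G.deleteEdges {s(x, y)}).Walk a x, ∃ _ : ∀ v ∈ p.support, v ∉ Y, ∃ b ∈ B,
      ∃ q : (G.deleteEdges {s(x, y)}).Walk b y, ∀ v ∈ q.support, v ∉ Y := by
    have hns : ¬ G.Separates A B Y := fun hs => absurd (h Y hs) (by omega)
    unfold Separates at hns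
    push Not at hns
    obtain ⟨a, ha, b, hb, p, hp⟩ := hns
    have hmeet : ∃ v ∈ p.support, v ∈ ({x₀, y₀} : Set V) := by
      by_contra hno
      push Not at hno
      have hx : x₀ ∉ p.support := fun hx => hno x₀ hx (by simp)
      obtain ⟨v, hv, hvY⟩ := hY₀ a ha b hb (p.toDeleteEdges {s(x₀, y₀)} (by
        intro e he' hes
        rw [Set.mem_singleton_iff] at hes
        exact hx (p.fst_mem_support_of_mem_edges (hes ▸ he'))))
      exact hp v (by simpa [Walk.toDeleteEdges] using hv) hvY
    have key : ∀ {c d : V} (p : G.Walk c d), (∀ v ∈ p.support, v ∉ Y) →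
        (∃ v ∈ p.support, v ∈ ({x₀, y₀} : Set V)) → ∃ v ∈ ({x₀, y₀} : Set V),
        ∃ q : (G.deleteEdges {s(x₀, y₀)}).Walk c v, ∀ w ∈ q.support, w ∉ Y := by
      intro c d p hp hm
      obtain ⟨v, hv, q, hqp, -, hqe⟩ := p.exists_prefix _ hm
      refine ⟨v, hv, q.toDeleteEdges {s(x₀, y₀)} ?_, ?_⟩
      · intro e he hes
        rw [Set.mem_singleton_iff] at hes
        obtain ⟨u, hu, hnu⟩ := hqe e he
        rw [hes, Sym2.mem_iff] at hu
        simp only [Set.mem_insert_iff, Set.mem_singleton_iff, not_or] at hnu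
        tauto
      · intro w hw
        exact hp w (hqp (by simpa [Walk.toDeleteEdges] using hw))
    obtain ⟨u, hu, p', hp'⟩ := key p hp hmeet
    obtain ⟨v, hv, q', hq'⟩ := key p.reverse (by simpa using hp) (by simpa using hmeet)
    have huv : u ≠ v := by
      rintro rfl
      obtain ⟨w, hw, hwY⟩ := hY₀ a ha b hb (p'.append q'.reverse)
      rw [Walk.mem_support_append_iff] at hw
      rcases hw with hw | hw
      · exact hp' w hw hwY
      · exact hq' w (by simpa using hw) hwY
    simp only [Set.mem_insert_iff, Set.mem_singleton_iff] at hu hv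
    rcases hu with rfl | rfl <;> rcases hv with rfl | rfl
    · exact absurd rfl huv
    · exact ⟨u, v, hxy₀, hY₀, a, ha, p', hp', b, hb, q', hq'⟩
    · refine ⟨u, v, hxy₀.symm, ?_⟩
      rw [show s(u, v) = s(v, u) from Sym2.eq_swap]
      exact ⟨hY₀, a, ha, p', hp', b, hb, q', hq'⟩
    · exact absurd rfl huv
  have hxY : x ∉ Y := hp₀ x (by simp)
  have hyY : y ∉ Y := hq₀ y (by simp)
  have hAy : ∀ a ∈ A, ∀ p : (G.deleteEdges {s(x, y)}).Walk a y, ∃ v ∈ p.support, v ∈ Y := by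
    intro a ha p
    obtain ⟨v, hv, hvY⟩ := hY a ha b₀ hb₀ (p.append q₀.reverse)
    rw [Walk.mem_support_append_iff] at hv
    rcases hv with hv | hv
    · exact ⟨v, hv, hvY⟩
    · exact absurd hvY (hq₀ v (by simpa using hv))
  have hBx : ∀ b ∈ B, ∀ p : (G.deleteEdges {s(x, y)}).Walk b x, ∃ v ∈ p.support, v ∈ Y := by
    intro b hb p
    obtain ⟨v, hv, hvY⟩ := hY a₀ ha₀ b hb (p₀.append p.reverse)
    rw [Walk.mem_support_append_iff] at hv
    rcases hv with hv | hv
    · exact absurd hvY (hp₀ v hv)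
    · exact ⟨v, by simpa using hv, hvY⟩
  have hsA : ∀ Z : Finset V, (G.deleteEdges {s(x, y)}).Separates A (insert x Y : Finset V) Z →
      k ≤ Z.card := fun Z hZ => h Z (Separates.of_deleteEdges hY hyY hAy (by simpa using hZ))
  have hsB : ∀ Z : Finset V, (G.deleteEdges {s(x, y)}).Separates B (insert y Y : Finset V) Z →
      k ≤ Z.card := fun Z hZ => by
    rw [show s(x, y) = s(y, x) from Sym2.eq_swap] at hY hBx hZ
    exact h Z (Separates.of_deleteEdges hY.symm hxY hBx (by simpa using hZ)).symm
  have htriv : ∀ (C : Set V) (Z : Finset V), (G.deleteEdges {s(x, y)}).Separates C Z Z :=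
    fun _ Z a _ b hb p => ⟨b, by simp, hb⟩
  have hcx : (insert x Y).card = k := by
    have := hsA _ (htriv A _)
    rw [Finset.card_insert_of_notMem hxY] at this ⊢
    omega
  have hcy : (insert y Y).card = k := by
    rw [Finset.card_insert_of_notMem hyY, ← Finset.card_insert_of_notMem hxY, hcx]
  obtain ⟨a, b, p, ha, hb, hp, hpd⟩ := ih _ (hlt x y hxy) _ A _ hsA rfl
  obtain ⟨c, d, q, hc, hd, hq, hqd⟩ := ih _ (hlt x y hxy) _ B _ hsB rfl
  obtain ⟨hbs, hbi, hbe⟩ := linkage_ends hcx hb hpd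
  obtain ⟨hds, hdi, hde⟩ := linkage_ends hcy hd hqd
  have hσ : ∀ i, ∃ j, d j = if b i = x then y else b i := by
    intro i
    apply hds
    have hbi := hb i
    split_ifs with hx
    · simp
    · simp only [Finset.coe_insert, Set.mem_insert_iff, Finset.mem_coe] at hbi
      simp; tauto
  choose σ hσ using hσ
  have hσi : Function.Injective σ := by
    intro i j hij
    have h1 := hσ i
    rw [hij, hσ j] at h1
    have hi := hb i
    have hj := hb j
    simp only [Finset.coe_insert, Set.mem_insert_iff, Finset.mem_coe] at hi hj
    apply hbi
    split_ifs at h1 <;> grind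
  have hcross : ∀ i j, ∀ v ∈ (p i).support, v ∈ (q j).support → j = σ i := by
    intro i j v hvp hvq
    by_cases hvY : v ∈ Y
    · have h1 := hbe i v hvp (by simp [hvY])
      have h2 := hde j v hvq (by simp [hvY])
      have hx : b i ≠ x := by
        rw [← h1]
        rintro rfl
        exact hxY hvY
      apply hdi
      rw [hσ, if_neg hx, ← h1, h2]
    · exfalso
      have aux : ∀ {c d : V} {z : V} (r : (G.deleteEdges {s(x, y)}).Walk c d), r.IsPath →
          (∀ v ∈ r.support, v ∈ insert z Y → v = d) → ∀ hv : v ∈ r.support,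
          ∀ w ∈ (r.takeUntil v hv).support, w ∉ Y := by
        intro c d z r hr hrd hv w hw hwY
        have hwd := hrd w (r.support_takeUntil_subset_support hv hw) (by simp [hwY])
        by_cases hvd : v = d
        · exact hvY (by rw [hvd, ← hwd]; exact hwY)
        · exact Walk.endpoint_notMem_support_takeUntil hr hv (Ne.symm hvd) (hwd ▸ hw)
      obtain ⟨w, hw, hwY⟩ := hY _ (ha i) _ (hc j)
        (((p i).takeUntil v hvp).append ((q j).takeUntil v hvq).reverse)
      rw [Walk.mem_support_append_iff] at hw
      rcases hw with hw | hw
      · exact aux (p i) (hp i) (hbe i) hvp w hw hwY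
      · exact aux (q j) (hq j) (hde j) hvq w (by simpa using hw) hwY
  have hle := deleteEdges_le (G := G) {s(x, y)}
  have hr : ∀ i, ∃ r : G.Walk (a i) (c (σ i)), r.IsPath ∧
      ∀ v ∈ r.support, v ∈ (p i).support ∨ v ∈ (q (σ i)).support := by
    intro i
    suffices ∃ r : G.Walk (a i) (c (σ i)),
        ∀ v ∈ r.support, v ∈ (p i).support ∨ v ∈ (q (σ i)).support by
      obtain ⟨r, hr⟩ := this
      exact ⟨r.bypass, r.bypass_isPath, fun v hv => hr v (r.support_bypass_subset_support hv)⟩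
    by_cases hx : b i = x
    · have hdy : d (σ i) = y := by rw [hσ, if_pos hx]
      refine ⟨((p i).mapLe hle).append (Walk.cons (?_ : G.Adj (b i) (d (σ i)))
        ((q (σ i)).mapLe hle).reverse), ?_⟩
      · rw [hx, hdy]; exact hxy
      · intro v hv
        rw [Walk.mem_support_append_iff, Walk.support_cons, List.mem_cons] at hv
        rcases hv with hv | rfl | hv
        · left; simpa using hv
        · left; simp
        · right; simpa using hv
    · have hdb : d (σ i) = b i := by rw [hσ, if_neg hx]
      refine ⟨((p i).mapLe hle).append (((q (σ i)).mapLe hle).copy rfl hdb).reverse, ?_⟩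
      intro v hv
      rw [Walk.mem_support_append_iff] at hv
      rcases hv with hv | hv
      · left; simpa using hv
      · right; simpa using hv
  choose r hrp hr using hr
  refine ⟨a, fun i => c (σ i), r, ha, fun i => hc _, hrp, ?_⟩
  intro i j hij v hvi hvj
  rcases hr i v hvi with h1 | h1 <;> rcases hr j v hvj with h2 | h2
  · exact hpd i j hij v h1 h2
  · exact hij (hσi (hcross i _ v h1 h2).symm)
  · exact hij (hσi (hcross j _ v h2 h1))
  · exact hqd _ _ (fun h => hij (hσi h)) v h1 h2

end SimpleGraph

/-! ### Connected vertex sets -/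

namespace SimpleGraph

variable {V : Type*} {G : SimpleGraph V}

/-- The set `A` induces a connected subgraph of `G`. -/
abbrev ConnOn (G : SimpleGraph V) (A : Set V) : Prop := (G.induce A).Connected

lemma ConnOn.nonempty' {A : Set V} (h : G.ConnOn A) : A.Nonempty := by
  obtain ⟨v⟩ := h.nonempty
  exact ⟨v, v.2⟩

lemma ConnOn.exists_walk {A : Set V} (h : G.ConnOn A) {u v : V} (hu : u ∈ A) (hv : v ∈ A) :
    ∃ p : G.Walk u v, ∀ w ∈ p.support, w ∈ A := by
  obtain ⟨p⟩ := h.preconnected ⟨u, hu⟩ ⟨v, hv⟩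
  have key : ∀ {a b : A} (_ : (G.induce A).Walk a b),
      ∃ p : G.Walk a b, ∀ w ∈ p.support, w ∈ A := by
    intro a b p
    induction p with
    | nil => exact ⟨Walk.nil, by simp⟩
    | @cons a c b hadj _ ih =>
      obtain ⟨q, hq⟩ := ih
      refine ⟨Walk.cons (v := (c : V)) (by simpa using hadj) q, ?_⟩
      simpa using hq
  exact key p

lemma connOn_of_walks {A : Set V} {u : V} (hu : u ∈ A)
    (h : ∀ v ∈ A, ∃ p : G.Walk u v, ∀ w ∈ p.support, w ∈ A) : G.ConnOn A := by
  refine induce_connected_of_patches u hu fun {v} hv => ?_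
  obtain ⟨p, hp⟩ := h v hv
  exact ⟨{w | w ∈ p.support}, hp, by simp, by simp, p.connected_induce_support _ _⟩

lemma connOn_singleton (v : V) : G.ConnOn {v} :=
  connOn_of_walks (Set.mem_singleton v) fun w hw => by
    rw [Set.mem_singleton_iff] at hw; subst hw
    exact ⟨Walk.nil, by simp⟩

lemma ConnOn.mono_graph {G' : SimpleGraph V} (hle : G' ≤ G) {A : Set V} (h : G'.ConnOn A) :
    G.ConnOn A := by
  obtain ⟨u, hu⟩ := h.nonempty'
  refine connOn_of_walks hu fun v hv => ?_
  obtain ⟨p, hp⟩ := h.exists_walk hu hv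
  exact ⟨p.mapLe hle, by simpa using hp⟩

/-- A connected set together with connected sets that meet it or are joined to it. -/
lemma ConnOn.union_iUnion {ι : Type*} {A : Set V} {B : ι → Set V} (hA : G.ConnOn A)
    (hB : ∀ i, G.ConnOn (B i)) (h : ∀ i, ∃ a ∈ A, ∃ b ∈ B i, a = b ∨ G.Adj a b) :
    G.ConnOn (A ∪ ⋃ i, B i) := by
  obtain ⟨u, hu⟩ := hA.nonempty'
  refine connOn_of_walks (Or.inl hu) ?_
  rintro v (hv | hv)
  · obtain ⟨p, hp⟩ := hA.exists_walk hu hv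
    exact ⟨p, fun w hw => Or.inl (hp w hw)⟩
  · rw [Set.mem_iUnion] at hv
    obtain ⟨i, hv⟩ := hv
    obtain ⟨a, ha, b, hb, hab⟩ := h i
    obtain ⟨p, hp⟩ := hA.exists_walk hu ha
    obtain ⟨q, hq⟩ := (hB i).exists_walk hb hv
    have hq' : ∀ w ∈ q.support, w ∈ A ∪ ⋃ i, B i :=
      fun w hw => Or.inr (Set.mem_iUnion.2 ⟨i, hq w hw⟩)
    rcases hab with rfl | hab
    · refine ⟨p.append q, fun w hw => ?_⟩
      rw [Walk.mem_support_append_iff] at hw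
      exact hw.elim (fun hw => Or.inl (hp w hw)) (hq' w)
    · refine ⟨p.append (Walk.cons hab q), fun w hw => ?_⟩
      rw [Walk.mem_support_append_iff, Walk.support_cons, List.mem_cons] at hw
      rcases hw with hw | rfl | hw
      · exact Or.inl (hp w hw)
      · exact Or.inl ha
      · exact hq' w hw

lemma ConnOn.union {A B : Set V} (hA : G.ConnOn A) (hB : G.ConnOn B)
    (h : ∃ a ∈ A, ∃ b ∈ B, a = b ∨ G.Adj a b) : G.ConnOn (A ∪ B) := by
  have := hA.union_iUnion (ι := Unit) (B := fun _ => B) (fun _ => hB) (fun _ => h)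
  rwa [Set.iUnion_const] at this

lemma ConnOn.insert {A : Set V} (hA : G.ConnOn A) {v : V} (h : ∃ a ∈ A, G.Adj a v) :
    G.ConnOn (Insert.insert v A) := by
  obtain ⟨a, ha, hav⟩ := h
  have := hA.union (connOn_singleton v) ⟨a, ha, v, rfl, Or.inr hav⟩
  rwa [Set.union_singleton] at this

/-- The union of connected sets any two of which are joined. -/
lemma connOn_biUnion {ι : Type*} {I : Set ι} {B : ι → Set V} (hI : I.Nonempty)
    (hB : ∀ i ∈ I, G.ConnOn (B i))
    (h : ∀ i ∈ I, ∀ j ∈ I, i ≠ j → ∃ a ∈ B i, ∃ b ∈ B j, G.Adj a b) :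
    G.ConnOn (⋃ i ∈ I, B i) := by
  obtain ⟨i, hi⟩ := hI
  have := (hB i hi).union_iUnion (ι := I) (B := fun j => B j) (fun j => hB j j.2) (by
    intro j
    by_cases hij : i = j
    · obtain ⟨u, hu⟩ := (hB i hi).nonempty'
      exact ⟨u, hu, u, hij ▸ hu, Or.inl rfl⟩
    · obtain ⟨a, ha, b, hb, hab⟩ := h i hi j j.2 hij
      exact ⟨a, ha, b, hb, Or.inr hab⟩)
  convert this using 1
  ext v
  simp only [Set.mem_iUnion, Set.mem_union, Subtype.exists, exists_prop]
  exact ⟨fun h => Or.inr h, fun h => h.elim (fun h => ⟨i, hi, h⟩) id⟩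

/-- A nonempty clique is connected. -/
lemma connOn_of_clique {A : Set V} (hA : A.Nonempty)
    (h : ∀ u ∈ A, ∀ v ∈ A, u ≠ v → G.Adj u v) : G.ConnOn A := by
  have := connOn_biUnion (G := G) (I := A) (B := fun v => {v}) hA
    (fun v _ => connOn_singleton v) (fun u hu v hv huv => ⟨u, rfl, v, rfl, h u hu v hv huv⟩)
  simpa using this

lemma ConnOn.image {V' : Type*} {G' : SimpleGraph V'} (e : G' →g G) {A : Set V'}
    (h : G'.ConnOn A) : G.ConnOn (e '' A) := by
  obtain ⟨u, hu⟩ := h.nonempty'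
  refine connOn_of_walks ⟨u, hu, rfl⟩ ?_
  rintro _ ⟨v, hv, rfl⟩
  obtain ⟨p, hp⟩ := h.exists_walk hu hv
  refine ⟨p.map e, fun w hw => ?_⟩
  rw [Walk.support_map, List.mem_map] at hw
  obtain ⟨x, hx, rfl⟩ := hw
  exact ⟨x, hp x hx, rfl⟩

lemma ConnOn.exists_crossing {U A : Set V} (hU : G.ConnOn U) {u v : V} (hu : u ∈ U) (huA : u ∈ A)
    (hv : v ∈ U) (hvA : v ∉ A) : ∃ a ∈ A, ∃ b ∈ U, b ∉ A ∧ G.Adj a b := by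
  obtain ⟨p, hp⟩ := hU.exists_walk hu hv
  obtain ⟨d, hd, h1, h2⟩ := p.exists_boundary_dart A huA hvA
  exact ⟨d.fst, h1, d.snd, hp _ (p.dart_snd_mem_support_of_mem_darts hd), h2, d.adj⟩

/-- Disjoint connected subsets of a connected set can be enlarged to a partition of it into
connected sets. -/
lemma ConnOn.exists_partition [Finite V] {ι : Type*} [Nonempty ι] {U : Set V} (hU : G.ConnOn U)
    (A : ι → Set V) (hA : ∀ i, G.ConnOn (A i)) (hAU : ∀ i, A i ⊆ U)
    (hd : ∀ i j, i ≠ j → Disjoint (A i) (A j)) :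
    ∃ B : ι → Set V, (∀ i, A i ⊆ B i) ∧ (∀ i, G.ConnOn (B i)) ∧ (∀ i, B i ⊆ U) ∧
      (∀ i j, i ≠ j → Disjoint (B i) (B j)) ∧ ∀ u ∈ U, ∃ i, u ∈ B i := by
  classical
  induction hn : (U \ ⋃ i, A i).ncard using Nat.strong_induction_on generalizing A with
  | _ n ih =>
  by_cases hcov : ∀ u ∈ U, ∃ i, u ∈ A i
  · exact ⟨A, fun _ => subset_rfl, hA, hAU, hd, hcov⟩
  push Not at hcov
  obtain ⟨v, hv, hvA⟩ := hcov
  obtain ⟨u, hu⟩ := (hA (Classical.arbitrary ι)).nonempty'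
  obtain ⟨a, ha, b, hb, hbA, hab⟩ := hU.exists_crossing (A := ⋃ i, A i) (hAU _ hu)
    (Set.mem_iUnion.2 ⟨_, hu⟩) hv (by simpa using hvA)
  obtain ⟨i, hai⟩ := Set.mem_iUnion.1 ha
  simp only [Set.mem_iUnion, not_exists] at hbA
  have hsub : ∀ j, A j ⊆ Function.update A i (Insert.insert b (A i)) j := by
    intro j
    by_cases hj : j = i
    · subst hj; simp
    · simp [hj]
  refine (ih _ ?_ (Function.update A i (Insert.insert b (A i))) ?_ ?_ ?_ rfl).imp
    fun B h => ⟨fun j => (hsub j).trans (h.1 j), h.2⟩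
  · rw [← hn]
    refine Set.ncard_lt_ncard ?_
    refine Set.ssubset_iff_of_subset (Set.sdiff_subset_sdiff_right (Set.iUnion_mono hsub)) |>.2
      ⟨b, ⟨hb, by simpa using hbA⟩, fun h => h.2 (Set.mem_iUnion.2 ⟨i, by simp⟩)⟩
  · intro j
    by_cases hj : j = i
    · subst hj
      simpa using (hA j).insert ⟨a, hai, hab⟩
    · simpa [hj] using hA j
  · intro j
    by_cases hj : j = i
    · subst hj
      simpa [Set.insert_subset_iff] using ⟨hb, hAU j⟩
    · simpa [hj] using hAU j
  · intro j k hjk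
    by_cases hj : j = i
    · subst hj
      simpa [hjk.symm] using ⟨hbA k, hd j k hjk⟩
    · by_cases hk : k = i
      · subst hk
        simpa [hj] using ⟨hbA j, hd j k hjk⟩
      · simpa [hj, hk] using hd j k hjk

/-- The **fan lemma**: if inside `U` no set with fewer than `|X|` vertices separates `z` from `X`,
there are disjoint connected sets joined to `z`, one for every member of `X`. -/
theorem exists_fan [Finite V] {U : Set V} {X : Finset V} {z : V} (hzX : z ∉ X)
    (h : ∀ Y : Finset V, z ∉ Y → Y.card < X.card →
      ∃ t ∈ X, ∃ p : G.Walk z t, ∀ v ∈ p.support, v ∈ U ∧ v ∉ Y) :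
    ∃ F : V → Set V, (∀ t ∈ X, G.ConnOn (F t) ∧ t ∈ F t ∧ F t ⊆ U ∧ z ∉ F t ∧
      ∃ v ∈ F t, G.Adj z v) ∧ ∀ s ∈ X, ∀ t ∈ X, s ≠ t → Disjoint (F s) (F t) := by
  classical
  let K : SimpleGraph V :=
    { Adj := fun u v => G.Adj u v ∧ (u ∈ U ∧ u ≠ z) ∧ (v ∈ U ∧ v ≠ z)
      symm := ⟨fun u v h => ⟨h.1.symm, h.2.2, h.2.1⟩⟩
      loopless := ⟨fun u h => h.1.ne rfl⟩ }
  have hKG : K ≤ G := fun u v h => h.1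
  have hK : ∀ {c d : V} (p : K.Walk c d), c ∈ U → c ≠ z → ∀ v ∈ p.support, v ∈ U ∧ v ≠ z := by
    intro c d p
    induction p with
    | nil => intro h1 h2; simpa using ⟨h1, h2⟩
    | cons hadj p ih =>
      intro h1 h2 v hv
      rw [Walk.support_cons, List.mem_cons] at hv
      rcases hv with rfl | hv
      · exact ⟨h1, h2⟩
      · exact ih hadj.2.2.1 hadj.2.2.2 v hv
  have hGK : ∀ {c d : V} (p : G.Walk c d), (∀ v ∈ p.support, v ∈ U ∧ v ≠ z) →
      ∃ q : K.Walk c d, q.support = p.support := by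
    intro c d p hp
    refine ⟨p.transfer K ?_, Walk.support_transfer _ _⟩
    intro e he
    induction e using Sym2.ind with
    | _ u v =>
    exact ⟨p.adj_of_mem_edges he, hp u (p.fst_mem_support_of_mem_edges he),
      hp v (p.snd_mem_support_of_mem_edges he)⟩
  obtain ⟨a, b, p, ha, hb, -, hd⟩ := menger X.card K {v | v ∈ U ∧ v ≠ z ∧ G.Adj z v} X (by
    intro Y hY
    by_contra hlt
    push Not at hlt
    obtain ⟨t, ht, p, hp⟩ := h (Y.erase z) (by simp)
      (lt_of_le_of_lt (Finset.card_le_card (Finset.erase_subset _ _)) hlt)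
    have hpp : p.bypass.IsPath := p.bypass_isPath
    have hps : ∀ v ∈ p.bypass.support, v ∈ U ∧ v ∉ Y.erase z :=
      fun v hv => hp v (p.support_bypass_subset_support hv)
    generalize p.bypass = r at hpp hps
    cases r with
    | nil => exact hzX ht
    | cons hadj r =>
      rw [Walk.cons_isPath_iff] at hpp
      have hr : ∀ v ∈ r.support, v ∈ U ∧ v ≠ z := by
        intro v hv
        refine ⟨(hps v (by simp [hv])).1, ?_⟩
        rintro rfl
        exact hpp.2 hv
      obtain ⟨q, hq⟩ := hGK r hr
      obtain ⟨v, hv, hvY⟩ := hY _ ⟨(hr _ (by simp)).1, (hr _ (by simp)).2, hadj⟩ t ht q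
      rw [hq] at hv
      exact (hps v (by simp [hv])).2 (Finset.mem_erase.2 ⟨(hr v hv).2, hvY⟩))
  obtain ⟨hbs, hbi, -⟩ := linkage_ends rfl hb hd
  refine ⟨fun t => {v | ∃ i, b i = t ∧ v ∈ (p i).support}, ?_, ?_⟩
  · intro t ht
    obtain ⟨i, rfl⟩ := hbs t ht
    have hF : {v | ∃ j, b j = b i ∧ v ∈ (p j).support} = {v | v ∈ (p i).support} := by
      ext v
      exact ⟨fun ⟨j, hj, hv⟩ => hbi hj ▸ hv, fun hv => ⟨i, rfl, hv⟩⟩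
    beta_reduce
    rw [hF]
    refine ⟨?_, ?_, ?_, ?_, ?_⟩
    · exact ConnOn.mono_graph hKG (p i).connected_induce_support
    · simp
    · intro v hv
      exact (hK _ (ha _).1 (ha _).2.1 v hv).1
    · intro hz
      exact (hK _ (ha _).1 (ha _).2.1 z hz).2 rfl
    · exact ⟨a i, by simp, (ha _).2.2⟩
  · intro s hs t ht hst
    refine Set.disjoint_left.2 ?_
    rintro v ⟨i, rfl, hi⟩ ⟨j, rfl, hj⟩
    exact hd i j (fun h => hst (by rw [h])) v hi hj

end SimpleGraph

/-! ### Internally disjoint trees from hubs -/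

namespace SimpleGraph

variable {V : Type*} {G : SimpleGraph V}

/-- A family, indexed by `ι`, of connected subgraphs `H a` of `G` on `S ∪ W a`, where the sets
`W a ⊆ C` are disjoint from `S` and from each other, and no edge inside `S` is used twice. -/
def GoodIn (G : SimpleGraph V) (S C : Set V) (ι : Type*) : Prop :=
  ∃ (H : ι → SimpleGraph V) (W : ι → Set V),
    (∀ a, H a ≤ G) ∧ (∀ a, (H a).ConnOn (S ∪ W a)) ∧ (∀ a, W a ⊆ C) ∧
    (∀ a, Disjoint S (W a)) ∧ (∀ a b, a ≠ b → Disjoint (W a) (W b)) ∧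
    ∀ a b, a ≠ b → ∀ u ∈ S, ∀ v ∈ S, (H a).Adj u v → ¬ (H b).Adj u v

/-- A connected set disjoint from `S` to which every member of `S` is joined. -/
def IsHub (G : SimpleGraph V) (S W : Set V) : Prop :=
  G.ConnOn W ∧ Disjoint S W ∧ ∀ s ∈ S, ∃ w ∈ W, G.Adj s w

lemma GoodIn.comap {S C : Set V} {ι κ : Type*} (h : G.GoodIn S C ι) (e : κ ↪ ι) :
    G.GoodIn S C κ := by
  obtain ⟨H, W, h1, h2, h3, h4, h5, h6⟩ := h
  exact ⟨fun a => H (e a), fun a => W (e a), fun _ => h1 _, fun _ => h2 _, fun _ => h3 _,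
    fun _ => h4 _, fun a b hab => h5 _ _ (e.injective.ne hab),
    fun a b hab => h6 _ _ (e.injective.ne hab)⟩

lemma GoodIn.of_card {S C : Set V} {ι : Type*} [Finite ι] (h : G.GoodIn S C ι) {r : ℕ}
    (hr : r ≤ Nat.card ι) : G.GoodIn S C (Fin r) := by
  have := Fintype.ofFinite ι
  rw [Nat.card_eq_fintype_card] at hr
  obtain ⟨e⟩ := Function.Embedding.nonempty_of_card_le (α := Fin r) (β := ι) (by simpa using hr)
  exact h.comap e

lemma goodIn_empty (S : Set V) : G.GoodIn S ∅ Empty :=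
  ⟨fun a => a.elim, fun a => a.elim, fun a => a.elim, fun a => a.elim, fun a => a.elim,
    fun a => a.elim, fun a => a.elim, fun a => a.elim⟩

lemma goodIn_unit {S W : Set V} (h : G.ConnOn (S ∪ W)) (hd : Disjoint S W) :
    G.GoodIn S W Unit :=
  ⟨fun _ => G, fun _ => W, fun _ => le_rfl, fun _ => h, fun _ => subset_rfl, fun _ => hd,
    fun _ _ hab => (hab rfl).elim, fun _ _ hab => (hab rfl).elim⟩

lemma GoodIn.map {V' : Type*} {G' : SimpleGraph V'} (e : G' ↪g G) {S C : Set V'} {ι : Type*}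
    (h : G'.GoodIn S C ι) : G.GoodIn (e '' S) (e '' C) ι := by
  obtain ⟨H, W, h1, h2, h3, h4, h5, h6⟩ := h
  refine ⟨fun a => (H a).map e.toEmbedding, fun a => e '' W a, fun a => ?_, fun a => ?_,
    fun a => Set.image_mono (h3 a), fun a => ?_, fun a b hab => ?_, fun a b hab => ?_⟩
  · intro u v huv
    rw [map_adj] at huv
    obtain ⟨u, v, huv, rfl, rfl⟩ := huv
    exact e.map_rel_iff.2 (h1 a huv)
  · rw [← Set.image_union]
    exact (h2 a).image (Embedding.map e.toEmbedding (H a)).toHom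
  · exact (Set.disjoint_image_iff e.injective).2 (h4 a)
  · exact (Set.disjoint_image_iff e.injective).2 (h5 a b hab)
  · rintro _ ⟨u, hu, rfl⟩ _ ⟨v, hv, rfl⟩ hadj hadj'
    exact h6 a b hab u hu v hv ((map_adj_apply (f := e.toEmbedding)).1 hadj)
      ((map_adj_apply (f := e.toEmbedding)).1 hadj')

/-- Adding hubs to a good family. -/
lemma GoodIn.sum {S C : Set V} {ι κ : Type*} (h : G.GoodIn S C ι) (B : κ → Set V)
    (hB : ∀ a, G.IsHub S (B a)) (hd : ∀ a b, a ≠ b → Disjoint (B a) (B b))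
    (hC : ∀ a, Disjoint C (B a)) : G.GoodIn S Set.univ (ι ⊕ κ) := by
  obtain ⟨H, W, h1, h2, h3, h4, h5, h6⟩ := h
  let K : SimpleGraph V :=
    { Adj := fun u v => G.Adj u v ∧ ¬ (u ∈ S ∧ v ∈ S)
      symm := ⟨fun u v h => ⟨h.1.symm, fun h' => h.2 h'.symm⟩⟩
      loopless := ⟨fun u h => h.1.ne rfl⟩ }
  refine ⟨Sum.elim H fun _ => K, Sum.elim W B, ?_, ?_, fun _ => Set.subset_univ _, ?_, ?_, ?_⟩
  · rintro (a | a)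
    · exact h1 a
    · exact fun u v h => h.1
  · rintro (a | a)
    · exact h2 a
    · obtain ⟨hc, hS, hadj⟩ := hB a
      have hK : K.ConnOn (B a) := by
        obtain ⟨u, hu⟩ := hc.nonempty'
        refine connOn_of_walks hu fun v hv => ?_
        obtain ⟨p, hp⟩ := hc.exists_walk hu hv
        refine ⟨p.transfer K ?_, by rwa [Walk.support_transfer]⟩
        intro e he
        induction e using Sym2.ind with
        | _ u v =>
        exact ⟨p.adj_of_mem_edges he, fun h =>
          Set.disjoint_left.1 hS h.1 (hp u (p.fst_mem_support_of_mem_edges he))⟩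
      have := hK.union_iUnion (ι := S) (B := fun s => {(s : V)})
        (fun s => connOn_singleton _) (fun s => by
          obtain ⟨w, hw, hsw⟩ := hadj s s.2
          exact ⟨w, hw, s, rfl, Or.inr
            ⟨hsw.symm, fun h => Set.disjoint_left.1 hS h.1 hw⟩⟩)
      have he : B a ∪ ⋃ s : S, {(s : V)} = S ∪ B a := by
        rw [Set.union_comm]
        congr 1
        ext v
        simp
      rw [he] at this
      exact this
  · rintro (a | a)
    · exact h4 a
    · exact (hB a).2.1
  · rintro (a | a) (b | b) hab
    · exact h5 a b (fun h => hab (by rw [h]))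
    · exact (hC b).mono_left (h3 a)
    · exact ((hC a).mono_left (h3 b)).symm
    · exact hd a b (fun h => hab (by rw [h]))
  · rintro (a | a) (b | b) hab u hu v hv hadj hadj'
    · exact h6 a b (fun h => hab (by rw [h])) u hu v hv hadj hadj'
    · exact hadj'.2 ⟨hu, hv⟩
    · exact hadj.2 ⟨hu, hv⟩
    · exact hadj.2 ⟨hu, hv⟩

lemma goodIn_of_hubs {S : Set V} {κ : Type*} (B : κ → Set V)
    (hB : ∀ a, G.IsHub S (B a)) (hd : ∀ a b, a ≠ b → Disjoint (B a) (B b)) :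
    G.GoodIn S Set.univ κ :=
  ((goodIn_empty S).sum B hB hd (by simp)).comap ⟨Sum.inr, Sum.inr_injective⟩

lemma GoodIn.connectsSet [Finite V] {S C : Set V} {r : ℕ} (h : G.GoodIn S C (Fin r)) :
    ConnectsSet G S r := by
  obtain ⟨H, W, h1, h2, h3, h4, h5, h6⟩ := h
  have hT := fun a => (h2 a).exists_isTree_le
  choose T hle hT using hT
  refine ⟨fun a =>
    { verts := S ∪ W a
      Adj := fun u v => ∃ (hu : u ∈ S ∪ W a) (hv : v ∈ S ∪ W a), (T a).Adj ⟨u, hu⟩ ⟨v, hv⟩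
      adj_sub := fun ⟨_, _, h⟩ => h1 a (hle a h)
      edge_vert := fun ⟨hu, _, _⟩ => hu
      symm := ⟨fun _ _ ⟨hu, hv, h⟩ => ⟨hv, hu, h.symm⟩⟩ }, fun a => ?_, fun a => ?_,
      fun a b hab => ?_, fun a b hab => ?_⟩
  · convert hT a
    ext u v
    exact ⟨fun ⟨_, _, h⟩ => h, fun h => ⟨u.2, v.2, h⟩⟩
  · exact Set.subset_union_left
  · change (S ∪ W a) ∩ (S ∪ W b) = S
    rw [← Set.union_inter_distrib_left, Set.disjoint_iff_inter_eq_empty.1 (h5 a b hab),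
      Set.union_empty]
  · rw [Set.disjoint_left]
    intro e
    induction e using Sym2.ind with
    | _ u v =>
    rintro ⟨hu, hv, h⟩ ⟨hu', hv', h'⟩
    have key : ∀ w ∈ S ∪ W a, w ∈ S ∪ W b → w ∈ S := by
      rintro w (hw | hw) (hw' | hw')
      · exact hw
      · exact hw
      · exact hw'
      · exact (Set.disjoint_left.1 (h5 a b hab) hw hw').elim
    exact h6 a b hab u (key u hu hu') v (key v hv hv') (hle a h) (hle b h')

lemma Subgraph.exists_adj_of_isTree {T : G.Subgraph} (hT : T.coe.IsTree) {x y : V}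
    (hx : x ∈ T.verts) (hy : y ∈ T.verts) (hxy : x ≠ y) : ∃ v, T.Adj x v := by
  obtain ⟨p⟩ := hT.connected.preconnected ⟨x, hx⟩ ⟨y, hy⟩
  cases p with
  | nil => exact (hxy rfl).elim
  | @cons _ v _ h _ => exact ⟨v, h⟩

lemma exists_injective_adj {S : Set V} {r : ℕ} {T : Fin r → G.Subgraph}
    (hT : ∀ a, (T a).coe.IsTree) (hS : ∀ a, S ⊆ (T a).verts)
    (hd : ∀ a b, a ≠ b → Disjoint (T a).edgeSet (T b).edgeSet) {x y : V}
    (hx : x ∈ S) (hy : y ∈ S) (hxy : x ≠ y) :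
    ∃ f : Fin r → G.neighborSet x, Function.Injective f ∧ ∀ a, (T a).Adj x (f a) := by
  have h := fun a => (T a).exists_adj_of_isTree (hT a) (hS a hx) (hS a hy) hxy
  choose f hf using h
  refine ⟨fun a => ⟨f a, (hf a).adj_sub⟩, fun a b hab => ?_, hf⟩
  by_contra hne
  have hab' : f a = f b := congrArg Subtype.val hab
  refine Set.disjoint_left.1 (hd a b hne) (show s(x, f a) ∈ (T a).edgeSet from hf a) ?_
  rw [hab']
  exact hf b

lemma _root_.ConnectsSet.le_ncard [Finite V] {S : Set V} {r : ℕ} (h : ConnectsSet G S r)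
    {x y : V} (hx : x ∈ S) (hy : y ∈ S) (hxy : x ≠ y) : r ≤ (G.neighborSet x).ncard := by
  obtain ⟨T, hT, hS, -, hd⟩ := h
  obtain ⟨f, hf, -⟩ := exists_injective_adj hT hS hd hx hy hxy
  simpa [Set.ncard_def, Nat.card_coe_set_eq] using Nat.card_le_card_of_injective f hf

lemma unique_adj_of_eq_ncard [Finite V] {S : Set V} {r : ℕ} {T : Fin r → G.Subgraph}
    (hT : ∀ a, (T a).coe.IsTree) (hS : ∀ a, S ⊆ (T a).verts)
    (hd : ∀ a b, a ≠ b → Disjoint (T a).edgeSet (T b).edgeSet) {x y : V}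
    (hx : x ∈ S) (hy : y ∈ S) (hxy : x ≠ y) (hr : r = (G.neighborSet x).ncard) :
    (∀ v, G.Adj x v → ∃ a, (T a).Adj x v) ∧
      ∀ a v w, (T a).Adj x v → (T a).Adj x w → v = w := by
  obtain ⟨f, hf, hfa⟩ := exists_injective_adj hT hS hd hx hy hxy
  have hsurj : Function.Surjective f :=
    ((Nat.bijective_iff_injective_and_card f).2 ⟨hf, by simpa [Nat.card_coe_set_eq] using hr⟩).2
  refine ⟨fun v hv => ?_, fun a v w hv hw => ?_⟩
  · obtain ⟨a, ha⟩ := hsurj ⟨v, hv⟩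
    exact ⟨a, by simpa [ha] using hfa a⟩
  · have key : ∀ v, (T a).Adj x v → v = f a := by
      intro v hv
      obtain ⟨b, hb⟩ := hsurj ⟨v, hv.adj_sub⟩
      have hbv : (T b).Adj x v := by simpa [hb] using hfa b
      by_cases hab : a = b
      · rw [hab, hb]
      · exact (Set.disjoint_left.1 (hd a b hab) (show s(x, v) ∈ (T a).edgeSet from hv) hbv).elim
    rw [key v hv, key w hw]

/-- The upper bound: a triple containing an edge is connected by fewer trees than the degree of
the endpoints. -/
lemma _root_.ConnectsSet.lt_of_adj [Finite V] {x y z : V} (hxy : G.Adj x y) (hxz : z ≠ x)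
    (hyz : z ≠ y) {r d : ℕ} (h : ConnectsSet G {x, y, z} r) (hx : (G.neighborSet x).ncard = d)
    (hy : (G.neighborSet y).ncard = d) : r < d := by
  have hle := h.le_ncard (x := x) (y := y) (by simp) (by simp) hxy.ne
  rw [hx] at hle
  refine lt_of_le_of_ne hle fun hr => ?_
  obtain ⟨T, hT, hS, -, hd⟩ := h
  obtain ⟨h1, h2⟩ := unique_adj_of_eq_ncard hT hS hd (x := x) (y := y) (by simp) (by simp)
    hxy.ne (hr.trans hx.symm)
  obtain ⟨-, h3⟩ := unique_adj_of_eq_ncard hT hS hd (x := y) (y := x) (by simp) (by simp)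
    hxy.ne' (hr.trans hy.symm)
  obtain ⟨a, ha⟩ := h1 y hxy
  obtain ⟨p⟩ := (hT a).connected.preconnected ⟨x, hS a (by simp)⟩ ⟨z, hS a (by simp)⟩
  obtain ⟨⟨⟨u, v⟩, huv⟩, -, hu, hv⟩ := p.exists_boundary_dart
    {w | (w : V) = x ∨ (w : V) = y} (Or.inl rfl) (by simp [hxz, hyz])
  have huv : (T a).Adj u v := huv
  simp only [Set.mem_ofPred_eq, not_or] at hu hv
  rcases hu with hu | hu
  · rw [hu] at huv
    exact hv.2 (h2 a _ _ huv ha)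
  · rw [hu] at huv
    exact hv.1 (h3 a _ _ huv ha.symm)

end SimpleGraph

/-! ### Arrangement graphs -/

namespace Arr

open SimpleGraph

variable {P Q : Type}

/-- The arrangement graph: injections `P ↪ Q`, adjacent when they differ at exactly one position.
When `Q` has two more elements than `P`, it is an alternating group graph. -/
def arr (P Q : Type) : SimpleGraph (P ↪ Q) where
  Adj f g := ∃ p, f p ≠ g p ∧ ∀ q, q ≠ p → f q = g q
  symm := ⟨fun _ _ ⟨p, h, h'⟩ => ⟨p, h.symm, fun q hq => (h' q hq).symm⟩⟩
  loopless := ⟨fun _ ⟨_, h, _⟩ => h rfl⟩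

/-- The symbol `k` is not used by `f`. -/
def Free (f : P ↪ Q) (k : Q) : Prop := ∀ p, f p ≠ k

open Classical in
/-- Replace the value of `f` at `p` by `k`. -/
noncomputable def mv (f : P ↪ Q) (p : P) (k : Q) : P ↪ Q := f.setValue p k

@[simp] lemma mv_same (f : P ↪ Q) (p : P) (k : Q) : mv f p k p = k := by
  classical
  exact Function.Embedding.setValue_eq f p k

lemma mv_of_ne {f : P ↪ Q} {p q : P} {k : Q} (hk : Free f k) (hq : q ≠ p) :
    mv f p k q = f q := by
  simp [mv, Function.Embedding.setValue, hq, hk q]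

lemma eq_mv {f g : P ↪ Q} {p : P} {k : Q} (hk : Free f k) (h1 : g p = k)
    (h2 : ∀ q, q ≠ p → g q = f q) : g = mv f p k := by
  ext q
  by_cases hq : q = p
  · subst hq; simp [h1]
  · rw [mv_of_ne hk hq, h2 q hq]

lemma adj_mv {f : P ↪ Q} {k : Q} (hk : Free f k) (p : P) : (arr P Q).Adj f (mv f p k) :=
  ⟨p, by simpa using hk p, fun q hq => (mv_of_ne hk hq).symm⟩

lemma adj_of_eqOn {f g : P ↪ Q} {p : P} (hne : f ≠ g) (h : ∀ q, q ≠ p → f q = g q) :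
    (arr P Q).Adj f g := by
  refine ⟨p, fun hp => hne ?_, h⟩
  ext q
  by_cases hq : q = p
  · rw [hq, hp]
  · exact h q hq

lemma free_of_adj {f g : P ↪ Q} {p : P} (hp : f p ≠ g p) (h : ∀ q, q ≠ p → f q = g q) :
    Free f (g p) := by
  intro q hq
  by_cases hqp : q = p
  · exact hp (by rw [← hq, hqp])
  · exact hqp (g.injective (by rw [← h q hqp, hq]))

lemma adj_iff {f g : P ↪ Q} : (arr P Q).Adj f g ↔ ∃ p k, Free f k ∧ g = mv f p k := by
  constructor
  · rintro ⟨p, hp, h⟩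
    have hf := free_of_adj hp h
    exact ⟨p, g p, hf, eq_mv hf rfl fun q hq => (h q hq).symm⟩
  · rintro ⟨p, k, hk, rfl⟩
    exact adj_mv hk p

lemma free_mv {f : P ↪ Q} {p : P} {k l : Q} (hk : Free f k) :
    Free (mv f p k) l ↔ (Free f l ∧ l ≠ k) ∨ l = f p := by
  constructor
  · intro h
    by_cases hl : l = f p
    · exact Or.inr hl
    · refine Or.inl ⟨fun q hq => ?_, ?_⟩
      · by_cases hqp : q = p
        · exact hl (by rw [← hq, hqp])
        · exact h q (by rw [mv_of_ne hk hqp, hq])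
      · rintro rfl
        exact h p (by simp)
  · rintro (⟨h1, h2⟩ | rfl) q
    · by_cases hqp : q = p
      · subst hqp; simpa using h2.symm
      · rw [mv_of_ne hk hqp]; exact h1 q
    · by_cases hqp : q = p
      · subst hqp; simpa using (hk q).symm
      · rw [mv_of_ne hk hqp]; exact fun h => hqp (f.injective h)

lemma free_mv_self {f : P ↪ Q} {p : P} {k : Q} (hk : Free f k) : Free (mv f p k) (f p) :=
  (free_mv hk).2 (Or.inr rfl)

lemma mv_mv_self {f : P ↪ Q} {p : P} {k : Q} (hk : Free f k) : mv (mv f p k) p (f p) = f :=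
  (eq_mv (free_mv_self hk) rfl fun _ hq => (mv_of_ne hk hq).symm).symm

lemma mv_mv {f : P ↪ Q} {p : P} {k l : Q} (hk : Free f k) (hl : Free f l) (hkl : k ≠ l) :
    mv (mv f p k) p l = mv f p l := by
  refine eq_mv hl (by simp) fun q hq => ?_
  rw [mv_of_ne ((free_mv hk).2 (Or.inl ⟨hl, hkl.symm⟩)) hq, mv_of_ne hk hq]

lemma adj_mv_mv {f : P ↪ Q} {p : P} {k l : Q} (hk : Free f k) (hl : Free f l) (hkl : k ≠ l) :
    (arr P Q).Adj (mv f p k) (mv f p l) := by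
  rw [← mv_mv hk hl hkl]
  exact adj_mv ((free_mv hk).2 (Or.inl ⟨hl, hkl.symm⟩)) p

/-- The injections taking the value `c` at `p`. -/
def Cp (p : P) (c : Q) : Set (P ↪ Q) := {f | f p = c}

@[simp] lemma mem_Cp {p : P} {c : Q} {f : P ↪ Q} : f ∈ Cp p c ↔ f p = c := Iff.rfl

lemma disjoint_Cp {p : P} {c d : Q} (h : c ≠ d) : Disjoint (Cp p c) (Cp p d) :=
  Set.disjoint_left.2 fun _ h1 h2 => h (h1.symm.trans h2)

lemma mv_injOn {p : P} {c k : Q} {f g : P ↪ Q} (hf : f p = c) (hg : g p = c)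
    (hkf : Free f k) (hkg : Free g k) (h : mv f p k = mv g p k) : f = g := by
  rw [← mv_mv_self (p := p) hkf, ← mv_mv_self (p := p) hkg, h, hf, hg]

/-- Extend an injection avoiding `c` by the value `c` at `p`. -/
noncomputable def ext (p : P) (c : Q) (e : {q // q ≠ p} ↪ {k // k ≠ c}) : P ↪ Q where
  toFun q := by
    classical
    exact if h : q = p then c else e ⟨q, h⟩
  inj' := by
    intro q r h
    by_cases hq : q = p <;> by_cases hr : r = p <;> simp only [hq, hr, dite_true, dite_false] at h ⊢
    · exact ((e ⟨r, hr⟩).2 h.symm).elim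
    · exact ((e ⟨q, hq⟩).2 h).elim
    · simpa using e.injective (Subtype.ext h)

@[simp] lemma ext_same (p : P) (c : Q) (e : {q // q ≠ p} ↪ {k // k ≠ c}) : ext p c e p = c :=
  dif_pos rfl

lemma ext_ne {p : P} {c : Q} (e : {q // q ≠ p} ↪ {k // k ≠ c}) (q : {q // q ≠ p}) :
    ext p c e q = e q :=
  dif_neg q.2

/-- The injections with a prescribed value form a smaller arrangement graph. -/
noncomputable def extEmb (p : P) (c : Q) :
    arr {q // q ≠ p} {k // k ≠ c} ↪g arr P Q where
  toFun := ext p c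
  inj' := by
    intro e e' h
    ext q
    have := DFunLike.congr_fun h (q : P)
    rwa [ext_ne, ext_ne] at this
  map_rel_iff' := by
    intro e e'
    change (arr P Q).Adj (ext p c e) (ext p c e') ↔ _
    constructor
    · rintro ⟨q, hq, h⟩
      have hqp : q ≠ p := by rintro rfl; simp at hq
      refine ⟨⟨q, hqp⟩, fun h' => hq ?_, fun r hr => ?_⟩
      · rw [ext_ne e ⟨q, hqp⟩, ext_ne e' ⟨q, hqp⟩, h']
      · have := h r (fun h => hr (Subtype.ext h))
        rw [ext_ne, ext_ne] at this
        exact Subtype.ext this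
    · rintro ⟨q, hq, h⟩
      refine ⟨q, fun h' => hq ?_, fun r hr => ?_⟩
      · rw [ext_ne, ext_ne] at h'
        exact Subtype.ext h'
      · by_cases hrp : r = p
        · subst hrp; simp
        · rw [ext_ne e ⟨r, hrp⟩, ext_ne e' ⟨r, hrp⟩, h ⟨r, hrp⟩ (fun h => hr (by rw [← h]))]

lemma range_extEmb (p : P) (c : Q) : Set.range (extEmb p c) = Cp p c := by
  ext f
  constructor
  · rintro ⟨e, rfl⟩
    exact ext_same p c e
  · intro hf
    refine ⟨⟨fun q => ⟨f q, fun h => q.2 (f.injective (h.trans hf.symm))⟩, ?_⟩, ?_⟩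
    · intro q r h
      exact Subtype.ext (f.injective (congrArg Subtype.val h))
    · ext q
      by_cases hq : q = p
      · subst hq
        exact (ext_same q c _).trans hf.symm
      · exact ext_ne (p := p) (c := c) _ ⟨q, hq⟩

variable [Finite P] [Finite Q]

lemma card_ne {α : Type} [Finite α] (a : α) : Nat.card {b // b ≠ a} + 1 = Nat.card α := by
  classical
  have := Fintype.ofFinite α
  rw [Nat.card_eq_fintype_card, Nat.card_eq_fintype_card, Fintype.card_subtype_compl]
  have : 0 < Fintype.card α := Fintype.card_pos_iff.2 ⟨a⟩
  simp; omega

lemma exists_free (h : Nat.card Q = Nat.card P + 2) (f : P ↪ Q) :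
    ∃ a b, a ≠ b ∧ ∀ k, Free f k ↔ k = a ∨ k = b := by
  have hc : (Set.range f)ᶜ.ncard = 2 := by
    have h1 := Set.ncard_add_ncard_compl (Set.range f)
    have h2 : (Set.range f).ncard = Nat.card P := by
      rw [← Set.image_univ, Set.ncard_image_of_injective _ f.injective, Set.ncard_univ]
    omega
  obtain ⟨a, b, hab, he⟩ := Set.ncard_eq_two.1 hc
  refine ⟨a, b, hab, fun k => ?_⟩
  have : k ∈ (Set.range f)ᶜ ↔ k ∈ ({a, b} : Set Q) := by rw [he]
  simpa [Free] using this

lemma exists_free_ne (h : Nat.card Q = Nat.card P + 2) (f : P ↪ Q) (c : Q) :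
    ∃ a, Free f a ∧ a ≠ c := by
  obtain ⟨a, b, hab, hf⟩ := exists_free h f
  by_cases hac : a = c
  · exact ⟨b, (hf b).2 (Or.inr rfl), fun h => hab (hac.trans h.symm)⟩
  · exact ⟨a, (hf a).2 (Or.inl rfl), hac⟩

lemma free_unique (h : Nat.card Q = Nat.card P + 2) {f : P ↪ Q} {a b c : Q} (ha : Free f a)
    (hb : Free f b) (hc : Free f c) (hab : a ≠ b) : c = a ∨ c = b := by
  obtain ⟨x, y, hxy, hf⟩ := exists_free h f
  rw [hf] at ha hb hc
  grind

/-- Prescribe values on a set and the two unused symbols. -/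
lemma exists_emb (h : Nat.card Q = Nat.card P + 2) (s : Set P) (f : P → Q) (hf : Set.InjOn f s)
    {a b : Q} (hab : a ≠ b) (ha : ∀ p ∈ s, f p ≠ a) (hb : ∀ p ∈ s, f p ≠ b) :
    ∃ g : P ↪ Q, (∀ p ∈ s, g p = f p) ∧ Free g a ∧ Free g b := by
  classical
  have := Fintype.ofFinite P
  have := Fintype.ofFinite Q
  obtain ⟨g, hg⟩ := Finset.exists_equiv_extend_of_card_eq (α := P) (t := ({a, b} : Finset Q)ᶜ)
    (s := s.toFinset) (f := f) (by
      rw [Finset.card_compl, Finset.card_pair hab]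
      rw [Nat.card_eq_fintype_card, Nat.card_eq_fintype_card] at h
      omega) (by
      intro q hq
      simp only [Finset.mem_image, Set.mem_toFinset] at hq
      obtain ⟨p, hp, rfl⟩ := hq
      simp [ha p hp, hb p hp]) (by simpa using hf)
  have hg' : ∀ p, (g p : Q) ≠ a ∧ (g p : Q) ≠ b := fun p => by simpa using (g p).2
  exact ⟨g.toEmbedding.trans (Function.Embedding.subtype _),
    fun p hp => hg p (by simpa using hp), fun p => (hg' p).1, fun p => (hg' p).2⟩

/-- The number of edges between two copies. -/
lemma ncard_cross (h : Nat.card Q = Nat.card P + 2) (p : P) {c k : Q} (hck : c ≠ k) :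
    (Nat.card P).factorial ≤ {f : P ↪ Q | f p = c ∧ Free f k}.ncard := by
  classical
  have := Fintype.ofFinite P
  have := Fintype.ofFinite Q
  let i : {q : {q // q ≠ c} // q ≠ ⟨k, hck.symm⟩} ↪ {q // q ≠ c} := Function.Embedding.subtype _
  have hinj : Function.Injective
      (fun e : {q // q ≠ p} ↪ {q : {q // q ≠ c} // q ≠ ⟨k, hck.symm⟩} => ext p c (e.trans i)) := by
    intro e e' hee
    have := (extEmb p c).injective hee
    ext q
    have h := DFunLike.congr_fun this q
    exact congrArg Subtype.val h
  have h1 := card_ne p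
  have h2 := card_ne c
  have h3 := card_ne (⟨k, hck.symm⟩ : {q // q ≠ c})
  have hcard : Nat.card ({q // q ≠ p} ↪ {q : {q // q ≠ c} // q ≠ ⟨k, hck.symm⟩}) =
      (Nat.card P).factorial := by
    rw [Nat.card_eq_fintype_card, Fintype.card_embedding_eq, ← Nat.card_eq_fintype_card,
      ← Nat.card_eq_fintype_card]
    have h4 : Nat.card {q : {q // q ≠ c} // q ≠ ⟨k, hck.symm⟩} = Nat.card P := by omega
    rw [h4]
    have := Nat.factorial_mul_descFactorial (n := Nat.card P) (k := Nat.card {q // q ≠ p})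
      (by omega)
    rw [← this, show Nat.card P - Nat.card {q // q ≠ p} = 1 by omega]
    simp
  rw [← hcard, ← Set.ncard_univ, ← Set.ncard_image_of_injective _ hinj]
  refine Set.ncard_le_ncard ?_
  rintro _ ⟨e, -, rfl⟩
  refine ⟨ext_same p c _, fun q => ?_⟩
  by_cases hq : q = p
  · subst hq
    rw [ext_same]
    exact hck
  · have := ext_ne (p := p) (c := c) (e.trans i) ⟨q, hq⟩
    simp only at this
    rw [this]
    exact fun h => (e ⟨q, hq⟩).2 (Subtype.ext h)

/-- If fewer vertices are removed than there are edges between two copies, an edge survives. -/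
lemma exists_cross (h : Nat.card Q = Nat.card P + 2) (p : P) {c k : Q} (hck : c ≠ k)
    (Y : Set (P ↪ Q)) (hY : (Y ∩ (Cp p c ∪ Cp p k)).ncard < (Nat.card P).factorial) :
    ∃ a ∈ Cp p c \ Y, ∃ b ∈ Cp p k \ Y, (arr P Q).Adj a b := by
  classical
  by_contra hno
  refine absurd (ncard_cross h p hck) (not_le.2 (lt_of_le_of_lt ?_ hY))
  have key : ∀ f, f p = c → Free f k → f ∉ Y → mv f p k ∈ Y := by
    intro f hf hk hfY
    by_contra hm
    exact hno ⟨f, ⟨hf, hfY⟩, mv f p k, ⟨mv_same _ _ _, hm⟩, adj_mv hk p⟩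
  refine Set.ncard_le_ncard_of_injOn (fun f => if f ∈ Y then f else mv f p k) ?_ ?_
  · rintro f ⟨hf, hk⟩
    by_cases hfY : f ∈ Y
    · simp only [hfY, if_true]
      exact ⟨hfY, Or.inl hf⟩
    · simp only [hfY, if_false]
      exact ⟨key f hf hk hfY, Or.inr (mv_same _ _ _)⟩
  · rintro f ⟨hf, hk⟩ g ⟨hg, hk'⟩ hfg
    by_cases hfY : f ∈ Y <;> by_cases hgY : g ∈ Y <;>
      simp only [hfY, hgY, if_true, if_false] at hfg
    · exact hfg
    · exact (hck (by rw [← hf, hfg, mv_same])).elim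
    · exact (hck (by rw [← hg, ← hfg, mv_same])).elim
    · exact mv_injOn hf hg hk hk' hfg

end Arr

/-! ### Connectivity of arrangement graphs -/

namespace Arr

open SimpleGraph

variable {P Q : Type}

lemma connOn_Cp_of (p : P) (c : Q) {m : ℕ}
    (ih : ∀ Y : Set ({q // q ≠ p} ↪ {k // k ≠ c}), Y.ncard < m →
      (arr {q // q ≠ p} {k // k ≠ c}).ConnOn Yᶜ) (Y : Set (P ↪ Q))
    (hY : (Y ∩ Cp p c).ncard < m) : (arr P Q).ConnOn (Cp p c \ Y) := by
  have h1 : (extEmb p c ⁻¹' Y).ncard < m := by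
    rw [← Set.ncard_image_of_injective _ (extEmb p c).injective, Set.image_preimage_eq_inter_range,
      range_extEmb]
    exact hY
  have h2 := (ih _ h1).image (extEmb p c).toHom
  convert h2 using 1
  rw [← range_extEmb]
  ext f
  constructor
  · rintro ⟨⟨e, rfl⟩, he⟩
    exact ⟨e, he, rfl⟩
  · rintro ⟨e, he, rfl⟩
    exact ⟨⟨e, rfl⟩, he⟩

variable [Finite P] [Finite Q]

/-- Copies connected to a central one by surviving edges. -/
lemma connOn_star (h : Nat.card Q = Nat.card P + 2) (p : P) {Y : Set (P ↪ Q)} {I : Set Q} {c : Q}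
    (hc : c ∈ I) (hI : ∀ k ∈ I, (arr P Q).ConnOn (Cp p k \ Y))
    (hY : ∀ k ∈ I, k ≠ c → (Y ∩ (Cp p c ∪ Cp p k)).ncard < (Nat.card P).factorial) :
    (arr P Q).ConnOn {f | f p ∈ I ∧ f ∉ Y} := by
  have := (hI c hc).union_iUnion (ι := I) (B := fun k => Cp p (k : Q) \ Y) (fun k => hI k k.2) (by
    intro k
    by_cases hk : (k : Q) = c
    · obtain ⟨u, hu⟩ := (hI c hc).nonempty'
      exact ⟨u, hu, u, by rwa [hk], Or.inl rfl⟩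
    · obtain ⟨a, ha, b, hb, hab⟩ := exists_cross h p (Ne.symm hk) Y (hY k k.2 hk)
      exact ⟨a, ha, b, hb, Or.inr hab⟩)
  convert this using 1
  ext f
  simp only [Set.mem_ofPred_eq, Set.mem_union, Set.mem_iUnion, Set.mem_sdiff, mem_Cp]
  constructor
  · rintro ⟨h1, h2⟩
    exact Or.inr ⟨⟨f p, h1⟩, rfl, h2⟩
  · rintro (⟨h1, h2⟩ | ⟨k, h1, h2⟩)
    · exact ⟨h1 ▸ hc, h2⟩
    · exact ⟨h1 ▸ k.2, h2⟩

lemma ncard_inter_add_le {α : Type} [Finite α] (Y A B : Set α) (h : Disjoint A B) :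
    (Y ∩ A).ncard + (Y ∩ B).ncard ≤ Y.ncard := by
  rw [← Set.ncard_union_eq (h.mono Set.inter_subset_right Set.inter_subset_right)]
  exact Set.ncard_le_ncard (by grind)

lemma lt_factorial {m : ℕ} (hm : 3 ≤ m) : 2 * m - 1 < m.factorial := by
  induction m, hm using Nat.le_induction with
  | base => decide
  | succ k hk ih =>
    rw [Nat.factorial_succ]
    have : 4 * (k.factorial) ≤ (k + 1) * k.factorial := Nat.mul_le_mul_right _ (by omega)
    omega

/-- The vertex connectivity of the arrangement graph is at least its degree. -/
theorem connOn_compl (h : Nat.card Q = Nat.card P + 2) (hP : 1 ≤ Nat.card P) (Y : Set (P ↪ Q))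
    (hY : Y.ncard < 2 * Nat.card P) : (arr P Q).ConnOn Yᶜ := by
  classical
  induction hm : Nat.card P using Nat.strong_induction_on generalizing P Q with
  | _ m ih =>
  have hne : Nonempty P := Nat.card_pos_iff.1 hP |>.1
  let p := Classical.arbitrary P
  rcases Nat.lt_or_ge (Nat.card P) 2 with hlt | hge
  · have h1 : Nat.card P = 1 := by omega
    have : Subsingleton P := (Nat.card_eq_one_iff_unique.1 h1).1
    refine connOn_of_clique ?_ ?_
    · rw [Set.nonempty_compl]
      rintro rfl
      have := Fintype.ofFinite P
      have := Fintype.ofFinite Q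
      rw [Set.ncard_univ, Nat.card_eq_fintype_card, Fintype.card_embedding_eq,
        ← Nat.card_eq_fintype_card, ← Nat.card_eq_fintype_card, h, h1] at hY
      norm_num at hY
    · intro f _ g _ hfg
      exact adj_of_eqOn (p := p) hfg fun q hq => (hq (Subsingleton.elim _ _)).elim
  have hcopy : ∀ (c : Q) (Y : Set (P ↪ Q)), (Y ∩ Cp p c).ncard < 2 * (Nat.card P - 1) →
      (arr P Q).ConnOn (Cp p c \ Y) := by
    intro c Y hY
    have h1 := card_ne p
    have h2 := card_ne c
    refine connOn_Cp_of p c (m := 2 * (Nat.card P - 1)) (fun Z hZ => ?_) Y hY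
    exact ih _ (by omega) (by omega) (by omega) Z (by omega) rfl
  have hfac : 2 ≤ (Nat.card P).factorial := (Nat.factorial_le hge).trans' (by decide)
  by_cases hbad : ∃ c, 2 * (Nat.card P - 1) ≤ (Y ∩ Cp p c).ncard
  · obtain ⟨c, hc⟩ := hbad
    have hout : ∀ A : Set (P ↪ Q), Disjoint (Cp p c) A → (Y ∩ A).ncard ≤ 1 := by
      intro A hA
      have := ncard_inter_add_le Y _ _ hA
      omega
    obtain ⟨f0, hf0⟩ : ∃ f : P ↪ Q, Free f c := by
      obtain ⟨d, hd⟩ : ∃ d : Q, d ≠ c := by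
        have : Nontrivial Q := (Finite.one_lt_card_iff_nontrivial).1 (by omega)
        exact exists_ne c
      obtain ⟨g, -, hg, -⟩ := exists_emb (P := P) h ∅ (fun _ => c) (by simp) hd.symm
        (by simp) (by simp)
      exact ⟨g, hg⟩
    have hU := connOn_star h p (Y := Y) (I := {k | k ≠ c}) (c := f0 p) (hf0 p)
      (fun k hk => hcopy k Y (by
        have := hout (Cp p k) (disjoint_Cp (Ne.symm hk))
        omega))
      (fun k hk _ => by
        have := hout (Cp p (f0 p) ∪ Cp p k)
          (Set.disjoint_union_right.2 ⟨disjoint_Cp (hf0 p).symm, disjoint_Cp (Ne.symm hk)⟩)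
        omega)
    have := hU.union_iUnion (ι := {f : P ↪ Q // f p = c ∧ f ∉ Y}) (B := fun f => {(f : P ↪ Q)})
      (fun f => connOn_singleton _) (by
        rintro ⟨f, hf, hfY⟩
        obtain ⟨a, b, hab, hfree⟩ := exists_free h f
        have ha : Free f a := (hfree a).2 (Or.inl rfl)
        have hb : Free f b := (hfree b).2 (Or.inr rfl)
        have key : mv f p a ∉ Y ∨ mv f p b ∉ Y := by
          by_contra hno
          simp only [not_or, not_not] at hno
          have h1 := hout {mv f p a, mv f p b} (by
            rw [Set.disjoint_right]
            rintro g (rfl | rfl) hg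
            · exact ha p (hf.trans (by simpa using hg.symm))
            · exact hb p (hf.trans (by simpa using hg.symm)))
          rw [Set.inter_eq_right.2 (by simp [Set.insert_subset_iff, hno.1, hno.2]),
            Set.ncard_pair (fun he => hab (by
              have := DFunLike.congr_fun he p
              simpa using this))] at h1
          omega
        rcases key with hk | hk
        · exact ⟨_, ⟨by simpa using fun h : a = c => ha p (hf.trans h.symm), hk⟩, f, rfl,
            Or.inr (adj_mv ha p).symm⟩
        · exact ⟨_, ⟨by simpa using fun h : b = c => hb p (hf.trans h.symm), hk⟩, f, rfl,
            Or.inr (adj_mv hb p).symm⟩)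
    convert this using 1
    ext f
    simp only [Set.mem_compl_iff, Set.mem_union, Set.mem_ofPred_eq, Set.mem_iUnion,
      Set.mem_singleton_iff, Subtype.exists, exists_prop, exists_eq_right']
    tauto
  · push Not at hbad
    obtain ⟨c, hc⟩ : ∃ c : Q, ∀ k, k ≠ c →
        (Y ∩ (Cp p c ∪ Cp p k)).ncard < (Nat.card P).factorial := by
      rcases Nat.lt_or_ge (Nat.card P) 3 with hlt | hge3
      · obtain ⟨c, hc⟩ : ∃ c, Y ∩ Cp p c = ∅ := by
          by_contra hno
          simp only [not_exists, ← Ne.eq_def, ← Set.nonempty_iff_ne_empty] at hno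
          choose g hg using hno
          have h1 : Function.Injective (fun c => (⟨g c, (hg c).1⟩ : Y)) := by
            intro c d hcd
            have h2 : g c = g d := congrArg Subtype.val hcd
            rw [← (hg c).2, ← (hg d).2, h2]
          have h2 := Nat.card_le_card_of_injective _ h1
          rw [Nat.card_coe_set_eq] at h2
          omega
        refine ⟨c, fun k _ => ?_⟩
        rw [Set.inter_union_distrib_left, hc, Set.empty_union]
        have := hbad k
        omega
      · have : Nonempty Q := Nat.card_pos_iff.1 (by omega : 0 < Nat.card Q) |>.1
        refine ⟨Classical.arbitrary Q, fun k _ => ?_⟩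
        have h1 := lt_factorial hge3
        have h2 := Set.ncard_le_ncard (Set.inter_subset_left (s := Y)
          (t := Cp p (Classical.arbitrary Q) ∪ Cp p k))
        omega
    have := connOn_star h p (Y := Y) (I := Set.univ) (c := c) trivial
      (fun k _ => hcopy k Y (hbad k)) (fun k _ hk => hc k hk)
    convert this using 1
    ext f
    simp

/-- Removing few vertices from a copy leaves it connected. -/
theorem connOn_Cp (h : Nat.card Q = Nat.card P + 2) (hP : 2 ≤ Nat.card P) (p : P) (c : Q)
    (Y : Set (P ↪ Q)) (hY : (Y ∩ Cp p c).ncard < 2 * (Nat.card P - 1)) :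
    (arr P Q).ConnOn (Cp p c \ Y) := by
  have h1 := card_ne p
  have h2 := card_ne c
  exact connOn_Cp_of p c (m := 2 * (Nat.card P - 1))
    (fun Z hZ => connOn_compl (by omega) (by omega) Z (by omega)) Y hY

end Arr

/-! ### Two positions -/

namespace Arr

open SimpleGraph

/-- Adjacency of the codes `4 * a + b` of pairs `(a, b)`: exactly one coordinate agrees. -/
def adjCode (u v : ℕ) : Bool := (u / 4 == v / 4) != (u % 4 == v % 4)

/-- A code of a pair of different numbers below `4`. -/
def validCode (u : ℕ) : Bool := u / 4 < 4 && u / 4 != u % 4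

/-- The tree allowed to use an edge of the triple `1, y, z`; other edges are marked `3`. -/
def owner (y z : ℕ) (o : List ℕ) (u v : ℕ) : ℕ :=
  if (u == 1 && v == y) || (u == y && v == 1) then o.getD 0 0
  else if (u == 1 && v == z) || (u == z && v == 1) then o.getD 1 0
  else if (u == y && v == z) || (u == z && v == y) then o.getD 2 0
  else 3

/-- The edges available to tree number `i`. -/
def useCode (y z : ℕ) (o : List ℕ) (i u v : ℕ) : Bool :=
  adjCode u v && (owner y z o u v == i || owner y z o u v == 3)

/-- Every entry of the list except the last is joined to a later one. -/
def chainCode (r : ℕ → ℕ → Bool) : List ℕ → Bool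
  | [] => true
  | [_] => true
  | u :: v :: l => (v :: l).any (r u) && chainCode r (v :: l)

/-- Three internally disjoint trees for each triple `1, y, z`: the owners of the edges `1 y`, `1 z`
and `yz`, and the vertices of the trees in an order in which each is joined to a later one. -/
def treeTable : List (ℕ × ℕ × List ℕ × List ℕ × List ℕ × List ℕ) := [
  (2, 3, [0, 0, 1], [3, 2, 1], [2, 3, 11, 9, 1], [3, 7, 6, 2, 14, 13, 1]),
  (2, 4, [0, 0, 0], [4, 6, 2, 1], [4, 7, 2, 3, 1], [2, 14, 4, 12, 13, 1]),
  (2, 6, [0, 0, 0], [6, 2, 1], [6, 7, 2, 3, 1], [6, 2, 14, 13, 1]),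
  (2, 7, [0, 0, 0], [7, 6, 2, 1], [7, 2, 3, 1], [2, 14, 7, 4, 12, 13, 1]),
  (2, 8, [0, 0, 0], [8, 9, 2, 1], [8, 11, 2, 3, 1], [2, 14, 8, 12, 13, 1]),
  (2, 9, [0, 0, 0], [9, 2, 1], [9, 11, 2, 3, 1], [2, 14, 9, 13, 1]),
  (2, 11, [0, 0, 0], [11, 9, 2, 1], [11, 2, 3, 1], [11, 7, 6, 2, 14, 13, 1]),
  (2, 12, [0, 0, 0], [12, 13, 2, 1], [12, 14, 2, 3, 1], [12, 2, 6, 4, 8, 9, 1]),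
  (2, 13, [0, 0, 0], [13, 2, 1], [13, 14, 2, 3, 1], [13, 2, 6, 4, 8, 9, 1]),
  (2, 14, [0, 0, 0], [14, 2, 1], [14, 13, 2, 3, 1], [14, 2, 6, 4, 8, 9, 1]),
  (3, 4, [0, 0, 0], [4, 7, 3, 1], [4, 6, 3, 2, 1], [3, 11, 4, 8, 9, 1]),
  (3, 6, [0, 0, 0], [6, 7, 3, 1], [6, 3, 2, 1], [3, 11, 6, 4, 8, 9, 1]),
  (3, 7, [0, 0, 0], [7, 3, 1], [7, 6, 3, 2, 1], [7, 3, 11, 9, 1]),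
  (3, 8, [0, 0, 0], [8, 9, 3, 1], [8, 11, 3, 2, 1], [8, 3, 7, 4, 12, 13, 1]),
  (3, 9, [0, 0, 0], [9, 3, 1], [9, 11, 3, 2, 1], [3, 7, 4, 8, 9, 13, 1]),
  (3, 11, [0, 0, 0], [11, 3, 1], [11, 9, 3, 2, 1], [11, 3, 7, 4, 12, 13, 1]),
  (3, 12, [0, 0, 0], [12, 13, 3, 1], [12, 14, 3, 2, 1], [12, 3, 11, 8, 9, 1]),
  (3, 13, [0, 0, 0], [13, 3, 1], [13, 14, 3, 2, 1], [13, 3, 11, 9, 1]),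
  (3, 14, [0, 0, 0], [14, 13, 3, 1], [14, 3, 2, 1], [14, 6, 7, 3, 11, 9, 1]),
  (4, 6, [0, 0, 0], [4, 6, 2, 1], [6, 4, 7, 3, 1], [6, 14, 4, 12, 13, 1]),
  (4, 7, [0, 0, 0], [4, 7, 3, 1], [7, 4, 6, 2, 1], [7, 11, 4, 8, 9, 1]),
  (4, 8, [0, 0, 0], [4, 8, 9, 1], [8, 4, 12, 13, 1], [8, 11, 4, 7, 3, 1]),
  (4, 9, [0, 0, 0], [4, 8, 9, 1], [4, 12, 9, 13, 1], [9, 11, 4, 7, 3, 1]),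
  (4, 11, [0, 0, 0], [11, 4, 7, 3, 1], [11, 8, 4, 6, 2, 1], [4, 12, 13, 11, 9, 1]),
  (4, 12, [0, 0, 0], [4, 12, 13, 1], [12, 4, 8, 9, 1], [12, 14, 4, 6, 2, 1]),
  (4, 13, [0, 0, 0], [4, 12, 13, 1], [13, 4, 8, 9, 1], [13, 14, 4, 6, 2, 1]),
  (4, 14, [0, 0, 0], [14, 4, 6, 2, 1], [14, 12, 4, 7, 3, 1], [14, 13, 4, 8, 9, 1]),
  (6, 7, [0, 0, 0], [7, 6, 2, 1], [6, 4, 7, 3, 1], [6, 14, 13, 7, 11, 9, 1]),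
  (6, 8, [0, 0, 0], [8, 4, 6, 2, 1], [8, 9, 6, 7, 3, 1], [6, 14, 8, 12, 13, 1]),
  (6, 9, [0, 0, 0], [9, 6, 2, 1], [6, 14, 9, 13, 1], [9, 11, 6, 7, 3, 1]),
  (6, 11, [0, 0, 0], [11, 6, 3, 2, 1], [6, 7, 11, 9, 1], [11, 8, 6, 4, 12, 13, 1]),
  (6, 12, [0, 0, 0], [12, 4, 6, 2, 1], [6, 14, 12, 13, 1], [12, 8, 9, 6, 7, 3, 1]),
  (6, 13, [0, 0, 0], [13, 6, 2, 1], [6, 14, 13, 9, 1], [13, 12, 6, 4, 7, 3, 1]),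
  (6, 14, [0, 0, 0], [6, 14, 13, 1], [14, 6, 2, 1], [14, 12, 6, 4, 7, 3, 1]),
  (7, 8, [0, 0, 0], [8, 4, 7, 3, 1], [7, 11, 8, 9, 1], [8, 12, 13, 7, 6, 2, 1]),
  (7, 9, [0, 0, 0], [9, 7, 3, 1], [7, 11, 9, 13, 1], [9, 8, 7, 4, 6, 2, 1]),
  (7, 11, [0, 0, 0], [7, 11, 9, 1], [11, 7, 3, 1], [11, 8, 7, 4, 6, 2, 1]),
  (7, 12, [0, 0, 0], [12, 4, 7, 3, 1], [12, 13, 7, 6, 2, 1], [12, 7, 11, 8, 9, 1]),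
  (7, 13, [0, 0, 0], [13, 7, 3, 1], [13, 7, 11, 9, 1], [13, 14, 7, 6, 2, 1]),
  (7, 14, [0, 0, 0], [14, 7, 3, 2, 1], [7, 6, 14, 13, 1], [14, 12, 7, 4, 8, 9, 1]),
  (8, 9, [0, 0, 0], [8, 9, 1], [9, 8, 11, 3, 1], [8, 12, 9, 13, 1]),
  (8, 11, [0, 0, 0], [8, 11, 3, 1], [11, 8, 9, 1], [11, 8, 7, 4, 6, 2, 1]),
  (8, 12, [0, 0, 0], [12, 8, 9, 1], [8, 4, 12, 13, 1], [12, 14, 8, 11, 3, 2, 1]),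
  (8, 13, [0, 0, 0], [8, 12, 13, 1], [13, 8, 9, 1], [13, 14, 8, 11, 3, 2, 1]),
  (8, 14, [0, 0, 0], [14, 8, 9, 2, 1], [14, 8, 12, 13, 1], [14, 8, 6, 4, 7, 3, 1]),
  (9, 11, [0, 0, 0], [11, 9, 1], [9, 8, 11, 3, 1], [9, 13, 11, 7, 6, 2, 1]),
  (9, 12, [0, 0, 0], [12, 8, 9, 1], [12, 9, 13, 1], [12, 14, 9, 11, 3, 2, 1]),
  (9, 13, [0, 0, 1], [13, 9, 1], [9, 13, 14, 2, 1], [13, 12, 9, 8, 11, 3, 1]),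
  (9, 14, [0, 0, 0], [14, 9, 2, 1], [14, 9, 13, 1], [14, 9, 11, 6, 7, 3, 1]),
  (11, 12, [0, 0, 0], [12, 8, 11, 3, 1], [12, 13, 11, 9, 1], [12, 11, 7, 4, 6, 2, 1]),
  (11, 13, [0, 0, 0], [13, 11, 3, 1], [13, 11, 9, 1], [13, 14, 11, 7, 6, 2, 1]),
  (11, 14, [0, 0, 0], [14, 11, 3, 2, 1], [14, 6, 7, 11, 9, 1], [14, 11, 8, 12, 13, 1]),
  (12, 13, [0, 0, 0], [12, 13, 1], [13, 12, 14, 2, 1], [13, 12, 8, 9, 1]),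
  (12, 14, [0, 0, 0], [12, 14, 2, 1], [14, 12, 13, 1], [14, 12, 6, 4, 7, 3, 1]),
  (13, 14, [0, 0, 0], [14, 13, 1], [14, 13, 9, 2, 1], [14, 13, 12, 4, 7, 3, 1])]

/-- The three vertex lists of a row of the table. -/
def treeList (e : ℕ × ℕ × List ℕ × List ℕ × List ℕ × List ℕ) (i : Fin 3) : List ℕ :=
  if i = 0 then e.2.2.2.1 else if i = 1 then e.2.2.2.2.1 else e.2.2.2.2.2

set_option maxRecDepth 100000 in
lemma treeTable_spec : ∀ e ∈ treeTable, (∀ j < 3, e.2.2.1.getD j 0 < 3) ∧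
    (∀ i : Fin 3, chainCode (useCode e.1 e.2.1 e.2.2.1 i) (treeList e i) = true ∧
      (∀ u ∈ treeList e i, validCode u = true) ∧ 1 ∈ treeList e i ∧ e.1 ∈ treeList e i ∧
      e.2.1 ∈ treeList e i) ∧
    ∀ i j : Fin 3, i ≠ j → ∀ u ∈ treeList e i, u ∈ treeList e j → u = 1 ∨ u = e.1 ∨ u = e.2.1 := by
  decide

set_option maxRecDepth 100000 in
lemma treeTable_complete : ∀ y < 16, ∀ z < 16,
    (validCode y && validCode z && y != 1 && z != 1 && y < z) = true →
    treeTable.any (fun e => e.1 == y && e.2.1 == z) = true := by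
  decide

lemma useCode_comm (y z : ℕ) (o : List ℕ) (i u v : ℕ) :
    useCode y z o i u v = useCode y z o i v u := by
  have h1 : adjCode u v = adjCode v u := by
    simp only [adjCode, Bool.beq_comm (a := u / 4), Bool.beq_comm (a := u % 4)]
  have h2 : owner y z o u v = owner y z o v u := by
    simp only [owner, Bool.or_eq_true, Bool.and_eq_true, beq_iff_eq]
    grind
  rw [useCode, useCode, h1, h2]

/-- Entries of a list in which all but the last are joined to a later one form a connected set. -/
lemma connOn_of_chainCode {V : Type*} {H : SimpleGraph V} {c : V → ℕ} {r : ℕ → ℕ → Bool}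
    (hr : ∀ f g, r (c f) (c g) = true → H.Adj f g) (hc : Function.Injective c) :
    ∀ l : List ℕ, l ≠ [] → (∀ u ∈ l, ∃ f, c f = u) → chainCode r l = true →
      H.ConnOn {f | c f ∈ l}
  | [], h, _, _ => (h rfl).elim
  | [u], _, hl, _ => by
    obtain ⟨f, rfl⟩ := hl u (by simp)
    have : {g | c g ∈ [c f]} = {f} := by
      ext g
      simp [hc.eq_iff]
    rw [this]
    exact connOn_singleton f
  | u :: v :: l, _, hl, hch => by
    rw [chainCode, Bool.and_eq_true, List.any_eq_true] at hch
    obtain ⟨⟨w, hw, huw⟩, hch⟩ := hch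
    have ih := connOn_of_chainCode hr hc (v :: l) (by simp)
      (fun u hu => hl u (List.mem_cons_of_mem _ hu)) hch
    obtain ⟨f, rfl⟩ := hl u (by simp)
    obtain ⟨g, rfl⟩ := hl w (List.mem_cons_of_mem _ hw)
    have := ih.insert (v := f) ⟨g, hw, (hr f g huw).symm⟩
    convert this using 1
    ext k
    simp only [List.mem_cons, Set.mem_ofPred_eq, Set.mem_insert_iff, hc.eq_iff]

/-- The three trees in the twelve-vertex arrangement graph. -/
theorem goodIn_of_card_two {P Q : Type} [Finite P] [Finite Q] (hP : Nat.card P = 2)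
    (hQ : Nat.card Q = 4) {S : Set (P ↪ Q)} (hS : S.ncard = 3) :
    (arr P Q).GoodIn S Set.univ (Fin 3) := by
  classical
  have := Fintype.ofFinite P
  have := Fintype.ofFinite Q
  obtain ⟨p, q, hpq, huniv⟩ := Nat.card_eq_two_iff.1 hP
  have hcover : ∀ r : P, r = p ∨ r = q := fun r => by
    have : r ∈ ({p, q} : Set P) := huniv ▸ Set.mem_univ r
    simpa using this
  obtain ⟨x, y, z, hxy, hxz, hyz, rfl⟩ := Set.ncard_eq_three.1 hS
  have hxpq : x p ≠ x q := fun h => hpq (x.injective h)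
  obtain ⟨e, he⟩ := Finset.exists_equiv_extend_of_card_eq (α := Q) (β := ℕ) (t := Finset.range 4)
    (s := {x p, x q}) (f := fun k => if k = x p then 0 else 1)
    (by rw [← Nat.card_eq_fintype_card, hQ]; rfl) (by
      intro k hk
      simp only [Finset.mem_image] at hk
      obtain ⟨r, -, rfl⟩ := hk
      split <;> simp) (by
      intro a ha b hb hab
      simp only [Finset.coe_insert, Finset.coe_singleton, Set.mem_insert_iff,
        Set.mem_singleton_iff] at ha hb
      rcases ha with rfl | rfl <;> rcases hb with rfl | rfl <;>
        simp_all [hxpq.symm])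
  have hep : (e (x p) : ℕ) = 0 := by simpa using he (x p) (by simp)
  have heq : (e (x q) : ℕ) = 1 := by simpa [hxpq.symm] using he (x q) (by simp)
  have hlt : ∀ k, (e k : ℕ) < 4 := fun k => Finset.mem_range.1 (e k).2
  have heinj : ∀ {a b : Q}, (e a : ℕ) = e b → a = b := fun h => e.injective (Subtype.ext h)
  let c : (P ↪ Q) → ℕ := fun f => 4 * e (f p) + e (f q)
  have hdiv : ∀ f, c f / 4 = e (f p) := fun f => by have := hlt (f q); simp only [c]; omega
  have hmod : ∀ f, c f % 4 = e (f q) := fun f => by have := hlt (f q); simp only [c]; omega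
  have hcinj : Function.Injective c := by
    intro f g hfg
    ext r
    rcases hcover r with rfl | rfl
    · exact heinj (by rw [← hdiv, ← hdiv, hfg])
    · exact heinj (by rw [← hmod, ← hmod, hfg])
  have hvalid : ∀ f, validCode (c f) = true := by
    intro f
    simp only [validCode, hdiv, hmod, Bool.and_eq_true, decide_eq_true_eq, bne_iff_ne]
    exact ⟨hlt _, fun h => hpq (f.injective (heinj h))⟩
  have hlt16 : ∀ f, c f < 16 := fun f => by
    have := hlt (f p)
    have := hlt (f q)
    simp only [c]
    omega
  have hsurj : ∀ u, validCode u = true → ∃ f, c f = u := by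
    intro u hu
    simp only [validCode, Bool.and_eq_true, decide_eq_true_eq, bne_iff_ne] at hu
    let a := e.symm ⟨u / 4, Finset.mem_range.2 hu.1⟩
    let b := e.symm ⟨u % 4, Finset.mem_range.2 (Nat.mod_lt _ (by decide))⟩
    have hab : a ≠ b := fun h => hu.2 (by simpa using e.symm.injective h)
    refine ⟨⟨fun r => if r = p then a else b, fun r s hrs => ?_⟩, ?_⟩
    · rcases hcover r with rfl | rfl <;> rcases hcover s with rfl | rfl <;>
        simp_all [hpq.symm, hab.symm]
    · change 4 * (e (if p = p then a else b) : ℕ) + e (if q = p then a else b) = u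
      rw [if_pos rfl, if_neg hpq.symm]
      simp only [a, b, Equiv.apply_symm_apply]
      omega
  have hadj : ∀ f g, adjCode (c f) (c g) = true → (arr P Q).Adj f g := by
    intro f g hfg
    simp only [adjCode, hdiv, hmod] at hfg
    by_cases h1 : f p = g p
    · refine ⟨q, fun h2 => ?_, fun r hr => ?_⟩
      · simp [h1, h2] at hfg
      · rcases hcover r with rfl | rfl
        · exact h1
        · exact (hr rfl).elim
    · have h1' : (e (f p) : ℕ) ≠ e (g p) := fun h => h1 (heinj h)
      refine ⟨p, h1, fun r hr => ?_⟩
      rcases hcover r with rfl | rfl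
      · exact (hr rfl).elim
      · exact heinj (by simpa [h1'] using hfg)
  have hx : c x = 1 := by simp only [c]; omega
  have hne : ∀ f, f ≠ x → (c f != 1) = true := fun f hf => by
    rw [bne_iff_ne, ← hx]
    exact fun h => hf (hcinj h)
  obtain ⟨t, ht, y', z', hS', hy', hz'⟩ : ∃ t ∈ treeTable, ∃ y' z',
      ({x, y, z} : Set (P ↪ Q)) = {x, y', z'} ∧ t.1 = c y' ∧ t.2.1 = c z' := by
    rcases lt_or_gt_of_ne (fun h => hyz (hcinj h) : c y ≠ c z) with hlt | hlt
    · have := treeTable_complete _ (hlt16 y) _ (hlt16 z)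
        (by simp [hvalid, hne y hxy.symm, hne z hxz.symm, hlt])
      obtain ⟨t, ht, he⟩ := List.any_eq_true.1 this
      simp only [Bool.and_eq_true, beq_iff_eq] at he
      exact ⟨t, ht, y, z, rfl, he.1, he.2⟩
    · have := treeTable_complete _ (hlt16 z) _ (hlt16 y)
        (by simp [hvalid, hne y hxy.symm, hne z hxz.symm, hlt])
      obtain ⟨t, ht, he⟩ := List.any_eq_true.1 this
      simp only [Bool.and_eq_true, beq_iff_eq] at he
      exact ⟨t, ht, z, y, by rw [Set.pair_comm], he.1, he.2⟩
  rw [hS']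
  obtain ⟨hown, hlist, hdisj⟩ := treeTable_spec t ht
  have hmem : ∀ i, ∀ f ∈ ({x, y', z'} : Set (P ↪ Q)), c f ∈ treeList t i := by
    rintro i f (rfl | rfl | rfl)
    · exact hx ▸ (hlist i).2.2.1
    · exact hy' ▸ (hlist i).2.2.2.1
    · exact hz' ▸ (hlist i).2.2.2.2
  refine ⟨fun i =>
    { Adj := fun f g => useCode t.1 t.2.1 t.2.2.1 i (c f) (c g) = true
      symm := ⟨fun f g h => by rw [useCode_comm]; exact h⟩
      loopless := ⟨fun f h => by simp [useCode, adjCode] at h⟩ },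
    fun i => {f | c f ∈ treeList t i ∧ f ∉ ({x, y', z'} : Set (P ↪ Q))}, ?_, ?_, ?_, ?_, ?_, ?_⟩
  · intro i f g hfg
    change useCode _ _ _ _ _ _ = true at hfg
    rw [useCode, Bool.and_eq_true] at hfg
    exact hadj f g hfg.1
  · intro i
    have hu : ({x, y', z'} : Set (P ↪ Q)) ∪
        {f | c f ∈ treeList t i ∧ f ∉ ({x, y', z'} : Set (P ↪ Q))} =
        {f | c f ∈ treeList t i} := by
      ext f
      by_cases hf : f ∈ ({x, y', z'} : Set (P ↪ Q))
      · simp only [Set.mem_union, hf, true_or, Set.mem_ofPred_eq, true_iff]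
        exact hmem i f hf
      · simp only [Set.mem_union, hf, false_or, Set.mem_ofPred_eq, not_false_eq_true, and_true]
    rw [hu]
    refine connOn_of_chainCode (fun f g h => h) hcinj _ ?_
      (fun u hu => hsurj u ((hlist i).2.1 u hu))
      (hlist i).1
    exact List.ne_nil_of_mem (hlist i).2.2.1
  · exact fun i => Set.subset_univ _
  · exact fun i => Set.disjoint_left.2 fun f hf hf' => hf'.2 hf
  · intro i j hij
    refine Set.disjoint_left.2 fun f hf hf' => hf.2 ?_
    rcases hdisj i j hij _ hf.1 hf'.1 with h | h | h
    · exact Or.inl (hcinj (h.trans hx.symm))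
    · exact Or.inr (Or.inl (hcinj (h.trans hy')))
    · exact Or.inr (Or.inr (hcinj (h.trans hz')))
  · intro i j hij u hu v hv huv huv'
    change useCode _ _ _ _ _ _ = true at huv huv'
    have huv_ne : c u ≠ c v := by
      intro h
      simp [useCode, adjCode, h] at huv
    rw [useCode, Bool.and_eq_true, Bool.or_eq_true, beq_iff_eq, beq_iff_eq] at huv huv'
    have h3 : owner t.1 t.2.1 t.2.2.1 (c u) (c v) ≠ 3 := by
      have h0 := hown 0 (by decide)
      have h1 := hown 1 (by decide)
      have h2 := hown 2 (by decide)
      have hcases : ∀ f ∈ ({x, y', z'} : Set (P ↪ Q)), c f = 1 ∨ c f = t.1 ∨ c f = t.2.1 := by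
        rintro f (rfl | rfl | rfl)
        · exact Or.inl hx
        · exact Or.inr (Or.inl hy'.symm)
        · exact Or.inr (Or.inr hz'.symm)
      have hu' := hcases u hu
      have hv' := hcases v hv
      simp only [owner, Bool.or_eq_true, Bool.and_eq_true, beq_iff_eq]
      split_ifs <;> grind
    refine hij (Fin.ext ?_)
    have h1 := huv.2.resolve_right h3
    have h2 := huv'.2.resolve_right h3
    omega

end Arr

/-! ### Three vertices in one copy -/

namespace Arr

open SimpleGraph

lemma exists_two_coloring {Q : Type} {x x' y y' z z' : Q} (hx : x ≠ x') (hy : y ≠ y')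
    (hz : z ≠ z') :
    (∃ I : Set Q, (x ∈ I ↔ x' ∉ I) ∧ (y ∈ I ↔ y' ∉ I) ∧ (z ∈ I ↔ z' ∉ I)) ∨
    ∃ a b d, a ≠ b ∧ b ≠ d ∧ a ≠ d ∧ s(x, x') = s(a, b) ∧ s(y, y') = s(b, d) ∧
      s(z, z') = s(a, d) := by
  classical
  by_contra hno
  simp only [not_or, not_exists] at hno
  obtain ⟨h1, h2⟩ := hno
  have k1 := h1 {x, y, z}
  have k2 := h1 {x, y, z'}
  have k3 := h1 {x, y', z}
  have k4 := h1 {x, y', z'}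
  have l3 := h2 x x' y
  have l4 := h2 x x' y'
  have l5 := h2 x' x y
  have l6 := h2 x' x y'
  simp only [Set.mem_insert_iff, Set.mem_singleton_iff, Sym2.eq_iff] at *
  clear h1 h2
  by_cases e1 : x = y <;> by_cases e2 : x = y' <;> by_cases e3 : x = z <;>
    by_cases e4 : x = z' <;> by_cases e5 : x' = y <;> by_cases e6 : x' = y' <;> grind

variable {P Q : Type}

lemma not_free_iff {f : P ↪ Q} {k : Q} : ¬ Free f k ↔ ∃ p, f p = k := by
  simp [Free]

variable [Finite P] [Finite Q]

lemma free_iff (h : Nat.card Q = Nat.card P + 2) {f : P ↪ Q} {a b : Q} (ha : Free f a)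
    (hb : Free f b) (hab : a ≠ b) (c : Q) : Free f c ↔ c = a ∨ c = b :=
  ⟨fun hc => free_unique h ha hb hc hab, by rintro (rfl | rfl) <;> assumption⟩

lemma connOn_copies (h : Nat.card Q = Nat.card P + 2) (hP : 2 ≤ Nat.card P) (p : P) {I : Set Q}
    (hI : I.Nonempty) : (arr P Q).ConnOn {f | f p ∈ I} := by
  obtain ⟨c, hc⟩ := hI
  have := connOn_star h p (Y := ∅) hc (fun k _ => connOn_Cp h hP p k ∅ (by simp; omega))
    (fun k _ _ => by simpa using Nat.factorial_pos _)
  simpa using this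

/-- The two hubs outside the copy containing the triple. -/
lemma exists_two_hubs (h : Nat.card Q = Nat.card P + 2) (hP : 3 ≤ Nat.card P) (p : P) {c : Q}
    {x y z : P ↪ Q} (hx : x p = c) (hy : y p = c) (hz : z p = c) (hxy : x ≠ y) :
    ∃ A B : Set (P ↪ Q), (arr P Q).IsHub {x, y, z} A ∧ (arr P Q).IsHub {x, y, z} B ∧
      Disjoint A B ∧ Disjoint (Cp p c) A ∧ Disjoint (Cp p c) B := by
  obtain ⟨x₁, x₂, hx12, hfx⟩ := exists_free h x
  obtain ⟨y₁, y₂, hy12, hfy⟩ := exists_free h y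
  obtain ⟨z₁, z₂, hz12, hfz⟩ := exists_free h z
  have hfc : ∀ f ∈ ({x, y, z} : Set (P ↪ Q)), f p = c := by
    rintro f (rfl | rfl | rfl) <;> assumption
  have hdisj : ∀ A : Set (P ↪ Q), (∀ f ∈ A, f p ≠ c) →
      Disjoint {x, y, z} A ∧ Disjoint (Cp p c) A := fun A hA =>
    ⟨Set.disjoint_left.2 fun f hf hf' => hA f hf' (hfc f hf),
      Set.disjoint_left.2 fun f hf hf' => hA f hf' hf⟩
  rcases exists_two_coloring hx12 hy12 hz12 with
    ⟨I, hIx, hIy, hIz⟩ | ⟨a, b, d, hab, hbd, had, ex, ey, ez⟩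
  · have key : ∀ J : Set Q, (∀ f ∈ ({x, y, z} : Set (P ↪ Q)), ∃ k, Free f k ∧ k ∈ J) →
        c ∉ J → (arr P Q).IsHub {x, y, z} {f | f p ∈ J} ∧ Disjoint (Cp p c) {f | f p ∈ J} := by
      intro J hJ hc
      obtain ⟨k, -, hk⟩ := hJ x (by simp)
      obtain ⟨h1, h2⟩ := hdisj {f | f p ∈ J} (fun f hf hf' => hc (hf' ▸ hf))
      refine ⟨⟨connOn_copies h (by omega) p ⟨k, hk⟩, h1, fun s hs => ?_⟩, h2⟩
      obtain ⟨k, hk, hkJ⟩ := hJ s hs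
      exact ⟨mv s p k, by simpa using hkJ, adj_mv hk p⟩
    have hkc : ∀ f ∈ ({x, y, z} : Set (P ↪ Q)), ∀ k, Free f k → k ≠ c :=
      fun f hf k hk hkc => hk p ((hfc f hf).trans hkc.symm)
    have hA := key {k | k ∈ I ∧ k ≠ c} (by
      have := fun f hf k (hk : k ∈ I) h => (⟨k, h, hk, hkc f hf k h⟩ :
        ∃ k, Free f k ∧ k ∈ {k | k ∈ I ∧ k ≠ c})
      rintro f (rfl | rfl | rfl)
      · by_cases hI : x₁ ∈ I
        · exact this _ (by simp) x₁ hI ((hfx _).2 (Or.inl rfl))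
        · exact this _ (by simp) x₂ (by tauto) ((hfx _).2 (Or.inr rfl))
      · by_cases hI : y₁ ∈ I
        · exact this _ (by simp) y₁ hI ((hfy _).2 (Or.inl rfl))
        · exact this _ (by simp) y₂ (by tauto) ((hfy _).2 (Or.inr rfl))
      · by_cases hI : z₁ ∈ I
        · exact this _ (by simp) z₁ hI ((hfz _).2 (Or.inl rfl))
        · exact this _ (by simp) z₂ (by tauto) ((hfz _).2 (Or.inr rfl))) (fun h => h.2 rfl)
    have hB := key {k | k ∉ I ∧ k ≠ c} (by
      have := fun f hf k (hk : k ∉ I) h => (⟨k, h, hk, hkc f hf k h⟩ :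
        ∃ k, Free f k ∧ k ∈ {k | k ∉ I ∧ k ≠ c})
      rintro f (rfl | rfl | rfl)
      · by_cases hI : x₁ ∉ I
        · exact this _ (by simp) x₁ hI ((hfx _).2 (Or.inl rfl))
        · exact this _ (by simp) x₂ (by tauto) ((hfx _).2 (Or.inr rfl))
      · by_cases hI : y₁ ∉ I
        · exact this _ (by simp) y₁ hI ((hfy _).2 (Or.inl rfl))
        · exact this _ (by simp) y₂ (by tauto) ((hfy _).2 (Or.inr rfl))
      · by_cases hI : z₁ ∉ I
        · exact this _ (by simp) z₁ hI ((hfz _).2 (Or.inl rfl))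
        · exact this _ (by simp) z₂ (by tauto) ((hfz _).2 (Or.inr rfl))) (fun h => h.2 rfl)
    exact ⟨_, _, hA.1, hB.1, Set.disjoint_left.2 fun f h1 h2 => h2.1 h1.1, hA.2, hB.2⟩
  · have hxf : Free x a ∧ Free x b := by
      rw [hfx, hfx]; simp only [Sym2.eq_iff] at ex; grind
    have hyf : Free y b ∧ Free y d := by
      rw [hfy, hfy]; simp only [Sym2.eq_iff] at ey; grind
    have hzf : Free z a ∧ Free z d := by
      rw [hfz, hfz]; simp only [Sym2.eq_iff] at ez; grind
    have hac : a ≠ c := fun h => hxf.1 p (hx.trans h.symm)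
    have hbc : b ≠ c := fun h => hxf.2 p (hx.trans h.symm)
    have hdc : d ≠ c := fun h => hyf.2 p (hy.trans h.symm)
    obtain ⟨q, hq⟩ : ∃ q, y q = a := by
      rw [← not_free_iff, free_iff h hyf.1 hyf.2 hbd]
      rintro (h | h)
      · exact hab h
      · exact had h
    have hqp : q ≠ p := by
      rintro rfl
      exact hac (hq.symm.trans hy)
    obtain ⟨v, hv⟩ : ∃ v, v = mv y p b := ⟨_, rfl⟩
    have hvp : v p = b := by rw [hv, mv_same]
    have hvq : v q = a := by rw [hv, mv_of_ne hyf.1 hqp, hq]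
    have hvc : Free v c := by
      rw [hv, ← hy]; exact free_mv_self hyf.1
    obtain ⟨u, hu⟩ : ∃ u, u = mv v q c := ⟨_, rfl⟩
    have hup : u p = b := by rw [hu, mv_of_ne hvc hqp.symm, hvp]
    have huq : u q = c := by rw [hu, mv_same]
    have hua : Free u a := by
      rw [hu, ← hvq]; exact free_mv_self hvc
    have hYcard : ({v, u} : Set (P ↪ Q)).ncard ≤ 2 :=
      (Set.ncard_insert_le _ _).trans (by simp)
    have h6 := Nat.factorial_le hP
    have h3 : Nat.factorial 3 = 6 := rfl
    have hcopy : ∀ k, (arr P Q).ConnOn (Cp p k \ {v, u}) := fun k =>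
      connOn_Cp h (by omega) p k _ (by
        have := Set.ncard_le_ncard (Set.inter_subset_left (s := {v, u}) (t := Cp p k))
        omega)
    have hA1 : (arr P Q).ConnOn (Insert.insert v (Insert.insert u {f | f p ∈ ({a} : Set Q)})) :=
      ((connOn_copies h (by omega) p (Set.singleton_nonempty a)).insert
        ⟨mv u p a, mv_same u p a, (adj_mv hua p).symm⟩).insert
        ⟨u, by simp, hu ▸ (adj_mv hvc q).symm⟩
    have hB1 := connOn_star h p (Y := {v, u}) (I := {b, d}) (c := b) (by simp)
      (fun k _ => hcopy k) (fun k _ _ => by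
        have := Set.ncard_le_ncard (Set.inter_subset_left (s := {v, u}) (t := Cp p b ∪ Cp p k))
        omega)
    have hAp : ∀ f ∈ Insert.insert v (Insert.insert u {f | f p ∈ ({a} : Set Q)}), f p ≠ c := by
      rintro f (rfl | rfl | hf)
      · rwa [hvp]
      · rwa [hup]
      · simp only [Set.mem_singleton_iff, Set.mem_ofPred_eq] at hf
        rwa [hf]
    have hBp : ∀ f ∈ {f : P ↪ Q | f p ∈ ({b, d} : Set Q) ∧ f ∉ ({v, u} : Set (P ↪ Q))},
        f p ≠ c := by
      rintro f ⟨hf | hf, -⟩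
      · rwa [hf]
      · rw [hf]; exact hdc
    refine ⟨_, _, ⟨hA1, (hdisj _ hAp).1, ?_⟩, ⟨hB1, (hdisj _ hBp).1, ?_⟩, ?_, (hdisj _ hAp).2,
      (hdisj _ hBp).2⟩
    · rintro s (rfl | rfl | rfl)
      · exact ⟨mv s p a, by simp, adj_mv hxf.1 p⟩
      · exact ⟨v, by simp, hv ▸ adj_mv hyf.1 p⟩
      · exact ⟨mv s p a, by simp, adj_mv hzf.1 p⟩
    · rintro s (rfl | rfl | rfl)
      · refine ⟨mv s p b, ⟨by simp, ?_⟩, adj_mv hxf.2 p⟩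
        rintro (hs | hs)
        · exact hxy (mv_injOn hx hy hxf.2 hyf.1 (hs.trans hv))
        · have hsq : mv s p b q = c := by rw [hs]; exact huq
          rw [mv_of_ne hxf.2 hqp] at hsq
          exact hqp (s.injective (hsq.trans hx.symm))
      · refine ⟨mv s p d, ⟨by simp, ?_⟩, adj_mv hyf.2 p⟩
        rintro (hs | hs)
        · exact hbd (by rw [← hvp, ← hs, mv_same])
        · exact hbd (by rw [← hup, ← hs, mv_same])
      · refine ⟨mv s p d, ⟨by simp, ?_⟩, adj_mv hzf.2 p⟩
        rintro (hs | hs)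
        · exact hbd (by rw [← hvp, ← hs, mv_same])
        · exact hbd (by rw [← hup, ← hs, mv_same])
    · rw [Set.disjoint_left]
      rintro f (rfl | rfl | hf) ⟨hf1, hf2⟩
      · exact hf2 (by simp)
      · exact hf2 (by simp)
      · simp only [Set.mem_singleton_iff, Set.mem_ofPred_eq] at hf
        rcases hf1 with hf1 | hf1
        · exact hab (hf.symm.trans hf1)
        · exact had (hf.symm.trans hf1)

/-- The induction step for a triple inside one copy. -/
theorem goodIn_of_same (h : Nat.card Q = Nat.card P + 2) (hP : 3 ≤ Nat.card P) (p : P) {c : Q}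
    {x y z : P ↪ Q} (hx : x p = c) (hy : y p = c) (hz : z p = c) (hxy : x ≠ y) (hxz : x ≠ z)
    (hyz : y ≠ z)
    (ih : ∀ S : Set ({q // q ≠ p} ↪ {k // k ≠ c}), S.ncard = 3 →
      (arr {q // q ≠ p} {k // k ≠ c}).GoodIn S Set.univ (Fin (2 * Nat.card P - 3))) :
    (arr P Q).GoodIn {x, y, z} Set.univ (Fin (2 * Nat.card P - 1)) := by
  have hS : ({x, y, z} : Set (P ↪ Q)) ⊆ Set.range (extEmb p c) := by
    rw [range_extEmb]
    rintro f (rfl | rfl | rfl) <;> assumption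
  have himg : extEmb p c '' (extEmb p c ⁻¹' {x, y, z}) = {x, y, z} :=
    Set.image_preimage_eq_of_subset hS
  have hcard : (extEmb p c ⁻¹' {x, y, z}).ncard = 3 := by
    rw [← Set.ncard_image_of_injective _ (extEmb p c).injective, himg]
    exact Set.ncard_eq_three.2 ⟨x, y, z, hxy, hxz, hyz, rfl⟩
  have hgood := (ih _ hcard).map (extEmb p c)
  rw [himg, Set.image_univ, range_extEmb] at hgood
  obtain ⟨A, B, hA, hB, hAB, hcA, hcB⟩ := exists_two_hubs h hP p hx hy hz hxy
  refine (hgood.sum (κ := Bool) (fun b => if b then A else B) ?_ ?_ ?_).of_card ?_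
  · rintro (_ | _)
    · simpa using hB
    · simpa using hA
  · rintro (_ | _) (_ | _) hne
    · exact (hne rfl).elim
    · simpa using hAB.symm
    · simpa using hAB
    · exact (hne rfl).elim
  · rintro (_ | _)
    · simpa using hcB
    · simpa using hcA
  · rw [Nat.card_sum]
    simp
    omega

end Arr

/-! ### Neighbourhoods -/

namespace Arr

open SimpleGraph

variable {P Q : Type}

/-- The neighbours of `x` obtained by changing the value at a position in `A`. -/
def nbr (x : P ↪ Q) (A : Set P) : Set (P ↪ Q) := {f | ∃ q ∈ A, ∃ k, Free x k ∧ f = mv x q k}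

lemma adj_of_mem_nbr {x f : P ↪ Q} {A : Set P} (hf : f ∈ nbr x A) : (arr P Q).Adj x f := by
  obtain ⟨q, -, k, hk, rfl⟩ := hf
  exact adj_mv hk q

lemma mem_Cp_of_mem_nbr {x f : P ↪ Q} {p : P} (hf : f ∈ nbr x {p}ᶜ) : f p = x p := by
  obtain ⟨q, hq, k, hk, rfl⟩ := hf
  exact mv_of_ne hk (Ne.symm hq)

lemma mem_nbr_iff {x f : P ↪ Q} {p : P} :
    f ∈ nbr x {p}ᶜ ↔ (arr P Q).Adj x f ∧ f p = x p := by
  refine ⟨fun hf => ⟨adj_of_mem_nbr hf, mem_Cp_of_mem_nbr hf⟩, fun ⟨hf, hp⟩ => ?_⟩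
  obtain ⟨q, k, hk, rfl⟩ := adj_iff.1 hf
  refine ⟨q, ?_, k, hk, rfl⟩
  rintro rfl
  exact hk q (by rw [← hp, mv_same])

lemma nbr_univ (x : P ↪ Q) : nbr x Set.univ = (arr P Q).neighborSet x := by
  ext f
  simp [nbr, adj_iff]

lemma mv_inj {x : P ↪ Q} {q r : P} {k l : Q} (hk : Free x k) (hl : Free x l)
    (h : mv x q k = mv x r l) : q = r ∧ k = l := by
  have hqr : q = r := by
    by_contra hne
    have := DFunLike.congr_fun h q
    rw [mv_same, mv_of_ne hl hne] at this
    exact hk q this.symm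
  subst hqr
  have := DFunLike.congr_fun h q
  simpa using this

variable [Finite P] [Finite Q]

lemma ncard_nbr (h : Nat.card Q = Nat.card P + 2) (x : P ↪ Q) (A : Set P) :
    (nbr x A).ncard = 2 * A.ncard := by
  obtain ⟨a, b, hab, hf⟩ := exists_free h x
  have : nbr x A = (fun s : P × Q => mv x s.1 s.2) '' (A ×ˢ {a, b}) := by
    ext f
    simp only [nbr, hf, Set.mem_ofPred_eq, Set.mem_image, Set.mem_prod, Prod.exists,
      Set.mem_insert_iff, Set.mem_singleton_iff]
    constructor
    · rintro ⟨q, hq, k, hk, rfl⟩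
      exact ⟨q, k, ⟨hq, hk⟩, rfl⟩
    · rintro ⟨q, k, ⟨hq, hk⟩, rfl⟩
      exact ⟨q, hq, k, hk, rfl⟩
  rw [this, Set.InjOn.ncard_image, Set.ncard_prod, Set.ncard_pair hab, mul_comm]
  rintro ⟨q, k⟩ ⟨-, hk⟩ ⟨r, l⟩ ⟨-, hl⟩ he
  obtain ⟨rfl, rfl⟩ := mv_inj ((hf k).2 hk) ((hf l).2 hl) he
  rfl

lemma ncard_nbr_compl (h : Nat.card Q = Nat.card P + 2) (x : P ↪ Q) (p : P) :
    (nbr x {p}ᶜ).ncard = 2 * (Nat.card P - 1) := by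
  rw [ncard_nbr h, Set.ncard_compl, Set.ncard_singleton]

/-- A choice of intermediate copies for the paths leaving the closed neighbourhood of `x`. -/
lemma exists_exits (h : Nat.card Q = Nat.card P + 2) (hP : 3 ≤ Nat.card P) {p : P} {c₂ : Q}
    {x : P ↪ Q} (hx : x p ≠ c₂) :
    ∃ (j : (P ↪ Q) → Q) (k₀ : Q), (∀ t ∈ Insert.insert x (nbr x {p}ᶜ), ¬ Free t c₂ → Free t (j t)) ∧
      Free x k₀ ∧ k₀ ≠ c₂ ∧ (¬ Free x c₂ → k₀ ≠ j x) ∧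
      ∀ k, {t ∈ Insert.insert x (nbr x {p}ᶜ) | ¬ Free t c₂ ∧ j t = k}.ncard ≤ Nat.card P - 2 := by
  classical
  obtain ⟨c, c', hcc, hfx, hc'⟩ : ∃ c c', c ≠ c' ∧ (∀ k, Free x k ↔ k = c ∨ k = c') ∧ c' ≠ c₂ := by
    obtain ⟨a, b, hab, hf⟩ := exists_free h x
    by_cases hb : b = c₂
    · exact ⟨b, a, hab.symm, fun k => (hf k).trans or_comm, fun h => hab (h.trans hb.symm)⟩
    · exact ⟨a, b, hab, hf, hb⟩
  have hxc : Free x c := (hfx c).2 (Or.inl rfl)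
  have hxc' : Free x c' := (hfx c').2 (Or.inr rfl)
  choose l hl hlc using fun t => exists_free_ne h t c'
  -- the value on each neighbour
  have hj : ∃ j : (P ↪ Q) → Q, j x = c' ∧ ∀ t, t ≠ x → j t = if Free t c then c else l t :=
    ⟨fun t => if t = x then c' else if Free t c then c else l t, by simp, fun t ht => by simp [ht]⟩
  obtain ⟨j, hjx, hj⟩ := hj
  have hjn : ∀ t, t ∈ Insert.insert x (nbr x {p}ᶜ) → ¬ Free t c₂ → (t = x ∧ j t = c') ∨
      (∃ q, q ≠ p ∧ t = mv x q c' ∧ j t = c ∧ x q ≠ c₂ ∧ c ≠ c₂) ∨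
      ∃ q, q ≠ p ∧ t = mv x q c ∧ j t = x q := by
    rintro t (rfl | ⟨q, hq, k, hk, rfl⟩) ht
    · exact Or.inl ⟨rfl, hjx⟩
    · right
      have hne : mv x q k ≠ x := (adj_mv hk q).ne'
      rcases (hfx k).1 hk with rfl | rfl
      · right
        refine ⟨q, hq, rfl, ?_⟩
        have hnf : ¬ Free (mv x q k) k := fun hf => hf q (mv_same _ _ _)
        rw [hj _ hne, if_neg hnf]
        rcases (free_mv hk).1 (hl (mv x q k)) with ⟨h1, h2⟩ | h1
        · rcases (hfx _).1 h1 with h3 | h3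
          · exact (h2 h3).elim
          · exact (hlc _ h3).elim
        · exact h1
      · left
        have hf : Free (mv x q k) c := (free_mv hk).2 (Or.inl ⟨hxc, hcc⟩)
        refine ⟨q, hq, rfl, ?_, ?_, ?_⟩
        · rw [hj _ hne, if_pos hf]
        · rintro rfl
          exact ht (free_mv_self hk)
        · rintro rfl
          exact ht hf
  refine ⟨j, if c = c₂ then c' else c, ?_, ?_, ?_, ?_, ?_⟩
  · intro t ht htf
    rcases hjn t ht htf with ⟨rfl, h1⟩ | ⟨q, hq, rfl, h1, -⟩ | ⟨q, hq, rfl, h1⟩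
    · rwa [h1]
    · rw [h1]; exact (free_mv hxc').2 (Or.inl ⟨hxc, hcc⟩)
    · rw [h1]; exact free_mv_self hxc
  · split_ifs <;> assumption
  · split_ifs <;> assumption
  · intro hnf
    rw [if_neg (by rintro rfl; exact hnf hxc), hjx]
    exact hcc
  · intro k
    by_cases hk : k = c
    · subst hk
      by_cases hc : k = c₂
      · refine le_trans (le_of_eq ?_) (Nat.zero_le _)
        rw [Set.ncard_eq_zero, Set.eq_empty_iff_forall_notMem]
        rintro t ⟨ht, htf, hjt⟩
        rcases hjn t ht htf with ⟨rfl, h1⟩ | ⟨q, hq, rfl, h1, -, h2⟩ | ⟨q, hq, rfl, h1⟩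
        · exact hcc (hjt.symm.trans h1)
        · exact h2 hc
        · exact hxc q (h1.symm.trans hjt)
      · by_cases hfree : Free x c₂
        · rcases (hfx _).1 hfree with h1 | h1
          · exact (hc h1.symm).elim
          · exact (hc' h1.symm).elim
        · obtain ⟨q₀, hq₀⟩ := not_free_iff.1 hfree
          have hq₀p : q₀ ≠ p := by rintro rfl; exact hx hq₀
          have hcard : ({p, q₀}ᶜ : Set P).ncard = Nat.card P - 2 := by
            rw [Set.ncard_compl, Set.ncard_pair hq₀p.symm]
          rw [← hcard]
          refine (Set.ncard_le_ncard (t := (fun q => mv x q c') '' ({p, q₀}ᶜ : Set P)) ?_).trans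
            (Set.ncard_image_le (Set.toFinite _))
          rintro t ⟨ht, htf, hjt⟩
          rcases hjn t ht htf with ⟨rfl, h1⟩ | ⟨q, hq, rfl, h1, h2, -⟩ | ⟨q, hq, rfl, h1⟩
          · exact (hcc (hjt.symm.trans h1)).elim
          · refine ⟨q, ?_, rfl⟩
            rintro (rfl | rfl)
            · exact hq rfl
            · exact h2 hq₀
          · exact (hxc q (h1.symm.trans hjt)).elim
    · refine le_trans (b := 1) ?_ (by omega)
      rw [Set.ncard_le_one_iff]
      rintro t u ⟨ht, htf, hjt⟩ ⟨hu, huf, hju⟩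
      rcases hjn t ht htf with ⟨rfl, h1⟩ | ⟨q, hq, rfl, h1, h2, -⟩ | ⟨q, hq, rfl, h1⟩ <;>
      rcases hjn u hu huf with ⟨rfl, h1'⟩ | ⟨q', hq', rfl, h1', h2', -⟩ | ⟨q', hq', rfl, h1'⟩
      · rfl
      · exact (hk (hju.symm.trans h1')).elim
      · exact (hxc' q' (by rw [← h1', hju, ← hjt, h1])).elim
      · exact (hk (hjt.symm.trans h1)).elim
      · exact (hk (hjt.symm.trans h1)).elim
      · exact (hk (hjt.symm.trans h1)).elim
      · exact (hxc' q (by rw [← h1, hjt, ← hju, h1'])).elim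
      · exact (hk (hju.symm.trans h1')).elim
      · rw [x.injective (a₁ := q) (a₂ := q') (by rw [← h1, ← h1', hjt, hju])]

end Arr

/-! ### Fans -/

namespace Arr

open SimpleGraph

variable {P Q : Type} [Finite P] [Finite Q]

lemma exists_fan_Cp (h : Nat.card Q = Nat.card P + 2) (hP : 2 ≤ Nat.card P) {p : P} {c : Q}
    {z : P ↪ Q} (hz : z p = c) {A X : Set (P ↪ Q)} (hX : X ⊆ Cp p c \ A) (hzA : z ∉ A)
    (hzX : z ∉ X) (hcard : A.ncard + X.ncard ≤ 2 * (Nat.card P - 1)) :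
    ∃ F : (P ↪ Q) → Set (P ↪ Q), (∀ t ∈ X, (arr P Q).ConnOn (F t) ∧ t ∈ F t ∧
      F t ⊆ Cp p c \ A ∧ z ∉ F t ∧ ∃ v ∈ F t, (arr P Q).Adj z v) ∧
      ∀ s ∈ X, ∀ t ∈ X, s ≠ t → Disjoint (F s) (F t) := by
  classical
  obtain ⟨X, rfl⟩ := (Set.toFinite X).exists_finset_coe
  refine exists_fan (X := X) (z := z) (U := Cp p c \ A) (by simpa using hzX) fun Y hzY hY => ?_
  rw [Set.ncard_coe_finset] at hcard
  obtain ⟨t, htX, htY⟩ := Finset.exists_mem_notMem_of_card_lt_card hY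
  have hA : (arr P Q).ConnOn (Cp p c \ (Y ∪ A)) := by
    refine connOn_Cp h hP p c _ (lt_of_le_of_lt (Set.ncard_le_ncard Set.inter_subset_left) ?_)
    refine lt_of_le_of_lt (Set.ncard_union_le _ _) ?_
    rw [Set.ncard_coe_finset]
    omega
  obtain ⟨w, hw⟩ := hA.exists_walk (u := z) (v := t) ⟨hz, by simp [hzY, hzA]⟩
    ⟨(hX htX).1, by simp [htY, (hX htX).2]⟩
  exact ⟨t, htX, w, fun v hv => ⟨⟨(hw v hv).1, fun hA => (hw v hv).2 (Or.inr hA)⟩,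
    fun hY => (hw v hv).2 (Or.inl hY)⟩⟩

lemma exists_fan_nbr (h : Nat.card Q = Nat.card P + 2) (hP : 2 ≤ Nat.card P) {p : P} {c : Q}
    {x y : P ↪ Q} (hx : x p = c) (hy : y p = c) (hxy : x ≠ y) :
    ∃ F : (P ↪ Q) → Set (P ↪ Q), (∀ t ∈ nbr x {p}ᶜ \ {y}, (arr P Q).ConnOn (F t) ∧ t ∈ F t ∧
      F t ⊆ Cp p c \ {x} ∧ y ∉ F t ∧ ∃ v ∈ F t, (arr P Q).Adj y v) ∧
      ∀ s ∈ nbr x {p}ᶜ \ {y}, ∀ t ∈ nbr x {p}ᶜ \ {y}, s ≠ t → Disjoint (F s) (F t) := by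
  classical
  have hcard := ncard_nbr_compl h x p
  have hsub : nbr x {p}ᶜ \ {y} ⊆ Cp p c \ {x} := fun t ht =>
    ⟨(mem_Cp_of_mem_nbr ht.1).trans hx, fun hx => (adj_of_mem_nbr ht.1).ne (Eq.symm hx)⟩
  by_cases hadj : (arr P Q).Adj x y
  · have hyN : y ∈ nbr x {p}ᶜ := mem_nbr_iff.2 ⟨hadj, hy.trans hx.symm⟩
    refine exists_fan_Cp h hP hy hsub (by simpa using hxy.symm) (by simp) ?_
    have := Set.ncard_sdiff_singleton_of_mem hyN
    rw [Set.ncard_singleton]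
    omega
  · obtain ⟨X, hX⟩ := (Set.toFinite (nbr x {p}ᶜ \ {y})).exists_finset_coe
    rw [← hX] at hsub ⊢
    have hyX : y ∉ X := fun hy => by
      have : y ∈ (X : Set (P ↪ Q)) := hy
      rw [hX] at this
      exact this.2 rfl
    refine exists_fan hyX fun Y hyY hY => ?_
    have hX' : X.card ≤ 2 * (Nat.card P - 1) := by
      rw [← hcard, ← Set.ncard_coe_finset, hX]
      exact Set.ncard_le_ncard Set.sdiff_subset
    by_cases hxY : x ∈ Y
    · obtain ⟨t, htX, htY⟩ := Finset.exists_mem_notMem_of_card_lt_card hY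
      have hA : (arr P Q).ConnOn (Cp p c \ Y) := by
        refine connOn_Cp h hP p c _ (lt_of_le_of_lt (Set.ncard_le_ncard Set.inter_subset_left) ?_)
        rw [Set.ncard_coe_finset]
        omega
      obtain ⟨w, hw⟩ := hA.exists_walk (u := y) (v := t) ⟨hy, hyY⟩ ⟨(hsub htX).1, htY⟩
      refine ⟨t, htX, w, fun v hv => ⟨⟨(hw v hv).1, ?_⟩, (hw v hv).2⟩⟩
      rintro rfl
      exact (hw _ hv).2 hxY
    · have hA : (arr P Q).ConnOn (Cp p c \ Y) := by
        refine connOn_Cp h hP p c _ (lt_of_le_of_lt (Set.ncard_le_ncard Set.inter_subset_left) ?_)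
        rw [Set.ncard_coe_finset]
        omega
      obtain ⟨w, hw⟩ := hA.exists_walk (u := x) (v := y) ⟨hx, hxY⟩ ⟨hy, hyY⟩
      obtain ⟨w', hw', hsub'⟩ : ∃ w' : (arr P Q).Walk x y, w'.IsPath ∧ w'.support ⊆ w.support :=
        ⟨w.bypass, w.bypass_isPath, w.support_bypass_subset_support⟩
      cases w' with
      | nil => exact (hxy rfl).elim
      | @cons _ t _ hxt w' =>
        rw [Walk.cons_isPath_iff] at hw'
        have hsup : ∀ v ∈ w'.support, v ∈ Cp p c \ Y := fun v hv => hw v (hsub' (by simp [hv]))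
        have htN : t ∈ nbr x {p}ᶜ := mem_nbr_iff.2 ⟨hxt, (hsup t (by simp)).1.trans hx.symm⟩
        have htX : t ∈ (X : Set (P ↪ Q)) := by
          rw [hX]
          refine ⟨htN, ?_⟩
          rintro rfl
          exact hadj hxt
        refine ⟨t, htX, w'.reverse, fun v hv => ?_⟩
        rw [Walk.support_reverse, List.mem_reverse] at hv
        refine ⟨⟨(hsup v hv).1, ?_⟩, (hsup v hv).2⟩
        rintro rfl
        exact hw'.2 hv

end Arr

/-! ### Two vertices in one copy -/

namespace Arr

open SimpleGraph

variable {P Q : Type}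

open Classical in
/-- Exchange two symbols. -/
noncomputable def sw (c d : Q) (t : P ↪ Q) : P ↪ Q := t.trans (Equiv.swap c d).toEmbedding

lemma sw_of_eq_left {c d : Q} {t : P ↪ Q} {q : P} (hq : t q = c) : sw c d t q = d := by
  simp [sw, hq]

lemma sw_of_eq_right {c d : Q} {t : P ↪ Q} {q : P} (hq : t q = d) : sw c d t q = c := by
  simp [sw, hq]

lemma sw_of_ne {c d : Q} {t : P ↪ Q} {q : P} (hc : t q ≠ c) (hd : t q ≠ d) :
    sw c d t q = t q := by
  classical
  simp [sw, Equiv.swap_apply_of_ne_of_ne hc hd]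

lemma sw_injective (c d : Q) : Function.Injective (sw c d : (P ↪ Q) → (P ↪ Q)) := by
  intro s t h
  ext q
  have := DFunLike.congr_fun h q
  simpa [sw] using this

lemma free_sw {c d k : Q} {t : P ↪ Q} (hc : k ≠ c) (hd : k ≠ d) (hk : Free t k) :
    Free (sw c d t) k := by
  intro q hq
  by_cases h1 : t q = c
  · exact hd (hq.symm.trans (sw_of_eq_left h1))
  by_cases h2 : t q = d
  · exact hc (hq.symm.trans (sw_of_eq_right h2))
  · exact hk q ((sw_of_ne h1 h2).symm.trans hq)

lemma sw_of_free {c d : Q} {t : P ↪ Q} {p : P} (hp : t p = c) (hd : Free t d) :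
    sw c d t = mv t p d := by
  refine eq_mv hd (sw_of_eq_left hp) fun q hq => sw_of_ne (fun h => hq ?_) (hd q)
  exact t.injective (h.trans hp.symm)

open Classical in
/-- The interior of the path from `t` to `sw c d t` which changes the value at `p` via `j`. -/
noncomputable def lk (p : P) (c d j : Q) (t : P ↪ Q) : Set (P ↪ Q) :=
  if Free t d then ∅ else {mv t p j, mv (sw c d t) p j}

lemma lk_of_not_free {p : P} {c d j : Q} {t : P ↪ Q} (ht : ¬ Free t d) :
    lk p c d j t = {mv t p j, mv (sw c d t) p j} := if_neg ht

lemma mem_lk {p : P} {c d j : Q} {t f : P ↪ Q} (hf : f ∈ lk p c d j t) :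
    ¬ Free t d ∧ (f = mv t p j ∨ f = mv (sw c d t) p j) := by
  by_cases ht : Free t d
  · simp [lk, ht] at hf
  · rw [lk_of_not_free ht] at hf
    exact ⟨ht, hf⟩

lemma apply_of_mem_lk {p : P} {c d j : Q} {t f : P ↪ Q} (hf : f ∈ lk p c d j t) : f p = j := by
  rcases (mem_lk hf).2 with rfl | rfl <;> exact mv_same _ _ _

variable {p : P} {c d j : Q} {s t : P ↪ Q}

lemma ne_of_free_lk (ht : t p = c) (hj : ¬ Free t d → Free t j) (htd : ¬ Free t d) :
    Free t j ∧ j ≠ c ∧ j ≠ d := by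
  refine ⟨hj htd, fun h => hj htd p (ht.trans h.symm), ?_⟩
  rintro rfl
  exact htd (hj htd)

lemma eq_of_mem_lk_left (hcd : c ≠ d) (ht : t p = c) (hj : ¬ Free t d → Free t j)
    (hs : s p = c) {k : Q} (hk : Free s k) (hm : mv s p k ∈ lk p c d j t) :
    s = t ∧ k = j ∧ ¬ Free t d := by
  obtain rfl : k = j := (mv_same s p k).symm.trans (apply_of_mem_lk hm)
  obtain ⟨htd, hm⟩ := mem_lk hm
  obtain ⟨hjf, hjc, hjd⟩ := ne_of_free_lk ht hj htd
  refine ⟨?_, rfl, htd⟩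
  rcases hm with hm | hm
  · exact mv_injOn hs ht hk hjf hm
  · obtain ⟨q, hq⟩ := not_free_iff.1 htd
    have hqp : q ≠ p := by
      rintro rfl
      exact hcd (ht.symm.trans hq)
    have := DFunLike.congr_fun hm q
    rw [mv_of_ne hk hqp, mv_of_ne (free_sw hjc hjd hjf) hqp, sw_of_eq_right hq] at this
    exact (hqp (s.injective (this.trans hs.symm))).elim

lemma eq_of_mem_lk_right (hcd : c ≠ d) (ht : t p = c) (hj : ¬ Free t d → Free t j)
    (hs : s p = d) {k : Q} (hk : Free s k) (hm : mv s p k ∈ lk p c d j t) :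
    s = sw c d t ∧ k = j ∧ ¬ Free t d := by
  obtain rfl : k = j := (mv_same s p k).symm.trans (apply_of_mem_lk hm)
  obtain ⟨htd, hm⟩ := mem_lk hm
  obtain ⟨hjf, hjc, hjd⟩ := ne_of_free_lk ht hj htd
  refine ⟨?_, rfl, htd⟩
  rcases hm with hm | hm
  · obtain ⟨q, hq⟩ := not_free_iff.1 htd
    have hqp : q ≠ p := by
      rintro rfl
      exact hcd (ht.symm.trans hq)
    have := DFunLike.congr_fun hm q
    rw [mv_of_ne hk hqp, mv_of_ne hjf hqp, hq] at this
    exact (hqp (s.injective (this.trans hs.symm))).elim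
  · exact mv_injOn hs (sw_of_eq_left ht) hk (free_sw hjc hjd hjf) hm

lemma disjoint_lk (hcd : c ≠ d) {i : Q} (ht : t p = c) (hj : ¬ Free t d → Free t j)
    (hs : s p = c) (hi : ¬ Free s d → Free s i) (hst : s ≠ t) :
    Disjoint (lk p c d i s) (lk p c d j t) := by
  rw [Set.disjoint_left]
  intro f hf hf'
  obtain ⟨hsd, rfl | rfl⟩ := mem_lk hf
  · exact hst (eq_of_mem_lk_left hcd ht hj hs (hi hsd) hf').1
  · obtain ⟨hif, hic, hid⟩ := ne_of_free_lk hs hi hsd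
    exact hst (sw_injective c d
      (eq_of_mem_lk_right hcd ht hj (sw_of_eq_left hs) (free_sw hic hid hif) hf').1)

lemma connOn_union_lk (hcd : c ≠ d) (ht : t p = c) (hj : ¬ Free t d → Free t j)
    {A : Set (P ↪ Q)} (hA : (arr P Q).ConnOn A) (htA : t ∈ A) :
    (arr P Q).ConnOn (A ∪ lk p c d j t) ∧
      ∃ v ∈ A ∪ lk p c d j t, (arr P Q).Adj v (sw c d t) := by
  by_cases htd : Free t d
  · rw [lk, if_pos htd, Set.union_empty]
    exact ⟨hA, t, htA, sw_of_free ht htd ▸ adj_mv htd p⟩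
  · obtain ⟨hjf, hjc, hjd⟩ := ne_of_free_lk ht hj htd
    obtain ⟨q, hq⟩ := not_free_iff.1 htd
    have hqp : q ≠ p := by
      rintro rfl
      exact hcd (ht.symm.trans hq)
    have hjs := free_sw hjc hjd hjf
    have hadj : (arr P Q).Adj (mv t p j) (mv (sw c d t) p j) := by
      refine adj_of_eqOn (p := q) (fun he => ?_) fun r hr => ?_
      · have := DFunLike.congr_fun he q
        rw [mv_of_ne hjf hqp, mv_of_ne hjs hqp, sw_of_eq_right hq, hq] at this
        exact hcd this.symm
      · by_cases hrp : r = p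
        · rw [hrp, mv_same, mv_same]
        · rw [mv_of_ne hjf hrp, mv_of_ne hjs hrp, sw_of_ne]
          · exact fun h => hrp (t.injective (h.trans ht.symm))
          · exact fun h => hr (t.injective (h.trans hq.symm))
    rw [lk_of_not_free htd]
    refine ⟨hA.union ?_ ⟨t, htA, mv t p j, by simp, Or.inr (adj_mv hjf p)⟩,
      mv (sw c d t) p j, by simp, (adj_mv hjs p).symm⟩
    have := (connOn_singleton (G := arr P Q) (mv (sw c d t) p j)).insert ⟨_, rfl, hadj.symm⟩
    exact this

variable [Finite P] [Finite Q]

lemma lt_factorial' {m : ℕ} (hm : 3 ≤ m) : 4 * (m - 2) < m.factorial := by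
  obtain rfl | hm' := hm.eq_or_lt
  · decide
  · obtain ⟨k, rfl⟩ : ∃ k, m = k + 1 := ⟨m - 1, by omega⟩
    have := lt_factorial (m := k) (by omega)
    rw [Nat.factorial_succ]
    have : 4 * k.factorial ≤ (k + 1) * k.factorial := Nat.mul_le_mul_right _ (by omega)
    omega

/-- The induction step for a triple meeting exactly two copies. -/
theorem goodIn_of_pair (h : Nat.card Q = Nat.card P + 2) (hP : 3 ≤ Nat.card P) (hcd : c ≠ d)
    {x y z : P ↪ Q} (hx : x p = c) (hy : y p = c) (hz : z p = d) (hxy : x ≠ y) :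
    (arr P Q).GoodIn {x, y, z} Set.univ (Fin (2 * Nat.card P - 1)) := by
  classical
  obtain ⟨j, k₀, hj, hk₀, hk₀d, hk₀j, hcard⟩ :=
    exists_exits h hP (x := x) (p := p) (c₂ := d) (by rwa [hx])
  obtain ⟨X, hX⟩ : ∃ X, X = nbr x {p}ᶜ \ {y} := ⟨_, rfl⟩
  obtain ⟨T, hT⟩ : ∃ T, T = X ∪ {t | t = x ∧ (arr P Q).Adj x y} := ⟨_, rfl⟩
  have hXT : X ⊆ T := hT ▸ Set.subset_union_left
  have hTx : T ⊆ Insert.insert x (nbr x {p}ᶜ) := by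
    rw [hT, hX]
    rintro t (ht | ht)
    · exact Or.inr ht.1
    · exact Or.inl ht.1
  have hTp : ∀ t ∈ T, t p = c := fun t ht => by
    rcases hTx ht with rfl | ht
    · exact hx
    · exact (mem_Cp_of_mem_nbr ht).trans hx
  have hyT : y ∉ T := by
    rw [hT, hX]
    rintro (hy | hy)
    · exact hy.2 rfl
    · exact hxy hy.1.symm
  have hjT : ∀ t ∈ T, ¬ Free t d → Free t (j t) := fun t ht => hj t (hTx ht)
  have hXcard : X.ncard + (if (arr P Q).Adj x y then 1 else 0) = 2 * (Nat.card P - 1) := by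
    rw [← ncard_nbr_compl h x p, hX]
    split_ifs with hadj
    · rw [Set.ncard_sdiff_singleton_add_one (mem_nbr_iff.2 ⟨hadj, hy.trans hx.symm⟩)]
    · rw [Set.sdiff_singleton_eq_self fun hy => hadj (mem_nbr_iff.1 hy).1, add_zero]
  have hTcard : T.ncard ≤ 2 * (Nat.card P - 1) := by
    rw [← hXcard, hT]
    refine (Set.ncard_union_le _ _).trans (Nat.add_le_add_left ?_ _)
    split_ifs with hadj <;> simp [hadj]
  obtain ⟨F, hF, hFd⟩ := exists_fan_nbr h (by omega) hx hy hxy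
  rw [← hX] at hF hFd
  obtain ⟨L, hL⟩ : ∃ L : (P ↪ Q) → Set (P ↪ Q), ∀ t, L t = lk p c d (j t) t := ⟨_, fun _ => rfl⟩
  have hLp : ∀ t ∈ T, ∀ f ∈ L t, f p ≠ c ∧ f p ≠ d := fun t ht f hf => by
    rw [hL] at hf
    rw [apply_of_mem_lk hf]
    exact (ne_of_free_lk (hTp t ht) (hjT t ht) (mem_lk hf).1).2
  have hLd : ∀ s ∈ T, ∀ t ∈ T, s ≠ t → Disjoint (L s) (L t) := fun s hs t ht hst => by
    rw [hL, hL]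
    exact disjoint_lk hcd (hTp t ht) (hjT t ht) (hTp s hs) (hjT s hs) hst
  -- the ends of the paths in the copy of `z`
  have hE : ∃ E : (P ↪ Q) → Set (P ↪ Q), (∀ t ∈ T, (∀ f ∈ E t, f p = d) ∧ z ∉ E t ∧
      ∀ A, (arr P Q).ConnOn A → (∃ v ∈ A, (arr P Q).Adj v (sw c d t)) →
        (arr P Q).ConnOn (A ∪ E t) ∧ ∃ v ∈ A ∪ E t, (arr P Q).Adj z v) ∧
      ∀ s ∈ T, ∀ t ∈ T, s ≠ t → Disjoint (E s) (E t) := by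
    obtain ⟨D, hD, hDd⟩ := exists_fan_Cp h (by omega) hz (A := ∅) (X := sw c d '' T \ {z}) (by
        rintro _ ⟨⟨t, ht, rfl⟩, -⟩
        exact ⟨sw_of_eq_left (hTp t ht), by simp⟩) (by simp) (by simp) (by
        have := Set.ncard_le_ncard (Set.sdiff_subset (s := sw c d '' T) (t := {z}))
        have := Set.ncard_image_le (s := T) (f := sw c d) (Set.toFinite _)
        simp only [Set.ncard_empty]
        omega)
    have hmem : ∀ t ∈ T, sw c d t ≠ z → sw c d t ∈ sw c d '' T \ {z} := fun t ht htz =>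
      ⟨⟨t, ht, rfl⟩, htz⟩
    refine ⟨fun t => if sw c d t = z then ∅ else D (sw c d t), fun t ht => ?_,
      fun s hs t ht hst => ?_⟩
    · by_cases htz : sw c d t = z
      · simp only [htz, if_true, Set.union_empty]
        refine ⟨by simp, by simp, fun A hA ⟨v, hv, hvz⟩ => ⟨hA, v, hv, hvz.symm⟩⟩
      · simp only [htz, if_false]
        obtain ⟨h1, h2, h3, h4, v, hv, hzv⟩ := hD _ (hmem t ht htz)
        refine ⟨fun f hf => (h3 hf).1, h4, fun A hA ⟨w, hw, hwt⟩ =>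
          ⟨hA.union h1 ⟨w, hw, _, h2, Or.inr hwt⟩, v, Or.inr hv, hzv⟩⟩
    · by_cases hsz : sw c d s = z <;> by_cases htz : sw c d t = z <;>
        simp only [hsz, htz, if_true, if_false, Set.disjoint_empty, Set.empty_disjoint]
      exact hDd _ (hmem s hs hsz) _ (hmem t ht htz) ((sw_injective c d).ne hst)
  obtain ⟨E, hE, hEd⟩ := hE
  -- the hub in the remaining copies
  obtain ⟨Y, hY⟩ : ∃ Y : Set (P ↪ Q), Y = ⋃ t ∈ T, L t := ⟨_, rfl⟩
  have hmemY : ∀ f, f ∈ Y ↔ ∃ t ∈ T, f ∈ L t := fun f => by simp [hY]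
  obtain ⟨R, hR⟩ : ∃ R : Set (P ↪ Q), R = {f | f p ∈ ({c, d}ᶜ : Set Q) ∧ f ∉ Y} := ⟨_, rfl⟩
  have hRp : ∀ f ∈ R, f p ≠ c ∧ f p ≠ d := by
    rintro f hf
    rw [hR] at hf
    simpa using hf.1
  have hk₀c : k₀ ≠ c := fun h => hk₀ p (hx.trans h.symm)
  have hYk : ∀ k, (Y ∩ Cp p k).ncard ≤ 2 * (Nat.card P - 2) := by
    intro k
    obtain ⟨B, hB⟩ : ∃ B, B = {t ∈ Insert.insert x (nbr x {p}ᶜ) | ¬ Free t d ∧ j t = k} :=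
      ⟨_, rfl⟩
    have hBk := hcard k
    rw [← hB] at hBk
    have hsub : Y ∩ Cp p k ⊆ (fun t => mv t p k) '' B ∪ (fun t => mv (sw c d t) p k) '' B := by
      rintro f ⟨hf, hfk⟩
      obtain ⟨t, ht, hft⟩ := (hmemY f).1 hf
      rw [hL] at hft
      have hjk : j t = k := (apply_of_mem_lk hft).symm.trans hfk
      obtain ⟨htd, hft⟩ := mem_lk hft
      have htB : t ∈ B := by rw [hB]; exact ⟨hTx ht, htd, hjk⟩
      rw [hjk] at hft
      exact hft.imp (fun hf => ⟨t, htB, hf.symm⟩) fun hf => ⟨t, htB, hf.symm⟩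
    have h1 := (Set.ncard_le_ncard hsub).trans (Set.ncard_union_le _ _)
    have h2 := Set.ncard_image_le (s := B) (f := fun t => mv t p k) (Set.toFinite _)
    have h3 := Set.ncard_image_le (s := B) (f := fun t => mv (sw c d t) p k) (Set.toFinite _)
    omega
  have hRconn : (arr P Q).ConnOn R := by
    rw [hR]
    refine connOn_star h p (c := k₀) (by simp [hk₀c, hk₀d]) (fun k _ => ?_) fun k _ _ => ?_
    · refine connOn_Cp h (by omega) p k Y (lt_of_le_of_lt (hYk k) (by omega))
    · rw [Set.inter_union_distrib_left]
      refine lt_of_le_of_lt (Set.ncard_union_le _ _) (lt_of_le_of_lt ?_ (lt_factorial' hP))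
      have := hYk k
      have := hYk k₀
      omega
  have hRhub : (arr P Q).IsHub {x, y, z} R := by
    refine ⟨hRconn, ?_, ?_⟩
    · rw [Set.disjoint_left]
      rintro f (rfl | rfl | rfl) hf
      · exact (hRp _ hf).1 hx
      · exact (hRp _ hf).1 hy
      · exact (hRp _ hf).2 hz
    · have hmemR : ∀ (s : P ↪ Q) k, Free s k → k ≠ c → k ≠ d →
          (∀ t ∈ T, mv s p k ∉ lk p c d (j t) t) → ∃ w ∈ R, (arr P Q).Adj s w := by
        intro s k hk hkc hkd hs
        refine ⟨mv s p k, ?_, adj_mv hk p⟩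
        rw [hR]
        refine ⟨by simp [hkc, hkd], fun hm => ?_⟩
        obtain ⟨t, ht, hm⟩ := (hmemY _).1 hm
        exact hs t ht (hL t ▸ hm)
      rintro s (rfl | rfl | rfl)
      · refine hmemR s k₀ hk₀ hk₀c hk₀d fun t ht hm => ?_
        obtain ⟨rfl, h1, h2⟩ := eq_of_mem_lk_left hcd (hTp t ht) (hjT t ht) hx hk₀ hm
        exact hk₀j h2 h1
      · obtain ⟨k, hk, hkd⟩ := exists_free_ne h s d
        refine hmemR s k hk (fun h => hk p (hy.trans h.symm)) hkd fun t ht hm => ?_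
        obtain ⟨rfl, -⟩ := eq_of_mem_lk_left hcd (hTp t ht) (hjT t ht) hy hk hm
        exact hyT ht
      · by_cases hzT : ∃ t ∈ T, s = sw c d t ∧ ¬ Free t d
        · obtain ⟨t, ht, rfl, htd⟩ := hzT
          obtain ⟨k, hk, hkj⟩ := exists_free_ne h (sw c d t) (j t)
          obtain ⟨q, hq⟩ := not_free_iff.1 htd
          refine hmemR _ k hk (fun h => hk q ?_) (fun h => hk p (hz.trans h.symm))
            fun u hu hm => ?_
          · rw [h]; exact sw_of_eq_right hq
          · obtain ⟨h1, h2, -⟩ := eq_of_mem_lk_right hcd (hTp u hu) (hjT u hu) hz hk hm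
            rw [sw_injective c d h1] at hkj
            exact hkj h2
        · obtain ⟨k, hk, hkc⟩ := exists_free_ne h s c
          refine hmemR _ k hk hkc (fun h => hk p (hz.trans h.symm)) fun u hu hm => ?_
          obtain ⟨h1, h2, h3⟩ := eq_of_mem_lk_right hcd (hTp u hu) (hjT u hu) hz hk hm
          exact hzT ⟨u, hu, h1, h3⟩
  -- the hubs through the neighbours of `x`
  have hhub : ∀ t ∈ X, (arr P Q).IsHub {x, y, z} (F t ∪ L t ∪ E t) := by
    intro t ht
    obtain ⟨h1, h2, h3, h4, v, hv, hyv⟩ := hF t ht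
    obtain ⟨e1, e2, e3⟩ := hE t (hXT ht)
    have hl := connOn_union_lk hcd (hTp t (hXT ht)) (hjT t (hXT ht)) h1 h2
    rw [← hL] at hl
    obtain ⟨hconn, w, hw, hzw⟩ := e3 _ hl.1 hl.2
    refine ⟨hconn, ?_, ?_⟩
    · rw [Set.disjoint_left]
      rintro f (rfl | rfl | rfl) ((hf | hf) | hf)
      · exact (h3 hf).2 rfl
      · exact (hLp t (hXT ht) _ hf).1 hx
      · exact hcd (hx.symm.trans (e1 _ hf))
      · exact h4 hf
      · exact (hLp t (hXT ht) _ hf).1 hy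
      · exact hcd (hy.symm.trans (e1 _ hf))
      · exact hcd ((h3 hf).1.symm.trans hz)
      · exact (hLp t (hXT ht) _ hf).2 hz
      · exact e2 hf
    · rintro s (rfl | rfl | rfl)
      · exact ⟨t, Or.inl (Or.inl h2), adj_of_mem_nbr (hX ▸ ht : t ∈ nbr s {p}ᶜ \ {y}).1⟩
      · exact ⟨v, Or.inl (Or.inl hv), hyv⟩
      · exact ⟨w, hw, hzw⟩
  have hdisj : ∀ s ∈ X, ∀ t ∈ X, s ≠ t → Disjoint (F s ∪ L s ∪ E s) (F t ∪ L t ∪ E t) := by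
    intro s hs t ht hst
    have key : ∀ t ∈ X, ∀ f ∈ F t ∪ L t ∪ E t, (f p = c ∧ f ∈ F t) ∨
        (f p ≠ c ∧ f p ≠ d ∧ f ∈ L t) ∨ (f p = d ∧ f ∈ E t) := by
      rintro t ht f ((hf | hf) | hf)
      · exact Or.inl ⟨((hF t ht).2.2.1 hf).1, hf⟩
      · exact Or.inr (Or.inl ⟨(hLp t (hXT ht) f hf).1, (hLp t (hXT ht) f hf).2, hf⟩)
      · exact Or.inr (Or.inr ⟨(hE t (hXT ht)).1 f hf, hf⟩)
    have d1 := Set.disjoint_left.1 (hFd s hs t ht hst)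
    have d2 := Set.disjoint_left.1 (hLd s (hXT hs) t (hXT ht) hst)
    have d3 := Set.disjoint_left.1 (hEd s (hXT hs) t (hXT ht) hst)
    rw [Set.disjoint_left]
    intro f hf hf'
    have k1 := key s hs f hf
    have k2 := key t ht f hf'
    have := @d1 f
    have := @d2 f
    have := @d3 f
    clear * - k1 k2 hcd this d1 d2 d3
    grind
  have hRd : ∀ t ∈ T, Disjoint R (F t ∩ Cp p c ∪ L t ∪ E t) := by
    intro t ht
    rw [Set.disjoint_left]
    rintro f hf ((hf' | hf') | hf')
    · exact (hRp f hf).1 hf'.2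
    · rw [hR] at hf
      exact hf.2 ((hmemY f).2 ⟨t, ht, hf'⟩)
    · exact (hRp f hf).2 ((hE t ht).1 f hf')
  have hRd' : ∀ t ∈ X, Disjoint R (F t ∪ L t ∪ E t) := fun t ht => by
    have := hRd t (hXT ht)
    rwa [Set.inter_eq_left.2 fun f hf => ((hF t ht).2.2.1 hf).1] at this
  obtain ⟨B, hBn, hBs⟩ : ∃ B : Option X → Set (P ↪ Q), B none = R ∧
      ∀ t : X, B (some t) = F t ∪ L t ∪ E t := ⟨fun o => o.elim R fun t => F t ∪ L t ∪ E t,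
        rfl, fun _ => rfl⟩
  have hBhub : ∀ a, (arr P Q).IsHub {x, y, z} (B a) := by
    rintro (_ | t)
    · rwa [hBn]
    · rw [hBs]; exact hhub t t.2
  have hBd : ∀ a b, a ≠ b → Disjoint (B a) (B b) := by
    rintro (_ | s) (_ | t) hne
    · exact (hne rfl).elim
    · rw [hBn, hBs]; exact hRd' t t.2
    · rw [hBn, hBs]; exact (hRd' s s.2).symm
    · rw [hBs, hBs]; exact hdisj s s.2 t t.2 fun he => hne (by rw [Subtype.ext he])
  have hcardO : Nat.card (Option X) = X.ncard + 1 := by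
    rw [Finite.card_option, Nat.card_coe_set_eq]
  by_cases hadj : (arr P Q).Adj x y
  · have hxT : x ∈ T := by rw [hT]; exact Or.inr ⟨rfl, hadj⟩
    have hxX : ∀ t ∈ X, x ≠ t := fun t ht he => by
      have := hX ▸ ht
      exact (adj_of_mem_nbr this.1).ne he
    obtain ⟨e1, e2, e3⟩ := hE x hxT
    have hl := connOn_union_lk hcd (hTp x hxT) (hjT x hxT)
      ((connOn_singleton (G := arr P Q) y).insert ⟨y, rfl, hadj.symm⟩) (Set.mem_insert x {y})
    rw [← hL] at hl
    obtain ⟨hconn, w, hw, hzw⟩ := e3 _ hl.1 hl.2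
    have hconn' : (arr P Q).ConnOn ({x, y, z} ∪ (L x ∪ E x)) := by
      convert hconn.insert ⟨w, hw, hzw.symm⟩ using 1
      ext f
      simp only [Set.mem_union, Set.mem_insert_iff, Set.mem_singleton_iff]
      tauto
    have hdS : Disjoint {x, y, z} (L x ∪ E x) := by
      rw [Set.disjoint_left]
      rintro f (rfl | rfl | rfl) (hf | hf)
      · exact (hLp _ hxT _ hf).1 hx
      · exact hcd (hx.symm.trans (e1 _ hf))
      · exact (hLp _ hxT _ hf).1 hy
      · exact hcd (hy.symm.trans (e1 _ hf))
      · exact (hLp _ hxT _ hf).2 hz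
      · exact e2 hf
    refine ((goodIn_unit hconn' hdS).sum B hBhub hBd ?_).of_card ?_
    · rintro (_ | t)
      · rw [hBn]
        exact ((hRd x hxT).mono_right (by grind)).symm
      · rw [hBs]
        have d2 := Set.disjoint_left.1 (hLd x hxT t (hXT t.2) (hxX t t.2))
        have d3 := Set.disjoint_left.1 (hEd x hxT t (hXT t.2) (hxX t t.2))
        rw [Set.disjoint_left]
        rintro f (hf | hf) ((hf' | hf') | hf')
        · exact (hLp _ hxT _ hf).1 ((hF t t.2).2.2.1 hf').1
        · exact d2 hf hf'
        · exact (hLp _ hxT _ hf).2 ((hE t (hXT t.2)).1 f hf')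
        · exact hcd (((hF t t.2).2.2.1 hf').1.symm.trans (e1 f hf))
        · exact (hLp _ (hXT t.2) _ hf').2 (e1 f hf)
        · exact d3 hf hf'
    · rw [if_pos hadj] at hXcard
      rw [Nat.card_sum, hcardO]
      simp only [Nat.card_unique]
      omega
  · refine (goodIn_of_hubs B hBhub hBd).of_card ?_
    rw [if_neg hadj] at hXcard
    omega

end Arr

/-! ### Attaching a vertex to hubs -/

namespace Arr

open SimpleGraph

variable {P Q : Type} [Finite P] [Finite Q]

/-- Extend disjoint connected sets inside the copy of `s` so that `s` is joined to all of them. -/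
lemma exists_attach (h : Nat.card Q = Nat.card P + 2) (hP : 3 ≤ Nat.card P) {p : P} {c : Q}
    {s : P ↪ Q} (hs : s p = c) {ι : Type} [Finite ι] (hι : Nat.card ι = 2 * Nat.card P - 1)
    {H : ι → Set (P ↪ Q)} (hH : ∀ a, (arr P Q).ConnOn (H a))
    (hd : ∀ a b, a ≠ b → Disjoint (H a) (H b)) (hsH : ∀ a, s ∉ H a) {t : ι → P ↪ Q}
    (htc : ∀ a, t a p = c) (htinj : Function.Injective t)
    (hta : ∀ a, t a ∈ H a ∨ ∃ v ∈ H a, (arr P Q).Adj (t a) v)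
    (hHt : ∀ a, ∀ f ∈ H a, f p = c → f = t a) {a₀ : ι} (ha₀ : ∀ f ∈ H a₀, f p ≠ c)
    (hadj : ∃ v ∈ H a₀, (arr P Q).Adj s v) :
    ∃ H' : ι → Set (P ↪ Q), (∀ a, H a ⊆ H' a) ∧
      (∀ a, ∀ f ∈ H' a, f ∈ H a ∨ (f p = c ∧ f ≠ s)) ∧
      (∀ a, (arr P Q).ConnOn (H' a)) ∧ (∀ a b, a ≠ b → Disjoint (H' a) (H' b)) ∧
      (∀ a, ∃ v ∈ H' a, (arr P Q).Adj s v) ∧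
      ∀ f, f p = c → f ≠ s → ∃ a, a ≠ a₀ ∧ f ∈ H' a := by
  classical
  obtain ⟨X, hX⟩ : ∃ X, X = t '' {a | a ≠ a₀ ∧ t a ≠ s} := ⟨_, rfl⟩
  have hXcard : X.ncard ≤ 2 * (Nat.card P - 1) := by
    have h1 : ({a₀}ᶜ : Set ι).ncard = 2 * (Nat.card P - 1) := by
      rw [Set.ncard_compl, Set.ncard_singleton]
      omega
    rw [← h1, hX]
    exact (Set.ncard_image_le (Set.toFinite _)).trans (Set.ncard_le_ncard fun a ha => ha.1)
  obtain ⟨F, hF, hFd⟩ := exists_fan_Cp h (by omega) hs (A := ∅) (X := X) (by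
      rw [hX]
      rintro _ ⟨a, -, rfl⟩
      exact ⟨htc a, by simp⟩) (by simp) (by
      rw [hX]
      rintro ⟨a, ha, has⟩
      exact ha.2 has) (by simpa using hXcard)
  have hmem : ∀ a, a ≠ a₀ → t a ≠ s → t a ∈ X := fun a h1 h2 => hX ▸ ⟨a, ⟨h1, h2⟩, rfl⟩
  have hne : Nonempty {a // a ≠ a₀ ∧ t a ≠ s} := by
    by_contra hno
    have hsub : (Set.univ : Set ι) ⊆ {a₀} ∪ {a | t a = s} := by
      intro a _
      by_contra ha
      exact hno ⟨⟨a, fun h1 => ha (Or.inl h1), fun h2 => ha (Or.inr h2)⟩⟩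
    have h1 := (Set.ncard_le_ncard hsub).trans (Set.ncard_union_le _ _)
    have h2 : {a | t a = s}.ncard ≤ 1 :=
      Set.ncard_le_one_iff_subsingleton.2 fun a ha b hb =>
      htinj (Eq.trans ha (Eq.symm hb))
    rw [Set.ncard_univ, Set.ncard_singleton] at h1
    omega
  have hU : (arr P Q).ConnOn (Cp p c \ {s}) := by
    refine connOn_Cp h (by omega) p c _ ?_
    have := Set.ncard_le_ncard (Set.inter_subset_left (s := {s}) (t := Cp p c))
    rw [Set.ncard_singleton] at this
    omega
  obtain ⟨B, hB1, hB2, hB3, hB4, hB5⟩ := hU.exists_partition (ι := {a // a ≠ a₀ ∧ t a ≠ s})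
    (fun a => F (t a)) (fun a => (hF _ (hmem a a.2.1 a.2.2)).1)
    (fun a f hf => by
      obtain ⟨-, -, h3, h4, -⟩ := hF _ (hmem a a.2.1 a.2.2)
      refine ⟨(h3 hf).1, ?_⟩
      rintro rfl
      exact h4 hf)
    (fun a b hab => hFd _ (hmem a a.2.1 a.2.2) _ (hmem b b.2.1 b.2.2)
      (htinj.ne fun hab' => hab (Subtype.ext hab')))
  obtain ⟨H', hH'1, hH'2⟩ : ∃ H' : ι → Set (P ↪ Q),
      (∀ a : {a // a ≠ a₀ ∧ t a ≠ s}, H' a = H a ∪ B a) ∧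
      ∀ a, ¬ (a ≠ a₀ ∧ t a ≠ s) → H' a = H a :=
    ⟨fun a => if ha : a ≠ a₀ ∧ t a ≠ s then H a ∪ B ⟨a, ha⟩ else H a,
      fun a => dif_pos a.2, fun a ha => dif_neg ha⟩
  have htB : ∀ a : {a // a ≠ a₀ ∧ t a ≠ s}, t a ∈ B a := fun a =>
    hB1 a (hF _ (hmem a a.2.1 a.2.2)).2.1
  have hout : ∀ a, ¬ (a ≠ a₀ ∧ t a ≠ s) → ∀ f ∈ H a, f p ≠ c := by
    intro a ha f hf hfc
    by_cases h1 : a = a₀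
    · exact ha₀ f (h1 ▸ hf) hfc
    · have h2 : t a = s := by
        by_contra h2
        exact ha ⟨h1, h2⟩
      exact hsH a (by rwa [← h2, ← hHt a f hf hfc])
  have hsub : ∀ a, H a ⊆ H' a := by
    intro a
    by_cases ha : a ≠ a₀ ∧ t a ≠ s
    · rw [hH'1 ⟨a, ha⟩]; exact Set.subset_union_left
    · rw [hH'2 a ha]
  have hHB : ∀ (a : ι) (b : {a // a ≠ a₀ ∧ t a ≠ s}), a ≠ b → Disjoint (H a) (B b) := by
    intro a b hab
    rw [Set.disjoint_left]
    intro f hf hfb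
    have hfc : f p = c := (hB3 b hfb).1
    by_cases ha : a ≠ a₀ ∧ t a ≠ s
    · rw [hHt a f hf hfc] at hfb
      exact Set.disjoint_left.1 (hB4 ⟨a, ha⟩ b fun he => hab (congrArg Subtype.val he))
        (htB ⟨a, ha⟩) hfb
    · exact hout a ha f hf hfc
  refine ⟨H', hsub, ?_, ?_, ?_, ?_, ?_⟩
  · intro a f hf
    by_cases ha : a ≠ a₀ ∧ t a ≠ s
    · rw [hH'1 ⟨a, ha⟩] at hf
      exact hf.imp_right fun hf => hB3 _ hf
    · rw [hH'2 a ha] at hf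
      exact Or.inl hf
  · intro a
    by_cases ha : a ≠ a₀ ∧ t a ≠ s
    · rw [hH'1 ⟨a, ha⟩]
      refine (hH a).union (hB2 _) ?_
      rcases hta a with h1 | ⟨v, hv, hav⟩
      · exact ⟨_, h1, _, htB ⟨a, ha⟩, Or.inl rfl⟩
      · exact ⟨v, hv, _, htB ⟨a, ha⟩, Or.inr hav.symm⟩
    · rw [hH'2 a ha]
      exact hH a
  · intro a b hab
    by_cases ha : a ≠ a₀ ∧ t a ≠ s <;> by_cases hb : b ≠ a₀ ∧ t b ≠ s
    · rw [hH'1 ⟨a, ha⟩, hH'1 ⟨b, hb⟩, Set.disjoint_union_left, Set.disjoint_union_right,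
        Set.disjoint_union_right]
      exact ⟨⟨hd a b hab, hHB a ⟨b, hb⟩ hab⟩, (hHB b ⟨a, ha⟩ hab.symm).symm,
        hB4 _ _ fun he => hab (congrArg Subtype.val he)⟩
    · rw [hH'1 ⟨a, ha⟩, hH'2 b hb, Set.disjoint_union_left]
      exact ⟨hd a b hab, (hHB b ⟨a, ha⟩ hab.symm).symm⟩
    · rw [hH'2 a ha, hH'1 ⟨b, hb⟩, Set.disjoint_union_right]
      exact ⟨hd a b hab, hHB a ⟨b, hb⟩ hab⟩
    · rw [hH'2 a ha, hH'2 b hb]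
      exact hd a b hab
  · intro a
    by_cases h1 : a = a₀
    · obtain ⟨v, hv, hsv⟩ := hadj
      exact ⟨v, hsub a (h1 ▸ hv), hsv⟩
    by_cases h2 : t a = s
    · rcases hta a with h3 | ⟨v, hv, hav⟩
      · exact (hsH a (h2 ▸ h3)).elim
      · exact ⟨v, hsub a hv, h2 ▸ hav⟩
    · obtain ⟨-, -, -, -, v, hv, hsv⟩ := hF _ (hmem a h1 h2)
      exact ⟨v, by rw [hH'1 ⟨a, h1, h2⟩]; exact Or.inr (hB1 ⟨a, h1, h2⟩ hv), hsv⟩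
  · intro f hfc hfs
    obtain ⟨a, ha⟩ := hB5 f ⟨hfc, hfs⟩
    exact ⟨a, a.2.1, by rw [hH'1]; exact Or.inr ha⟩

end Arr

/-! ### Hubs outside three copies -/

namespace Arr

open SimpleGraph

variable {P Q : Type} [Finite P] [Finite Q]

/-- A clique in the copy `j`, changing at `q`, with neighbours in the copies `a`, `b`, `c`. -/
lemma exists_bridge (h : Nat.card Q = Nat.card P + 2) {p q : P} (hq : q ≠ p) {a b c j : Q}
    (hab : a ≠ b) (hac : a ≠ c) (hbc : b ≠ c) (hj : j ∉ ({a, b, c} : Set Q)) :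
    ∃ T : Set (P ↪ Q), (arr P Q).ConnOn T ∧
      (∀ g ∈ T, g p = j ∧ g q ∈ ({a, b, c} : Set Q) ∧
        ∀ r, r ≠ p → r ≠ q → g r ∉ ({a, b, c} : Set Q)) ∧
      ∀ i ∈ ({a, b, c} : Set Q), ∃ u : P ↪ Q, u p = i ∧ Free u j ∧
        (∃ v ∈ T, (arr P Q).Adj u v) ∧ u q ∈ ({a, b, c} : Set Q) ∧
        (∀ r, r ≠ p → r ≠ q → u r ∉ ({a, b, c} : Set Q)) ∧
        ∃ k ∈ ({a, b, c} : Set Q), Free u k := by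
  classical
  simp only [Set.mem_insert_iff, Set.mem_singleton_iff, not_or] at hj ⊢
  obtain ⟨hja, hjb, hjc⟩ := hj
  obtain ⟨g, hg, hgb, hgc⟩ := exists_emb h {p, q} (fun r => if r = p then j else a) (by
      rintro r (rfl | rfl) s (rfl | rfl) hrs
      · rfl
      · simp [hq, hja] at hrs
      · exact (hja (by simpa [hq] using hrs.symm)).elim
      · rfl) hbc (by
      rintro r (rfl | rfl) <;> simp [hq, hab, hjb]) (by
      rintro r (rfl | rfl) <;> simp [hq, hac, hjc])
  have hgp : g p = j := by simpa using hg p (by simp)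
  have hgq : g q = a := by simpa [hq] using hg q (by simp)
  have hgr : ∀ r, r ≠ p → r ≠ q → ¬ (g r = a) ∧ ¬ (g r = b) ∧ ¬ (g r = c) := fun r _ hr =>
    ⟨fun hra => hr (g.injective (hra.trans hgq.symm)), hgb r, hgc r⟩
  obtain ⟨g', hg'⟩ : ∃ g', g' = mv g q b := ⟨_, rfl⟩
  have hg'a : Free g' a := by rw [hg', ← hgq]; exact free_mv_self hgb
  have hg'c : Free g' c := by rw [hg']; exact (free_mv hgb).2 (Or.inl ⟨hgc, hbc.symm⟩)
  have hg'p : g' p = j := by rw [hg', mv_of_ne hgb hq.symm, hgp]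
  have hg'q : g' q = b := by rw [hg', mv_same]
  have hg'r : ∀ r, r ≠ p → r ≠ q → ¬ (g' r = a) ∧ ¬ (g' r = b) ∧ ¬ (g' r = c) := fun r hp hr => by
    rw [hg', mv_of_ne hgb hr]; exact hgr r hp hr
  have key : ∀ f : P ↪ Q, f = g ∨ f = g' → ∀ i k, Free f i → Free f k → i ≠ k →
      (k = a ∨ k = b ∨ k = c) →
      ∃ u : P ↪ Q, u p = i ∧ Free u j ∧ (∃ v ∈ ({g, g'} : Set (P ↪ Q)), (arr P Q).Adj u v) ∧
        (u q = a ∨ u q = b ∨ u q = c) ∧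
        (∀ r, r ≠ p → r ≠ q → ¬ (u r = a) ∧ ¬ (u r = b) ∧ ¬ (u r = c)) ∧
        ∃ k, (k = a ∨ k = b ∨ k = c) ∧ Free u k := by
    intro f hf i k hi hk hik hkabc
    have hfp : f p = j := by rcases hf with rfl | rfl <;> assumption
    have hfq : f q = a ∨ f q = b := by
      rcases hf with rfl | rfl
      · exact Or.inl hgq
      · exact Or.inr hg'q
    have hfr : ∀ r, r ≠ p → r ≠ q → ¬ (f r = a) ∧ ¬ (f r = b) ∧ ¬ (f r = c) := by
      rcases hf with rfl | rfl <;> assumption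
    refine ⟨mv f p i, mv_same _ _ _, hfp ▸ free_mv_self hi, ⟨f, hf, (adj_mv hi p).symm⟩, ?_, ?_, k,
      hkabc, (free_mv hi).2 (Or.inl ⟨hk, hik.symm⟩)⟩
    · rw [mv_of_ne hi hq]
      tauto
    · intro r hrp hrq
      rw [mv_of_ne hi hrp]
      exact hfr r hrp hrq
  refine ⟨{g, g'}, (connOn_singleton g').insert ⟨g', rfl, hg' ▸ (adj_mv hgb q).symm⟩, ?_, ?_⟩
  · rintro f (rfl | rfl)
    · exact ⟨hgp, Or.inl hgq, hgr⟩
    · exact ⟨hg'p, Or.inr (Or.inl hg'q), hg'r⟩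
  · rintro i (rfl | rfl | rfl)
    · exact key g' (Or.inr rfl) _ c hg'a hg'c hac (by simp)
    · exact key g (Or.inl rfl) _ c hgb hgc hbc (by simp)
    · exact key g (Or.inl rfl) _ b hgc hgb hbc.symm (by simp)

/-- The hubs outside the copies `a`, `b`, `c` of the triple, together with a line. -/
lemma exists_cores (h : Nat.card Q = Nat.card P + 2) (hP : 3 ≤ Nat.card P) {p : P} {a b c : Q}
    (hab : a ≠ b) (hac : a ≠ c) (hbc : b ≠ c) {l : P ↪ Q} (hla : l p = a) (hlb : Free l b)
    (hlc : Free l c) :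
    ∃ (ι : Type) (_ : Finite ι) (H : Option ι → Set (P ↪ Q)),
      Nat.card (Option ι) = 2 * Nat.card P - 1 ∧ (∀ o, (arr P Q).ConnOn (H o)) ∧
      (∀ o o', o ≠ o' → Disjoint (H o) (H o')) ∧ H none = {mv l p b, mv l p c} ∧
      (∀ o, ∀ f ∈ H (some o), f p ∉ ({a, b, c} : Set Q)) ∧
      (∀ f : P ↪ Q, f p ∉ ({a, b, c} : Set Q) → ∃ o, f ∈ H (some o)) ∧
      ∀ i ∈ ({a, b, c} : Set Q), ∃ t : Option ι → P ↪ Q, (∀ o, t o p = i) ∧ Function.Injective t ∧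
        (∀ o, t o ∈ H o ∨ ∃ v ∈ H o, (arr P Q).Adj (t o) v) ∧
        ∀ o, ∀ f ∈ H o, f p = i → f = t o := by
  classical
  obtain ⟨q₁, q₂, hq₁, hq₂, hq12⟩ : ∃ q₁ q₂ : P, q₁ ≠ p ∧ q₂ ≠ p ∧ q₁ ≠ q₂ := by
    have h1 : 1 < ({p}ᶜ : Set P).ncard := by
      rw [Set.ncard_compl, Set.ncard_singleton]
      omega
    obtain ⟨q₁, q₂, h1, h2, h3⟩ := (Set.one_lt_ncard_iff (Set.toFinite _)).1 h1
    exact ⟨q₁, q₂, h1, h2, h3⟩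
  obtain ⟨q, hqp, hqinj⟩ : ∃ q : Bool → P, (∀ e, q e ≠ p) ∧ ∀ e e', e ≠ e' → q e ≠ q e' := by
    refine ⟨fun e => if e then q₁ else q₂, ?_, ?_⟩
    · rintro (_ | _) <;> simpa
    · rintro (_ | _) (_ | _) hne
      · exact (hne rfl).elim
      · simpa using hq12.symm
      · simpa using hq12
      · exact (hne rfl).elim
  have hbr := fun (j : ({a, b, c}ᶜ : Set Q)) (e : Bool) =>
    exists_bridge h (hqp e) hab hac hbc (j := (j : Q)) j.2
  choose T hT1 hT2 hT3 using hbr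
  have hpart := fun j : ({a, b, c}ᶜ : Set Q) => ConnOn.exists_partition (U := Cp p (j : Q))
    (by simpa using connOn_Cp h (by omega) p (j : Q) ∅ (by simp; omega)) (T j) (hT1 j)
    (fun e g hg => (hT2 j e g hg).1) (fun e e' hee => Set.disjoint_left.2 fun g hg hg' =>
      (hT2 j e' g hg').2.2 (q e) (hqp e) (hqinj e e' hee) (hT2 j e g hg).2.1)
  choose B hB1 hB2 hB3 hB4 hB5 using hpart
  have hla' : Free (mv l p b) a := hla ▸ free_mv_self hlb
  have hlc' : Free (mv l p b) c := (free_mv hlb).2 (Or.inl ⟨hlc, hbc.symm⟩)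
  refine ⟨({a, b, c}ᶜ : Set Q) × Bool, inferInstance,
    fun o => o.elim {mv l p b, mv l p c} fun s => B s.1 s.2, ?_, ?_, ?_, rfl, ?_, ?_, ?_⟩
  · rw [Finite.card_option, Nat.card_prod, Nat.card_coe_set_eq, Set.ncard_compl,
      Set.ncard_eq_three.2 ⟨a, b, c, hab, hac, hbc, rfl⟩]
    simp only [Nat.card_eq_fintype_card, Fintype.card_bool]
    rw [h]
    omega
  · rintro (_ | ⟨j, e⟩)
    · exact (connOn_singleton _).insert ⟨_, rfl, adj_mv_mv hlc hlb hbc.symm⟩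
    · exact hB2 j e
  · have hnone : ∀ (j : ({a, b, c}ᶜ : Set Q)) e,
        Disjoint ({mv l p b, mv l p c} : Set (P ↪ Q)) (B j e) := by
      intro j e
      rw [Set.disjoint_left]
      rintro f (rfl | rfl) hf
      · exact j.2 (by rw [← show _ = (j : Q) from hB3 j e hf, mv_same]; simp)
      · exact j.2 (by rw [← show _ = (j : Q) from hB3 j e hf, mv_same]; simp)
    rintro (_ | ⟨j, e⟩) (_ | ⟨j', e'⟩) hne
    · exact (hne rfl).elim
    · exact hnone j' e'
    · exact (hnone j e).symm
    · by_cases hjj : j = j'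
      · subst hjj
        refine hB4 j e e' ?_
        rintro rfl
        exact hne rfl
      · exact (disjoint_Cp fun he => hjj (Subtype.ext he)).mono (hB3 j e) (hB3 j' e')
  · rintro ⟨j, e⟩ f hf
    rw [show f p = (j : Q) from hB3 j e hf]
    exact j.2
  · intro f hf
    obtain ⟨e, he⟩ := hB5 ⟨f p, hf⟩ f rfl
    exact ⟨(⟨f p, hf⟩, e), he⟩
  · intro i hi
    choose u hu1 hu2 hu3 hu4 hu5 hu6 using fun j e => hT3 j e i hi
    have hlr : ∀ r, r ≠ p → l r ∉ ({a, b, c} : Set Q) := by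
      rintro r hr (hra | hrb | hrc)
      · exact hr (l.injective (hra.trans hla.symm))
      · exact hlb r hrb
      · exact hlc r hrc
    obtain ⟨w, hwp, hwr, hw1, hw2⟩ : ∃ w : P ↪ Q, w p = i ∧
        (∀ r, r ≠ p → w r ∉ ({a, b, c} : Set Q)) ∧
        (w ∈ ({mv l p b, mv l p c} : Set (P ↪ Q)) ∨
          ∃ v ∈ ({mv l p b, mv l p c} : Set (P ↪ Q)), (arr P Q).Adj w v) ∧
        ∀ f ∈ ({mv l p b, mv l p c} : Set (P ↪ Q)), f p = i → f = w := by
      rcases hi with rfl | rfl | rfl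
      · refine ⟨l, hla, hlr, Or.inr ⟨_, Or.inl rfl, adj_mv hlb p⟩, ?_⟩
        rintro f (rfl | rfl) hf
        · rw [mv_same] at hf; exact (hab hf.symm).elim
        · rw [mv_same] at hf; exact (hac hf.symm).elim
      · refine ⟨mv l p i, mv_same _ _ _, fun r hr => ?_, Or.inl (Or.inl rfl), ?_⟩
        · rw [mv_of_ne hlb hr]; exact hlr r hr
        · rintro f (rfl | rfl) hf
          · rfl
          · rw [mv_same] at hf; exact (hbc hf.symm).elim
      · refine ⟨mv l p i, mv_same _ _ _, fun r hr => ?_, Or.inl (Or.inr rfl), ?_⟩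
        · rw [mv_of_ne hlc hr]; exact hlr r hr
        · rintro f (rfl | rfl) hf
          · rw [mv_same] at hf; exact (hbc hf).elim
          · rfl
    refine ⟨fun o => o.elim w fun s => u s.1 s.2, ?_, ?_, ?_, ?_⟩
    · rintro (_ | ⟨j, e⟩)
      · exact hwp
      · exact hu1 j e
    · rintro (_ | ⟨j, e⟩) (_ | ⟨j', e'⟩) hee
      · rfl
      · exact (hwr (q e') (hqp e') ((show w = u j' e' from hee) ▸ hu4 j' e')).elim
      · exact (hwr (q e) (hqp e) ((show u j e = w from hee) ▸ hu4 j e)).elim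
      · have hee : u j e = u j' e' := hee
        have he : e = e' := by
          by_contra hne
          exact hu5 j' e' (q e) (hqp e) (hqinj e e' hne) (hee ▸ hu4 j e)
        subst he
        obtain ⟨k, hk, hfk⟩ := hu6 j e
        rcases free_unique h hfk (hu2 j e) (hee ▸ hu2 j' e) (fun hkj => j.2 (hkj ▸ hk)) with hj | hj
        · exact (j'.2 (hj ▸ hk)).elim
        · rw [Subtype.ext hj]
    · rintro (_ | ⟨j, e⟩)
      · exact hw1
      · obtain ⟨v, hv, huv⟩ := hu3 j e
        exact Or.inr ⟨v, hB1 j e hv, huv⟩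
    · rintro (_ | ⟨j, e⟩) f hf hfi
      · exact hw2 f hf hfi
      · exact (j.2 (by rw [← show f p = (j : Q) from hB3 j e hf, hfi]; exact hi)).elim

end Arr

/-! ### Three vertices in distinct copies -/

namespace Arr

open SimpleGraph

variable {P Q : Type} [Finite P] [Finite Q]

/-- Three vertices of distinct copies, where `x` is the base vertex `l` of the line or all three have
a neighbour outside the three copies. -/
lemma goodIn_of_line (h : Nat.card Q = Nat.card P + 2) (hP : 3 ≤ Nat.card P) {p : P} {a b c : Q}
    (hab : a ≠ b) (hac : a ≠ c) (hbc : b ≠ c) {l x y z : P ↪ Q} (hla : l p = a) (hlb : Free l b)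
    (hlc : Free l c) (hx : x p = a) (hy : y p = b) (hz : z p = c) (hly : mv l p b ≠ y)
    (hlz : mv l p c ≠ z) (hxk : x = l ∨ ∃ k ∉ ({a, b, c} : Set Q), Free x k)
    (hyk : x = l ∨ ∃ k ∉ ({a, b, c} : Set Q), Free y k)
    (hzk : x = l ∨ ∃ k ∉ ({a, b, c} : Set Q), Free z k) :
    (arr P Q).GoodIn {x, y, z} Set.univ (Fin (2 * Nat.card P - 1)) := by
  obtain ⟨ι, _, H, hcard, hH, hd, hnone, hsome, hcov, ht⟩ :=
    exists_cores h hP hab hac hbc hla hlb hlc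
  have hnone' : ∀ f ∈ H none, f = mv l p b ∨ f = mv l p c := fun f hf => by
    rw [hnone] at hf
    exact hf
  have hHa : ∀ o, ∀ f ∈ H o, f p ≠ a := by
    rintro (_ | o) f hf hfa
    · rcases hnone' f hf with rfl | rfl
      · rw [mv_same] at hfa; exact hab hfa.symm
      · rw [mv_same] at hfa; exact hac hfa.symm
    · exact hsome o f hf (by simp [hfa])
  have hHy : ∀ o, y ∉ H o := by
    rintro (_ | o) hf
    · rcases hnone' y hf with rfl | rfl
      · exact hly rfl
      · rw [mv_same] at hy; exact hbc hy.symm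
    · exact hsome o y hf (by simp [hy])
  have hHz : ∀ o, z ∉ H o := by
    rintro (_ | o) hf
    · rcases hnone' z hf with rfl | rfl
      · rw [mv_same] at hz; exact hbc hz
      · exact hlz rfl
    · exact hsome o z hf (by simp [hz])
  have hout : ∀ (f : P ↪ Q) (k : Q), k ∉ ({a, b, c} : Set Q) → Free f k →
      ∃ o, ∃ v ∈ H (some o), (arr P Q).Adj f v := by
    intro f k hk hfk
    obtain ⟨o, ho⟩ := hcov (mv f p k) (by rwa [mv_same])
    exact ⟨o, _, ho, adj_mv hfk p⟩
  obtain ⟨t, ht1, ht2, ht3, ht4⟩ := ht a (by simp)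
  obtain ⟨a₀, ha₀, hadj⟩ : ∃ a₀ : Option ι, (x = l → a₀ = none) ∧
      ∃ v ∈ H a₀, (arr P Q).Adj x v := by
    by_cases hxl : x = l
    · exact ⟨none, fun _ => rfl, mv l p b, by simp [hnone], hxl ▸ adj_mv hlb p⟩
    · obtain ⟨k, hk, hxk⟩ := hxk.resolve_left hxl
      obtain ⟨o, ho⟩ := hout x k hk hxk
      exact ⟨some o, fun h => (hxl h).elim, ho⟩
  obtain ⟨H₁, h₁sub, h₁mem, h₁conn, h₁d, h₁adj, h₁cov⟩ :=
    exists_attach h hP hx hcard hH hd (fun o ho => hHa o x ho hx) ht1 ht2 ht3 ht4 (hHa a₀) hadj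
  have hstep : ∀ (w : P ↪ Q) (e : Q), w p ≠ a → mv l p (w p) ≠ w → w p ≠ e → e ≠ a →
      (∀ k, k ≠ w p → k ≠ e → k ≠ a → k ∉ ({a, b, c} : Set Q)) →
      (x = l ∨ ∃ k ∉ ({a, b, c} : Set Q), Free w k) →
      ∃ o, ∃ v ∈ H₁ (some o), (arr P Q).Adj w v := by
    intro w e hwa hlw hwe hea hk hwk
    by_cases hw : ∃ k ∉ ({a, b, c} : Set Q), Free w k
    · obtain ⟨k, hk, hwk⟩ := hw
      obtain ⟨o, v, hv, hwv⟩ := hout w k hk hwk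
      exact ⟨o, v, h₁sub _ hv, hwv⟩
    · have hxl := hwk.resolve_right hw
      obtain ⟨k, hwk', hke⟩ := exists_free_ne h w e
      have hka : k = a := by
        by_contra hka
        exact hw ⟨k, hk k (hwk' p).symm hke hka, hwk'⟩
      subst hka
      obtain ⟨o, ho, hmem⟩ := h₁cov (mv w p k) (mv_same _ _ _) (by
        intro he
        apply hlw
        rw [← hxl, ← he]
        exact mv_mv_self hwk')
      rw [ha₀ hxl] at ho
      cases o with
      | none => exact (ho rfl).elim
      | some o => exact ⟨o, _, hmem, adj_mv hwk' p⟩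
  obtain ⟨t', ht1', ht2', ht3', ht4'⟩ := ht b (by simp)
  obtain ⟨o₁, hadj₁⟩ := hstep y c (by rw [hy]; exact hab.symm) (by rwa [hy]) (by rwa [hy]) hac.symm
    (by rw [hy]; intro k h1 h2 h3; simp [h1, h2, h3]) hyk
  obtain ⟨o₂, hadj₂⟩ := hstep z b (by rw [hz]; exact hac.symm) (by rwa [hz])
    (by rw [hz]; exact hbc.symm) hab.symm (by rw [hz]; intro k h1 h2 h3; simp [h1, h2, h3]) hzk
  have hmono : ∀ {A B : Option ι → Set (P ↪ Q)} {s : Option ι → P ↪ Q}, (∀ o, A o ⊆ B o) →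
      (∀ o, s o ∈ A o ∨ ∃ v ∈ A o, (arr P Q).Adj (s o) v) →
      ∀ o, s o ∈ B o ∨ ∃ v ∈ B o, (arr P Q).Adj (s o) v :=
    fun hAB hs o => (hs o).imp (fun h => hAB o h) fun ⟨v, hv, hvs⟩ => ⟨v, hAB o hv, hvs⟩
  obtain ⟨H₂, h₂sub, h₂mem, h₂conn, h₂d, h₂adj, -⟩ :=
    exists_attach h hP hy hcard h₁conn h₁d (fun o ho => by
      rcases h₁mem o y ho with ho | ho
      · exact hHy o ho
      · exact hab (ho.1.symm.trans hy)) ht1' ht2' (hmono h₁sub ht3') (fun o f hf hfb => by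
      rcases h₁mem o f hf with ho | ho
      · exact ht4' o f ho hfb
      · exact (hab (ho.1.symm.trans hfb)).elim) (a₀ := some o₁) (fun f hf hfb => by
      rcases h₁mem _ f hf with ho | ho
      · exact hsome _ f ho (by simp [hfb])
      · exact hab (ho.1.symm.trans hfb)) hadj₁
  obtain ⟨t'', ht1'', ht2'', ht3'', ht4''⟩ := ht c (by simp)
  have h₂mem' : ∀ o, ∀ f ∈ H₂ o, f p = c → f ∈ H o := by
    intro o f hf hfc
    rcases h₂mem o f hf with ho | ho
    · rcases h₁mem o f ho with ho | ho
      · exact ho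
      · exact (hac (ho.1.symm.trans hfc)).elim
    · exact (hbc (ho.1.symm.trans hfc)).elim
  obtain ⟨H₃, h₃sub, h₃mem, h₃conn, h₃d, h₃adj, -⟩ :=
    exists_attach h hP hz hcard h₂conn h₂d (fun o ho => hHz o (h₂mem' o z ho hz)) ht1'' ht2''
      (hmono (fun o => (h₁sub o).trans (h₂sub o)) ht3'')
      (fun o f hf hfc => ht4'' o f (h₂mem' o f hf hfc) hfc) (a₀ := some o₂)
      (fun f hf hfc => hsome _ f (h₂mem' _ f hf hfc) (by simp [hfc]))
      (hadj₂.imp fun v hv => ⟨h₂sub _ hv.1, hv.2⟩)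
  have hdis : ∀ o, ∀ f ∈ H₃ o, f ≠ x ∧ f ≠ y ∧ f ≠ z := by
    intro o f hf
    rcases h₃mem o f hf with hf | hf
    · rcases h₂mem o f hf with hf | hf
      · rcases h₁mem o f hf with hf | hf
        · refine ⟨?_, ?_, ?_⟩ <;> rintro rfl
          · exact hHa o f hf hx
          · exact hHy o hf
          · exact hHz o hf
        · refine ⟨hf.2, ?_, ?_⟩ <;> rintro rfl
          · exact hab (hf.1.symm.trans hy)
          · exact hac (hf.1.symm.trans hz)
      · refine ⟨?_, hf.2, ?_⟩ <;> rintro rfl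
        · exact hab (hx.symm.trans hf.1)
        · exact hbc (hf.1.symm.trans hz)
    · refine ⟨?_, ?_, hf.2⟩ <;> rintro rfl
      · exact hac (hx.symm.trans hf.1)
      · exact hbc (hy.symm.trans hf.1)
  refine (goodIn_of_hubs H₃ (fun o => ⟨h₃conn o, ?_, ?_⟩) h₃d).of_card hcard.ge
  · rw [Set.disjoint_right]
    rintro f hf (rfl | rfl | rfl)
    · exact (hdis o _ hf).1 rfl
    · exact (hdis o _ hf).2.1 rfl
    · exact (hdis o _ hf).2.2 rfl
  · rintro s (rfl | rfl | rfl)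
    · exact (h₁adj o).imp fun v hv => ⟨h₃sub o (h₂sub o hv.1), hv.2⟩
    · exact (h₂adj o).imp fun v hv => ⟨h₃sub o hv.1, hv.2⟩
    · exact h₃adj o

/-- A vertex with no unused symbol outside a triple has exactly the other two unused. -/
lemma free_of_forall (h : Nat.card Q = Nat.card P + 2) {p : P} {a b c : Q} {x : P ↪ Q}
    (hx : x p = a) (hxk : ¬ ∃ k ∉ ({a, b, c} : Set Q), Free x k) : Free x b ∧ Free x c := by
  obtain ⟨k, l, hkl, hf⟩ := exists_free h x
  have key : ∀ k, Free x k → k = b ∨ k = c := by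
    intro k hk
    by_contra hkbc
    refine hxk ⟨k, ?_, hk⟩
    rintro (rfl | hk')
    · exact hk p hx
    · exact hkbc hk'
  have hk := (hf k).2 (Or.inl rfl)
  have hl := (hf l).2 (Or.inr rfl)
  rcases key k hk with rfl | rfl <;> rcases key l hl with rfl | rfl
  · exact (hkl rfl).elim
  · exact ⟨hk, hl⟩
  · exact ⟨hl, hk⟩
  · exact (hkl rfl).elim

/-- The good trees when the three vertices disagree pairwise everywhere. -/
theorem goodIn_of_distinct (h : Nat.card Q = Nat.card P + 2) (hP : 3 ≤ Nat.card P)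
    {x y z : P ↪ Q} (hxy : ∀ q, x q ≠ y q) (hxz : ∀ q, x q ≠ z q) (hyz : ∀ q, y q ≠ z q) :
    (arr P Q).GoodIn {x, y, z} Set.univ (Fin (2 * Nat.card P - 1)) := by
  obtain ⟨p, q, hpq⟩ : ∃ p q : P, p ≠ q := by
    have := (Finite.one_lt_card_iff_nontrivial (α := P)).1 (by omega)
    exact exists_pair_ne P
  have hne : ∀ {f g : P ↪ Q} {k : Q}, Free f k → f q ≠ g q → mv f p k ≠ g := by
    rintro f g k hk hfg rfl
    exact hfg (mv_of_ne hk hpq.symm).symm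
  have hline : ∀ {x y z : P ↪ Q}, (∀ q, x q ≠ y q) → (∀ q, x q ≠ z q) → (∀ q, y q ≠ z q) →
      (¬ ∃ k ∉ ({x p, y p, z p} : Set Q), Free x k) →
      (arr P Q).GoodIn {x, y, z} Set.univ (Fin (2 * Nat.card P - 1)) := by
    intro x y z hxy hxz hyz hx
    obtain ⟨h1, h2⟩ := free_of_forall h rfl hx
    exact goodIn_of_line h hP (hxy p) (hxz p) (hyz p) rfl h1 h2 rfl rfl rfl (hne h1 (hxy q))
      (hne h2 (hxz q)) (Or.inl rfl) (Or.inl rfl) (Or.inl rfl)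
  by_cases hx : ∃ k ∉ ({x p, y p, z p} : Set Q), Free x k
  · by_cases hy : ∃ k ∉ ({x p, y p, z p} : Set Q), Free y k
    · by_cases hz : ∃ k ∉ ({x p, y p, z p} : Set Q), Free z k
      · obtain ⟨l, hl, hlb, hlc⟩ := exists_emb h {p} (fun _ => x p) (by simp) (hyz p)
          (by simpa using hxy p) (by simpa using hxz p)
        have hla : l p = x p := hl p rfl
        refine goodIn_of_line h hP (hxy p) (hxz p) (hyz p) hla hlb hlc rfl rfl rfl ?_ ?_
          (Or.inr hx) (Or.inr hy) (Or.inr hz)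
        · rintro he
          obtain ⟨k, hk, hyk⟩ := hy
          rw [← he, free_mv hlb, hla] at hyk
          rcases hyk with hyk | hyk
          · rcases free_unique h hlb hlc hyk.1 (hyz p) with rfl | rfl <;> simp at hk
          · simp [hyk] at hk
        · rintro he
          obtain ⟨k, hk, hzk⟩ := hz
          rw [← he, free_mv hlc, hla] at hzk
          rcases hzk with hzk | hzk
          · rcases free_unique h hlb hlc hzk.1 (hyz p) with rfl | rfl <;> simp at hk
          · simp [hzk] at hk
      · rw [show ({x, y, z} : Set (P ↪ Q)) = {z, x, y} by ext f; simp; tauto]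
        rw [show ({x p, y p, z p} : Set Q) = {z p, x p, y p} by ext f; simp; tauto] at hz
        exact hline (fun q => (hxz q).symm) (fun q => (hyz q).symm) hxy hz
    · rw [Set.insert_comm] at hy ⊢
      exact hline (fun q => (hxy q).symm) hyz hxz hy
  · exact hline hxy hxz hyz hx

end Arr

/-! ### All triples -/

namespace Arr

open SimpleGraph

/-- Three vertices of the arrangement graph are connected by `2m - 1` internally disjoint trees. -/
theorem goodIn_univ (m : ℕ) : ∀ (P Q : Type) [Finite P] [Finite Q], 1 ≤ m → Nat.card P = m →
    Nat.card Q = m + 2 → ∀ S : Set (P ↪ Q), S.ncard = 3 →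
    (arr P Q).GoodIn S Set.univ (Fin (2 * m - 1)) := by
  induction m with
  | zero => intro P Q _ _ h; omega
  | succ m ih =>
    intro P Q _ _ _ hP hQ S hS
    obtain ⟨x, y, z, hxy, hxz, hyz, rfl⟩ := Set.ncard_eq_three.1 hS
    have h : Nat.card Q = Nat.card P + 2 := by omega
    rcases (by omega : m = 0 ∨ m = 1 ∨ 3 ≤ Nat.card P) with rfl | rfl | hP3
    · have : Subsingleton P := (Nat.card_eq_one_iff_unique.1 hP).1
      obtain ⟨p⟩ := (Nat.card_eq_one_iff_unique.1 hP).2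
      have hc : (arr P Q).ConnOn ({x, y, z} ∪ ∅) := by
        refine connOn_of_clique (by simp) fun f _ g _ hfg =>
          adj_of_eqOn (p := p) hfg fun q hq => (hq (Subsingleton.elim q p)).elim
      obtain ⟨H, W, h1, h2, h3, h4⟩ := goodIn_unit hc (Set.disjoint_empty _)
      exact GoodIn.of_card ⟨H, W, h1, h2, fun _ => Set.subset_univ _, h4⟩ (by simp)
    · exact goodIn_of_card_two hP hQ hS
    · have hpair : ∀ {x y z : P ↪ Q} (p : P), x p = y p → x p ≠ z p → x ≠ y →
          (arr P Q).GoodIn {x, y, z} Set.univ (Fin (2 * (m + 1) - 1)) := by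
        intro x y z p h1 h2 h3
        have := goodIn_of_pair h hP3 h2 rfl h1.symm rfl h3
        rwa [hP] at this
      by_cases hd : (∀ q, x q ≠ y q) ∧ (∀ q, x q ≠ z q) ∧ ∀ q, y q ≠ z q
      · have := goodIn_of_distinct h hP3 hd.1 hd.2.1 hd.2.2
        rwa [hP] at this
      · obtain ⟨p, hp⟩ : ∃ p, x p = y p ∨ x p = z p ∨ y p = z p := by
          by_contra hno
          push Not at hno
          exact hd ⟨fun q => (hno q).1, fun q => (hno q).2.1, fun q => (hno q).2.2⟩
        by_cases h1 : x p = y p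
        · by_cases h2 : x p = z p
          · have hcP := card_ne p
            have hcQ := card_ne (x p)
            have := goodIn_of_same h hP3 p rfl h1.symm h2.symm hxy hxz hyz fun S hS => by
              have := ih {q // q ≠ p} {k // k ≠ x p} (by omega) (by omega) (by omega) S hS
              rwa [show 2 * m - 1 = 2 * Nat.card P - 3 by omega] at this
            rwa [hP] at this
          · exact hpair p h1 h2 hxy
        · by_cases h2 : x p = z p
          · rw [Set.pair_comm]
            exact hpair p h2 h1 hxz
          · rw [Set.insert_comm, Set.pair_comm]
            have h3 : y p = z p := by tauto
            exact hpair p h3 (Ne.symm h1) hyz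

end Arr

/-! ### The alternating group graph -/

/-- An `(r + 1)`-regular graph whose triples are all connected by `r` internally disjoint trees. -/
theorem SimpleGraph.kappa3_eq {V : Type*} [Finite V] {G : SimpleGraph V} {r : ℕ}
    (hdeg : ∀ v, (G.neighborSet v).ncard = r + 1)
    (h : ∀ S : Set V, S.ncard = 3 → ConnectsSet G S r) {x y z : V} (hxy : G.Adj x y)
    (hxz : z ≠ x) (hyz : z ≠ y) : kappa3 G = r := by
  have hle : ∀ S : Set V, S.ncard = 3 → r ≤ treeConn G S := by
    intro S hS
    obtain ⟨u, v, w, huv, -, -, rfl⟩ := Set.ncard_eq_three.1 hS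
    exact le_csSup ⟨r + 1, fun k hk => hdeg u ▸ hk.le_ncard (y := v) (by simp) (by simp) huv⟩
      (h _ hS)
  have hS : ({x, y, z} : Set V).ncard = 3 :=
    Set.ncard_eq_three.2 ⟨x, y, z, hxy.ne, hxz.symm, hyz.symm, rfl⟩
  have hmax : treeConn G {x, y, z} = r := by
    refine le_antisymm (csSup_le ⟨r, h _ hS⟩ fun k hk => ?_) (hle _ hS)
    exact Nat.lt_succ_iff.1 (ConnectsSet.lt_of_adj hxy hxz hyz hk (hdeg x) (hdeg y))
  refine le_antisymm (Nat.sInf_le ⟨_, hS, hmax⟩) (le_csInf ⟨_, _, hS, hmax⟩ ?_)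
  rintro k ⟨T, hT, rfl⟩
  exact hle T hT

/-- An even permutation moving at most two points is trivial. -/
lemma Equiv.Perm.eq_one_of_sign {α : Type*} [Fintype α] [DecidableEq α] {σ : Equiv.Perm α}
    (hσ : Equiv.Perm.sign σ = 1) {a b : α} (hab : a ≠ b)
    (h : ∀ c, c ≠ a → c ≠ b → σ c = c) : σ = 1 := by
  have hmem : ∀ d, d = a ∨ d = b → σ d = a ∨ σ d = b := by
    intro d hd
    by_contra hno
    rw [not_or] at hno
    have hdd : σ d = d := σ.injective (h _ hno.1 hno.2)
    rw [hdd] at hno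
    tauto
  rcases hmem a (Or.inl rfl) with ha | ha
  · have hb : σ b = b := (hmem b (Or.inr rfl)).resolve_left fun hb =>
      hab (σ.injective (ha.trans hb.symm))
    ext c
    by_cases hca : c = a
    · rw [hca, ha]; rfl
    · by_cases hcb : c = b
      · rw [hcb, hb]; rfl
      · rw [h c hca hcb]; rfl
  · have hb : σ b = a := (hmem b (Or.inr rfl)).resolve_right fun hb =>
      hab (σ.injective (ha.trans hb.symm))
    have hs : σ = Equiv.swap a b := by
      ext c
      by_cases hca : c = a
      · rw [hca, ha, Equiv.swap_apply_left]
      · by_cases hcb : c = b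
        · rw [hcb, hb, Equiv.swap_apply_right]
        · rw [h c hca hcb, Equiv.swap_apply_of_ne_of_ne hca hcb]
    rw [hs, Equiv.Perm.sign_swap hab] at hσ
    exact absurd hσ (by decide)

namespace Arr

open SimpleGraph

variable {n : ℕ}

/-- The restriction of an even permutation to the positions other than `0` and `1`. -/
def restr (x : alternatingGroup (Fin n)) : {j : Fin n // 2 ≤ (j : ℕ)} ↪ Fin n :=
  (Function.Embedding.subtype _).trans (x : Equiv.Perm (Fin n)).toEmbedding

lemma restr_apply (x : alternatingGroup (Fin n)) (j : {j : Fin n // 2 ≤ (j : ℕ)}) :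
    restr x j = (x : Equiv.Perm (Fin n)) j := rfl

lemma restr_injective (hn : 3 ≤ n) : Function.Injective (restr (n := n)) := by
  intro x y hxy
  have h1 : (x : Equiv.Perm (Fin n))⁻¹ * y = 1 := by
    refine Equiv.Perm.eq_one_of_sign (a := ⟨0, by omega⟩) (b := ⟨1, by omega⟩) ?_ (by simp) ?_
    · exact Equiv.Perm.mem_alternatingGroup.1 (x⁻¹ * y).2
    · intro c hc0 hc1
      have hc : 2 ≤ (c : ℕ) := by
        simp only [ne_eq, Fin.ext_iff] at hc0 hc1
        omega
      have := DFunLike.congr_fun hxy ⟨c, hc⟩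
      rw [restr_apply, restr_apply] at this
      rw [Equiv.Perm.mul_apply, Equiv.Perm.inv_eq_iff_eq]
      exact this.symm
  exact Subtype.ext (inv_mul_eq_one.1 h1)

lemma restr_surjective (hn : 3 ≤ n) : Function.Surjective (restr (n := n)) := by
  classical
  intro f
  obtain ⟨g, hg⟩ : ∃ g : Equiv.Perm (Fin n), ∀ j : {j : Fin n // 2 ≤ (j : ℕ)}, g j = f j := by
    let e : {j : Fin n // 2 ≤ (j : ℕ)} ≃ {k : Fin n // k ∈ Set.range f} :=
      Equiv.ofInjective f f.injective
    exact ⟨e.extendSubtype, fun j => e.extendSubtype_apply_of_mem _ j.2⟩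
  have h01 : (⟨0, by omega⟩ : Fin n) ≠ ⟨1, by omega⟩ := by simp
  rcases Int.units_eq_one_or (Equiv.Perm.sign g) with hs | hs
  · exact ⟨⟨g, Equiv.Perm.mem_alternatingGroup.2 hs⟩, DFunLike.ext _ _ hg⟩
  · refine ⟨⟨g * Equiv.swap ⟨0, by omega⟩ ⟨1, by omega⟩, Equiv.Perm.mem_alternatingGroup.2 ?_⟩,
      DFunLike.ext _ _ fun j => ?_⟩
    · rw [Equiv.Perm.sign_mul, hs, Equiv.Perm.sign_swap h01]
      decide
    · rw [restr_apply, ← hg j, Equiv.Perm.mul_apply, Equiv.swap_apply_of_ne_of_ne]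
      · rintro h
        have := j.2
        simp [h] at this
      · rintro h
        have := j.2
        simp [h] at this

/-- Even permutations agreeing outside `0`, `1`, `i` differ by a power of a 3-cycle. -/
lemma eq_cycle {α : Type*} [Fintype α] [DecidableEq α] {σ : Equiv.Perm α}
    (hσ : Equiv.Perm.sign σ = 1) {a b i : α} (hab : a ≠ b) (hai : a ≠ i) (hbi : b ≠ i)
    (h : ∀ c, c ≠ a → c ≠ b → c ≠ i → σ c = c) (h1 : σ ≠ 1) :
    σ = Equiv.swap a i * Equiv.swap a b ∨ σ = (Equiv.swap a i * Equiv.swap a b)⁻¹ := by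
  obtain ⟨s, hs⟩ : ∃ s, s = Equiv.swap a i * Equiv.swap a b := ⟨_, rfl⟩
  have hss : Equiv.Perm.sign s = 1 := by
    rw [hs, Equiv.Perm.sign_mul, Equiv.Perm.sign_swap hab, Equiv.Perm.sign_swap hai]
    decide
  have hsa : s a = b := by
    rw [hs, Equiv.Perm.mul_apply, Equiv.swap_apply_left, Equiv.swap_apply_of_ne_of_ne hab.symm hbi]
  have hsi : s i = a := by
    rw [hs, Equiv.Perm.mul_apply, Equiv.swap_apply_of_ne_of_ne hai.symm hbi.symm,
      Equiv.swap_apply_right]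
  have hsc : ∀ c, c ≠ a → c ≠ b → c ≠ i → s c = c := by
    intro c hca hcb hci
    rw [hs, Equiv.Perm.mul_apply, Equiv.swap_apply_of_ne_of_ne hca hcb,
      Equiv.swap_apply_of_ne_of_ne hca hci]
  rw [← hs]
  have hfix : ∀ τ : Equiv.Perm α, Equiv.Perm.sign τ = 1 → τ a = a →
      (∀ c, c ≠ a → c ≠ b → c ≠ i → τ c = c) → τ = 1 := by
    intro τ hτ hτa hτc
    refine Equiv.Perm.eq_one_of_sign hτ hbi fun c hcb hci => ?_
    by_cases hca : c = a
    · rw [hca, hτa]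
    · exact hτc c hca hcb hci
  by_cases ha : σ a = a
  · exact (h1 (hfix σ hσ ha h)).elim
  by_cases hb : σ a = b
  · refine Or.inl (inv_mul_eq_one.1 (hfix (s⁻¹ * σ) ?_ ?_ fun c h2 h3 h4 => ?_)).symm
    · rw [Equiv.Perm.sign_mul, Equiv.Perm.sign_inv, hss, hσ, one_mul]
    · rw [Equiv.Perm.mul_apply, hb, Equiv.Perm.inv_eq_iff_eq, hsa]
    · rw [Equiv.Perm.mul_apply, h c h2 h3 h4, Equiv.Perm.inv_eq_iff_eq, hsc c h2 h3 h4]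
  by_cases hi : σ a = i
  · refine Or.inr (eq_inv_of_mul_eq_one_right (hfix (s * σ) ?_ ?_ fun c h2 h3 h4 => ?_))
    · rw [Equiv.Perm.sign_mul, hss, hσ, one_mul]
    · rw [Equiv.Perm.mul_apply, hi, hsi]
    · rw [Equiv.Perm.mul_apply, h c h2 h3 h4, hsc c h2 h3 h4]
  · exact (ha (σ.injective (h _ ha hb hi))).elim

/-- The alternating group graph is an arrangement graph. -/
noncomputable def altIso (hn : 3 ≤ n) :
    altGroupGraph n hn ≃g arr {j : Fin n // 2 ≤ (j : ℕ)} (Fin n) where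
  toEquiv := Equiv.ofBijective restr ⟨restr_injective hn, restr_surjective hn⟩
  map_rel_iff' := by
    intro x y
    change (arr _ _).Adj (restr x) (restr y) ↔ _
    have key : ∀ x y : alternatingGroup (Fin n), x ≠ y → (∃ i : Fin n, 2 ≤ (i : ℕ) ∧
      ((y : Equiv.Perm (Fin n)) = (x : Equiv.Perm (Fin n)) *
          (Equiv.swap ⟨0, by omega⟩ i * Equiv.swap ⟨0, by omega⟩ ⟨1, by omega⟩) ∨
      (y : Equiv.Perm (Fin n)) = (x : Equiv.Perm (Fin n)) *
          (Equiv.swap ⟨0, by omega⟩ i * Equiv.swap ⟨0, by omega⟩ ⟨1, by omega⟩)⁻¹)) →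
      (arr _ _).Adj (restr x) (restr y) := by
      rintro x y hxy ⟨i, hi, hyi⟩
      refine adj_of_eqOn (p := ⟨i, hi⟩) ((restr_injective hn).ne hxy) ?_
      rintro ⟨j, hj⟩ hji
      have hji : j ≠ i := fun h => hji (Subtype.ext h)
      have hj0 : j ≠ ⟨0, by omega⟩ := by simp only [ne_eq, Fin.ext_iff]; omega
      have hj1 : j ≠ ⟨1, by omega⟩ := by simp only [ne_eq, Fin.ext_iff]; omega
      have hs : (Equiv.swap (⟨0, by omega⟩ : Fin n) i *
          Equiv.swap (⟨0, by omega⟩ : Fin n) ⟨1, by omega⟩ : Equiv.Perm (Fin n)) j = j := by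
        rw [Equiv.Perm.mul_apply, Equiv.swap_apply_of_ne_of_ne hj0 hj1,
          Equiv.swap_apply_of_ne_of_ne hj0 hji]
      rw [restr_apply, restr_apply]
      rcases hyi with hyi | hyi
      · rw [hyi, Equiv.Perm.mul_apply, hs]
      · rw [hyi, Equiv.Perm.mul_apply, Equiv.Perm.inv_eq_iff_eq.2 hs.symm]
    rw [altGroupGraph, fromRel_adj]
    constructor
    · rintro ⟨⟨i, hi⟩, hne, heq⟩
      have hxy : x ≠ y := by
        rintro rfl
        exact hne rfl
      refine ⟨hxy, Or.inl ⟨i, hi, ?_⟩⟩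
      have hi0 : (⟨0, by omega⟩ : Fin n) ≠ i := by simp only [ne_eq, Fin.ext_iff]; omega
      have hi1 : (⟨1, by omega⟩ : Fin n) ≠ i := by simp only [ne_eq, Fin.ext_iff]; omega
      refine (eq_cycle (σ := (x : Equiv.Perm (Fin n))⁻¹ * (y : Equiv.Perm (Fin n)))
        (Equiv.Perm.mem_alternatingGroup.1 (x⁻¹ * y).2) (by simp) hi0 hi1 ?_ fun h =>
        hxy (Subtype.ext (inv_mul_eq_one.1 h))).imp inv_mul_eq_iff_eq_mul.1 inv_mul_eq_iff_eq_mul.1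
      intro c hc0 hc1 hci
      have hc : 2 ≤ (c : ℕ) := by
        simp only [ne_eq, Fin.ext_iff] at hc0 hc1
        omega
      have := heq ⟨c, hc⟩ fun h => hci (congrArg Subtype.val h)
      rw [restr_apply, restr_apply] at this
      rw [Equiv.Perm.mul_apply, Equiv.Perm.inv_eq_iff_eq]
      exact this.symm
    · rintro ⟨hxy, h | h⟩
      · exact key x y hxy h
      · exact (key y x hxy.symm h).symm

lemma card_positions (hn : 3 ≤ n) : Nat.card {j : Fin n // 2 ≤ (j : ℕ)} = n - 2 := by
  have h2 := Fin.card_Ici (⟨2, by omega⟩ : Fin n)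
  rw [Nat.card_eq_fintype_card, Fintype.card_subtype]
  rw [← h2]
  congr 1
  ext j
  simp [Fin.le_def]

end Arr

/-- `κ₃(AG_n) = 2n - 5` for every `n ≥ 3`. -/
theorem stmt_10 (n : ℕ) (hn : 3 ≤ n) :
    kappa3 (altGroupGraph n hn) = 2 * n - 5 := by
  have hP := Arr.card_positions hn
  have h : Nat.card (Fin n) = Nat.card {j : Fin n // 2 ≤ (j : ℕ)} + 2 := by
    rw [hP, Nat.card_eq_fintype_card, Fintype.card_fin]
    omega
  obtain ⟨e⟩ : Nonempty (altGroupGraph n hn ≃g Arr.arr {j : Fin n // 2 ≤ (j : ℕ)} (Fin n)) :=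
    ⟨Arr.altIso hn⟩
  obtain ⟨x⟩ : Nonempty (alternatingGroup (Fin n)) := inferInstance
  obtain ⟨k, l, hkl, hf⟩ := Arr.exists_free h (e x)
  have hk := (hf k).2 (Or.inl rfl)
  have hl := (hf l).2 (Or.inr rfl)
  let p : {j : Fin n // 2 ≤ (j : ℕ)} := ⟨⟨2, by omega⟩, le_rfl⟩
  refine SimpleGraph.kappa3_eq (x := x) (y := e.symm (Arr.mv (e x) p k))
    (z := e.symm (Arr.mv (e x) p l)) (fun v => ?_) (fun S hS => ?_) ?_ ?_ ?_
  · have h1 := Arr.ncard_nbr h (e v) Set.univ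
    rw [Arr.nbr_univ, Set.ncard_univ, hP] at h1
    rw [← Nat.card_coe_set_eq, Nat.card_congr (e.mapNeighborSet v), Nat.card_coe_set_eq, h1]
    omega
  · have h1 := Arr.goodIn_univ (n - 2) _ (Fin n) (by omega) hP (by omega) (e '' S)
      (by rw [Set.ncard_image_of_injective _ e.injective, hS])
    have h2 := (h1.map e.symm.toEmbedding).connectsSet
    rw [← Set.image_comp] at h2
    rw [show 2 * n - 5 = 2 * (n - 2) - 1 by omega]
    convert h2
    ext v
    simp
  · rw [← e.map_rel_iff, e.apply_symm_apply]
    exact Arr.adj_mv hk p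
  · intro he
    exact (Arr.adj_mv hl p).ne ((e.symm_apply_eq.1 he).symm)
  · intro he
    exact (Arr.adj_mv_mv hk hl hkl).ne (e.symm.injective he).symm
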